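/- A(1/8;n) ∼ 4√2·sin(π/8)·cosh(π√(8n−1)/8)/√(8n−1) as n → ∞; that is, the quotient A(1/8;n)·√(8n−1)/(4√2·sin(π/8)·cosh(π√(8n−1)/8)) tends to 1 as n → ∞. -/

import Mathlib

open scoped Classical

/-- The M2-rank of a partition: ⌈ℓ/2⌉ − s, where ℓ is the largest part
(0 for the empty partition) and s is the number of parts. -/
def m2Rank {n : ℕ} (P : n.Partition) : ℤ :=
  (((P.parts.sup + 1) / 2 : ℕ) : ℤ) - (Multiset.card P.parts : ℤ)

/-- A partition has no repeated odd parts. -/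
def NoRepeatedOddParts {n : ℕ} (P : n.Partition) : Prop :=
  ∀ j : ℕ, Odd j → P.parts.count j ≤ 1

/-- `N2 r m n` is the number of partitions of `n` without repeated odd parts whose
M2-rank is congruent to `r` modulo `m`. -/
noncomputable def N2 (r : ℤ) (m n : ℕ) : ℕ :=
  Nat.card {P : n.Partition // NoRepeatedOddParts P ∧ m2Rank P ≡ r [ZMOD (m : ℤ)]}

/-- `Acoef a c n = Σ_{r=0}^{c−1} N2(r,c,n)·e^{2πiar/c}`, the coefficient of `q^n`
in the M2-rank generating function `R2(e^{2πia/c};q)`. -/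
noncomputable def Acoef (a : ℤ) (c n : ℕ) : ℂ :=
  ∑ r ∈ Finset.range c,
    (N2 (r : ℤ) c n : ℂ) * Complex.exp (2 * Real.pi * Complex.I * (a : ℂ) * (r : ℂ) / (c : ℂ))

open Filter Topology
/-- generating function of admissible partitions with `s` parts, all parts at most `2N` -/
noncomputable def bq {R : Type*} [CommRing R] (q : R) : ℕ → ℕ → R
  | 0, 0 => 1
  | 0, _ + 1 => 0
  | _ + 1, 0 => 1
  | N + 1, s + 1 => bq q N (s + 1) + q ^ (2 * N + 1) * bq q N s + q ^ (2 * N + 2) * bq q (N + 1) s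

theorem bq_zero_right {R : Type*} [CommRing R] (q : R) (N : ℕ) : bq q N 0 = 1 := by
  cases N <;> simp [bq]

theorem bq_zero_succ {R : Type*} [CommRing R] (q : R) (s : ℕ) : bq q 0 (s + 1) = 0 := by
  simp [bq]

theorem bq_succ {R : Type*} [CommRing R] (q : R) (N s : ℕ) :
    bq q (N + 1) (s + 1)
      = bq q N (s + 1) + q ^ (2 * N + 1) * bq q N s + q ^ (2 * N + 2) * bq q (N + 1) s := by
  rw [bq]

/-- The second recurrence (subtract two from every part). -/
theorem bq_second {R : Type*} [CommRing R] (q : R) (N s : ℕ) :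
    bq q (N + 1) (s + 1) = q ^ 2 * bq q (N + 1) s + q ^ (2 * s + 2) * bq q N (s + 1)
      + q ^ (2 * s + 1) * bq q N s := by
  induction N generalizing s with
  | zero =>
    cases s with
    | zero => simp [bq]; ring
    | succ s => simp [bq_succ q 0, bq_zero_succ]
  | succ N ih =>
    induction s with
    | zero =>
      have h := ih 0
      simp only [bq_zero_right, mul_zero, zero_add] at h ⊢
      rw [bq_succ q (N + 1) 0]
      have h2 := bq_succ q N 0
      simp only [bq_zero_right, zero_add] at h2 ⊢
      linear_combination h - q ^ 2 * h2
    | succ s ihs =>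
      have h1 := ih (s + 1)
      have h0 := ih s
      have e1 := bq_succ q (N + 1) (s + 1)
      have e2 := bq_succ q (N + 1) s
      have e3 := bq_succ q N (s + 1)
      have e4 := bq_succ q N s
      rw [e1]
      linear_combination h1 + q ^ (2 * N + 3) * h0 + q ^ (2 * N + 4) * ihs - q ^ 2 * e2
        - q ^ (2 * s + 4) * e3 - q ^ (2 * s + 3) * e4

theorem bq_norm_le (q : ℂ) (N s : ℕ) : ‖bq q N s‖ ≤ bq ‖q‖ N s := by
  induction N generalizing s with
  | zero => cases s <;> simp [bq]
  | succ N ih =>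
    induction s with
    | zero => simp [bq]
    | succ s ihs =>
      rw [bq_succ, bq_succ]
      refine (norm_add₃_le).trans ?_
      rw [norm_mul, norm_mul, norm_pow, norm_pow]
      gcongr
      · exact ih _
      · exact ih _

theorem bq_nonneg {r : ℝ} (hr : 0 ≤ r) (N s : ℕ) : 0 ≤ bq r N s := by
  induction N generalizing s with
  | zero => cases s <;> simp [bq]
  | succ N ih =>
    induction s with
    | zero => simp [bq]
    | succ s ihs =>
      rw [bq_succ]
      have := ih (s + 1)
      have := ih s
      positivity

/-- geometric bound -/
theorem bq_le_aux {r : ℝ} (hr : 0 < r) (hr1 : r < 1) (N s : ℕ) :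
    bq r N s ≤ Real.exp (∑ j ∈ Finset.range N, 2 / (1 - r) * r ^ j) * r ^ s := by
  have h1 : 0 < 1 - r := by linarith
  have hC : ∀ N, 1 ≤ Real.exp (∑ j ∈ Finset.range N, 2 / (1 - r) * r ^ j) := by
    intro N
    apply Real.one_le_exp
    apply Finset.sum_nonneg
    intros; positivity
  induction N generalizing s with
  | zero => cases s <;> simp [bq]; positivity
  | succ N ih =>
    induction s with
    | zero => simpa [bq] using hC (N + 1)
    | succ s ihs =>
      rw [bq_succ]
      set C := Real.exp (∑ j ∈ Finset.range N, 2 / (1 - r) * r ^ j) with hCdef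
      have hCs : Real.exp (∑ j ∈ Finset.range (N + 1), 2 / (1 - r) * r ^ j)
          = C * Real.exp (2 / (1 - r) * r ^ N) := by
        rw [Finset.sum_range_succ, Real.exp_add]
      rw [hCs] at ihs ⊢
      set E := Real.exp (2 / (1 - r) * r ^ N) with hE
      have hC0 : 0 < C := Real.exp_pos _
      have a1 := ih (s + 1)
      have a2 := ih s
      have hEge : 1 + 2 / (1 - r) * r ^ N ≤ E := by
        have := Real.add_one_le_exp (2 / (1 - r) * r ^ N); linarith
      have hrN : 0 < r ^ N := by positivity
      have hrN1 : r ^ N ≤ 1 := pow_le_one₀ hr.le hr1.le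
      -- key inequality
      have key : 1 + r ^ (2 * N) + r ^ (2 * N + 1) * E ≤ E := by
        have e1 : r ^ (2 * N) ≤ r ^ N := pow_le_pow_of_le_one hr.le hr1.le (by omega)
        have e2 : r ^ (2 * N + 1) ≤ r * r ^ N := by
          rw [pow_succ]; nlinarith
        have e3 : r ^ (2 * N + 1) ≤ r := by nlinarith
        have hh : (1 + 2 / (1 - r) * r ^ N) * (1 - r ^ (2 * N + 1)) ≤ E * (1 - r ^ (2 * N + 1)) := by
          apply mul_le_mul_of_nonneg_right hEge; linarith
        have hh2 : 2 / (1 - r) * r ^ N * (1 - r) ≤ 2 / (1 - r) * r ^ N * (1 - r ^ (2 * N + 1)) := by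
          apply mul_le_mul_of_nonneg_left (by linarith) (by positivity)
        have hh3 : 2 / (1 - r) * r ^ N * (1 - r) = 2 * r ^ N := by field_simp
        nlinarith
      have hs : 0 < r ^ s := by positivity
      calc _ ≤ C * r ^ (s + 1) + r ^ (2 * N + 1) * (C * r ^ s)
            + r ^ (2 * N + 2) * (C * E * r ^ s) := by gcongr
        _ = C * r ^ (s + 1) * (1 + r ^ (2 * N) + r ^ (2 * N + 1) * E) := by ring
        _ ≤ C * r ^ (s + 1) * E := by gcongr
        _ = _ := by ring

noncomputable def Cb (r : ℝ) : ℝ := Real.exp (2 / (1 - r) * (1 / (1 - r)))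

theorem bq_le {r : ℝ} (hr : 0 < r) (hr1 : r < 1) (N s : ℕ) : bq r N s ≤ Cb r * r ^ s := by
  refine (bq_le_aux hr hr1 N s).trans ?_
  have h1 : 0 < 1 - r := by linarith
  unfold Cb
  gcongr
  rw [← Finset.mul_sum]
  gcongr
  have := geom_sum_mul_neg r N
  rw [le_div_iff₀ h1, this]
  have : 0 < r ^ N := by positivity
  linarith

theorem bq_norm_bound {q : ℂ} (hq : q ≠ 0) (hq1 : ‖q‖ < 1) (N s : ℕ) :
    ‖bq q N s‖ ≤ Cb ‖q‖ * ‖q‖ ^ s :=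
  (bq_norm_le q N s).trans (bq_le (norm_pos_iff.2 hq) hq1 N s)

noncomputable def bz (q : ℂ) (N s : ℤ) : ℂ :=
  if 0 ≤ N ∧ 0 ≤ s then bq q N.toNat s.toNat else 0

theorem bz_coe (q : ℂ) (N s : ℕ) : bz q N s = bq q N s := by simp [bz]
theorem bz_neg_left (q : ℂ) {N : ℤ} (s : ℤ) (h : N < 0) : bz q N s = 0 := by
  rw [bz, if_neg]; omega
theorem bz_neg_right (q : ℂ) (N : ℤ) {s : ℤ} (h : s < 0) : bz q N s = 0 := by
  rw [bz, if_neg]; omega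

theorem bz_norm {q : ℂ} (hq : q ≠ 0) (hq1 : ‖q‖ < 1) (N s : ℤ) :
    ‖bz q N s‖ ≤ Cb ‖q‖ * ‖q‖ ^ s.natAbs := by
  have hC : 0 < Cb ‖q‖ := Real.exp_pos _
  by_cases h : 0 ≤ N ∧ 0 ≤ s
  · obtain ⟨n, rfl⟩ := Int.eq_ofNat_of_zero_le h.1
    obtain ⟨t, rfl⟩ := Int.eq_ofNat_of_zero_le h.2
    have := bq_norm_bound hq hq1 n t
    simpa [bz_coe] using this
  · rw [bz, if_neg h, norm_zero]; positivity

theorem bz_rec1 {q : ℂ} (_hq : q ≠ 0) (N s : ℤ) :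
    bz q N s = q ^ (2 * N) * bz q N (s - 1) + bz q (N - 1) s + q ^ (2 * N - 1) * bz q (N - 1) (s - 1)
      + ((if N = 0 ∧ s = 0 then 1 else 0) - (if N = 0 ∧ s = 1 then 1 else 0)) := by
  rcases lt_trichotomy N 0 with h | rfl | h
  · rw [bz_neg_left q s h, bz_neg_left q _ h, bz_neg_left q s (by omega : N - 1 < 0),
      bz_neg_left q _ (by omega : N - 1 < 0)]
    simp [h.ne]
  · rw [bz_neg_left q s (by omega : (0:ℤ) - 1 < 0), bz_neg_left q _ (by omega : (0:ℤ) - 1 < 0)]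
    have h0 : ((0:ℕ):ℤ) = 0 := rfl
    rcases lt_trichotomy s 0 with h | rfl | h
    · rw [bz_neg_right q _ h, bz_neg_right q _ (by omega : s - 1 < 0)]
      simp [h.ne]; omega
    · rw [bz_neg_right q _ (by omega : (0:ℤ) - 1 < 0)]
      have := bz_coe q 0 0
      simp only [h0] at this
      rw [this]; simp [bq]
    · obtain ⟨t, rfl⟩ : ∃ t : ℕ, s = (t : ℤ) + 1 := ⟨(s - 1).toNat, by omega⟩
      have e1 := bz_coe q 0 (t + 1)
      have e2 := bz_coe q 0 t
      push_cast at e1 e2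
      rw [add_sub_cancel_right, e1, e2, bq_zero_succ]
      cases t with
      | zero => simp [bq]
      | succ t =>
        rw [bq_zero_succ]
        have : ¬ ((t : ℤ) + 1 + 1 = 0) := by omega
        have h3 : ¬ ((t : ℤ) + 1 = 0) := by omega
        simp [this, h3]
  · obtain ⟨n, rfl⟩ : ∃ n : ℕ, N = (n : ℤ) + 1 := ⟨(N - 1).toNat, by omega⟩
    have hn : ¬ ((n : ℤ) + 1 = 0) := by omega
    simp only [hn, false_and, if_false, sub_zero, add_zero, add_sub_cancel_right]
    rcases lt_trichotomy s 0 with h | rfl | h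
    · rw [bz_neg_right q _ h, bz_neg_right q _ h, bz_neg_right q _ (by omega : s - 1 < 0),
        bz_neg_right q _ (by omega : s - 1 < 0)]
      simp
    · rw [bz_neg_right q _ (by omega : (0:ℤ) - 1 < 0), bz_neg_right q _ (by omega : (0:ℤ) - 1 < 0)]
      have e1 := bz_coe q (n + 1) 0
      have e2 := bz_coe q n 0
      push_cast at e1 e2
      rw [e1, e2, bq_zero_right, bq_zero_right]; simp
    · obtain ⟨t, rfl⟩ : ∃ t : ℕ, s = (t : ℤ) + 1 := ⟨(s - 1).toNat, by omega⟩
      have e1 := bz_coe q (n + 1) (t + 1)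
      have e2 := bz_coe q n (t + 1)
      have e3 := bz_coe q n t
      have e4 := bz_coe q (n + 1) t
      push_cast at e1 e2 e3 e4
      rw [add_sub_cancel_right, e1, e2, e3, e4, bq_succ]
      have z1 : q ^ (2 * ((n : ℤ) + 1)) = q ^ (2 * n + 2) := by
        rw [← zpow_natCast]; congr 1
      have z2 : q ^ (2 * ((n : ℤ) + 1) - 1) = q ^ (2 * n + 1) := by
        rw [← zpow_natCast]; congr 1; push_cast; ring
      rw [z1, z2]; ring

theorem bz_rec2 {q : ℂ} (_hq : q ≠ 0) (N s : ℤ) :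
    bz q N s = q ^ 2 * bz q N (s - 1) + q ^ (2 * s) * bz q (N - 1) s
      + q ^ (2 * s - 1) * bz q (N - 1) (s - 1)
      + ((if N = 0 ∧ s = 0 then 1 else 0) - (if N = 0 ∧ s = 1 then q ^ 2 else 0)) := by
  rcases lt_trichotomy N 0 with h | rfl | h
  · rw [bz_neg_left q s h, bz_neg_left q _ h, bz_neg_left q s (by omega : N - 1 < 0),
      bz_neg_left q _ (by omega : N - 1 < 0)]
    simp [h.ne]
  · rw [bz_neg_left q s (by omega : (0:ℤ) - 1 < 0), bz_neg_left q _ (by omega : (0:ℤ) - 1 < 0)]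
    have h0 : ((0:ℕ):ℤ) = 0 := rfl
    rcases lt_trichotomy s 0 with h | rfl | h
    · rw [bz_neg_right q _ h, bz_neg_right q _ (by omega : s - 1 < 0)]
      simp [h.ne]; omega
    · rw [bz_neg_right q _ (by omega : (0:ℤ) - 1 < 0)]
      have := bz_coe q 0 0
      simp only [h0] at this
      rw [this]; simp [bq]
    · obtain ⟨t, rfl⟩ : ∃ t : ℕ, s = (t : ℤ) + 1 := ⟨(s - 1).toNat, by omega⟩
      have e1 := bz_coe q 0 (t + 1)
      have e2 := bz_coe q 0 t
      push_cast at e1 e2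
      rw [add_sub_cancel_right, e1, e2, bq_zero_succ]
      cases t with
      | zero => simp [bq]
      | succ t =>
        rw [bq_zero_succ]
        have : ¬ ((t : ℤ) + 1 + 1 = 0) := by omega
        have h3 : ¬ ((t : ℤ) + 1 = 0) := by omega
        simp [this, h3]
  · obtain ⟨n, rfl⟩ : ∃ n : ℕ, N = (n : ℤ) + 1 := ⟨(N - 1).toNat, by omega⟩
    have hn : ¬ ((n : ℤ) + 1 = 0) := by omega
    simp only [hn, false_and, if_false, sub_zero, add_zero, add_sub_cancel_right]
    rcases lt_trichotomy s 0 with h | rfl | h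
    · rw [bz_neg_right q _ h, bz_neg_right q _ h, bz_neg_right q _ (by omega : s - 1 < 0),
        bz_neg_right q _ (by omega : s - 1 < 0)]
      simp
    · rw [bz_neg_right q _ (by omega : (0:ℤ) - 1 < 0), bz_neg_right q _ (by omega : (0:ℤ) - 1 < 0)]
      have e1 := bz_coe q (n + 1) 0
      have e2 := bz_coe q n 0
      push_cast at e1 e2
      rw [e1, e2, bq_zero_right, bq_zero_right]; simp
    · obtain ⟨t, rfl⟩ : ∃ t : ℕ, s = (t : ℤ) + 1 := ⟨(s - 1).toNat, by omega⟩
      have e1 := bz_coe q (n + 1) (t + 1)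
      have e2 := bz_coe q n (t + 1)
      have e3 := bz_coe q n t
      have e4 := bz_coe q (n + 1) t
      push_cast at e1 e2 e3 e4
      rw [add_sub_cancel_right, e1, e2, e3, e4, bq_second]
      have z1 : q ^ (2 * ((t : ℤ) + 1)) = q ^ (2 * t + 2) := by
        rw [← zpow_natCast]; congr 1
      have z2 : q ^ (2 * ((t : ℤ) + 1) - 1) = q ^ (2 * t + 1) := by
        rw [← zpow_natCast]; congr 1; push_cast; ring
      rw [z1, z2]

theorem summable_natAbs_pow {r : ℝ} (h0 : 0 ≤ r) (h1 : r < 1) :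
    Summable fun s : ℤ => r ^ s.natAbs := by
  rw [summable_int_iff_summable_nat_and_neg]
  constructor <;> simpa using summable_geometric_of_lt_one h0 h1

noncomputable def hq (q : ℂ) (m : ℤ) : ℂ := ∑' s : ℤ, bz q (s + m) s
noncomputable def kq (q : ℂ) (m : ℤ) : ℂ := ∑' s : ℤ, q ^ (2 * (s + m)) * bz q (s + m) s

theorem hq_hasSum {q : ℂ} (hq0 : q ≠ 0) (hq1 : ‖q‖ < 1) (m : ℤ) :
    HasSum (fun s : ℤ => bz q (s + m) s) (hq q m) := by
  apply Summable.hasSum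
  refine Summable.of_norm_bounded ((summable_natAbs_pow (norm_nonneg q) hq1).mul_left (Cb ‖q‖)) ?_
  intro s; exact bz_norm hq0 hq1 _ _

theorem kq_hasSum {q : ℂ} (hq0 : q ≠ 0) (hq1 : ‖q‖ < 1) (m : ℤ) :
    HasSum (fun s : ℤ => q ^ (2 * (s + m)) * bz q (s + m) s) (kq q m) := by
  apply Summable.hasSum
  refine Summable.of_norm_bounded ((summable_natAbs_pow (norm_nonneg q) hq1).mul_left (Cb ‖q‖)) ?_
  intro s
  by_cases h : 0 ≤ s + m
  · refine le_trans ?_ (bz_norm hq0 hq1 (s + m) s)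
    rw [norm_mul]
    apply mul_le_of_le_one_left (norm_nonneg _)
    obtain ⟨n, hn⟩ := Int.eq_ofNat_of_zero_le h
    rw [hn, norm_zpow]
    have : (2 * ((n : ℕ) : ℤ)) = ((2 * n : ℕ) : ℤ) := by push_cast; ring
    rw [this, zpow_natCast]
    exact pow_le_one₀ (norm_nonneg _) hq1.le
  · rw [bz_neg_left q _ (by omega)]
    have : 0 < Cb ‖q‖ := Real.exp_pos _
    simp only [mul_zero, norm_zero]; positivity

theorem hasSum_shift {f : ℤ → ℂ} {a : ℂ} (h : HasSum f a) (g : ℤ → ℂ)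
    (hg : ∀ s, g s = f (s - 1)) : HasSum g a := by
  have := (Equiv.subRight (1 : ℤ)).hasSum_iff.2 h
  convert this using 1
  ext s; simp [hg]

theorem HasSum.congr_fun' {ι α : Type*} [AddCommMonoid α] [TopologicalSpace α] {f g : ι → α}
    {a : α} (h : HasSum f a) (hfg : ∀ i, g i = f i) : HasSum g a := by
  rwa [show g = f from funext hfg]

theorem hasSum_ind (c : ℂ) (m j : ℤ) :
    HasSum (fun s : ℤ => if s + m = 0 ∧ s = j then c else 0) (if j + m = 0 then c else 0) := by
  convert hasSum_ite_eq j (if j + m = 0 then c else 0) using 1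
  ext s
  by_cases h : s = j
  · subst h; simp
  · simp [h]

theorem hq_rel1 {q : ℂ} (hq0 : q ≠ 0) (hq1 : ‖q‖ < 1) (m : ℤ) :
    hq q m = kq q (m + 1) + hq q (m - 1) + q * kq q m
      + ((if 0 + m = 0 then 1 else 0) - (if 1 + m = 0 then 1 else 0)) := by
  refine (hq_hasSum hq0 hq1 m).unique ?_
  have A1 : HasSum (fun s : ℤ => q ^ (2 * (s + m)) * bz q (s + m) (s - 1)) (kq q (m + 1)) := by
    refine hasSum_shift (kq_hasSum hq0 hq1 (m + 1)) _ ?_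
    intro s
    rw [show s - 1 + (m + 1) = s + m by ring]
  have A2 : HasSum (fun s : ℤ => bz q (s + m - 1) s) (hq q (m - 1)) := by
    convert hq_hasSum hq0 hq1 (m - 1) using 3
    ring
  have A3 : HasSum (fun s : ℤ => q ^ (2 * (s + m) - 1) * bz q (s + m - 1) (s - 1)) (q * kq q m) := by
    refine hasSum_shift ((kq_hasSum hq0 hq1 m).mul_left q) _ ?_
    intro s
    rw [show s - 1 + m = s + m - 1 by ring, ← mul_assoc, ← zpow_one_add₀ hq0]
    congr 2; ring
  have := ((A1.add A2).add A3).add ((hasSum_ind 1 m 0).sub (hasSum_ind 1 m 1))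
  convert this using 1
  ext s
  exact bz_rec1 hq0 (s + m) s

theorem hq_rel2 {q : ℂ} (hq0 : q ≠ 0) (hq1 : ‖q‖ < 1) (m : ℤ) :
    hq q m = q ^ 2 * hq q (m + 1) + q ^ (-2 * (m - 1)) * kq q (m - 1) + q ^ (1 - 2 * m) * kq q m
      + ((if 0 + m = 0 then 1 else 0) - (if 1 + m = 0 then q ^ 2 else 0)) := by
  refine (hq_hasSum hq0 hq1 m).unique ?_
  have A1 : HasSum (fun s : ℤ => q ^ 2 * bz q (s + m) (s - 1)) (q ^ 2 * hq q (m + 1)) := by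
    refine hasSum_shift ((hq_hasSum hq0 hq1 (m + 1)).mul_left _) _ ?_
    intro s
    rw [show s - 1 + (m + 1) = s + m by ring]
  have A2 : HasSum (fun s : ℤ => q ^ (2 * s) * bz q (s + m - 1) s)
      (q ^ (-2 * (m - 1)) * kq q (m - 1)) := by
    have h := (kq_hasSum hq0 hq1 (m - 1)).mul_left (q ^ (-2 * (m - 1)))
    refine h.congr_fun' ?_
    intro s
    rw [← mul_assoc, ← zpow_add₀ hq0, show s + (m - 1) = s + m - 1 by ring]
    congr 2; ring
  have A3 : HasSum (fun s : ℤ => q ^ (2 * s - 1) * bz q (s + m - 1) (s - 1))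
      (q ^ (1 - 2 * m) * kq q m) := by
    refine hasSum_shift ((kq_hasSum hq0 hq1 m).mul_left _) _ ?_
    intro s
    rw [show s - 1 + m = s + m - 1 by ring, ← mul_assoc, ← zpow_add₀ hq0]
    congr 2; ring
  have := ((A1.add A2).add A3).add ((hasSum_ind 1 m 0).sub (hasSum_ind (q ^ 2) m 1))
  convert this using 1
  ext s
  exact bz_rec2 hq0 (s + m) s

noncomputable def Xq (q : ℂ) (m : ℤ) : ℂ := hq q m + q ^ (2 * m + 3) * hq q (m + 2)

theorem Xq_step {q : ℂ} (hq0 : q ≠ 0) (hq1 : ‖q‖ < 1) (m : ℤ) :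
    Xq q m - Xq q (m - 1) = (if 0 + m = 0 then 1 else 0) - (if 1 + m = 0 then 1 else 0)
      - q ^ (2 * m + 1) * ((if 1 + m = 0 then 1 else 0) - (if 2 + m = 0 then q ^ 2 else 0)) := by
  have r1 := hq_rel1 hq0 hq1 m
  have r2 := hq_rel2 hq0 hq1 (m + 1)
  rw [show 0 + (m + 1) = 1 + m by ring, show 1 + (m + 1) = 2 + m by ring,
    show m + 1 + 1 = m + 2 by ring, add_sub_cancel_right] at r2
  have z1 : q ^ (2 * m + 1) * q ^ (-2 * m) = q := by
    rw [← zpow_add₀ hq0]; ring_nf; simp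
  have z2 : q ^ (2 * m + 1) * q ^ (1 - 2 * (m + 1)) = 1 := by
    rw [← zpow_add₀ hq0]; ring_nf; simp
  have z3 : q ^ (2 * m + 3) = q ^ (2 * m + 1) * q ^ 2 := by
    rw [show 2 * m + 3 = (2 * m + 1) + 2 by ring, zpow_add₀ hq0]; norm_cast
  unfold Xq
  rw [show 2 * (m - 1) + 3 = 2 * m + 1 by ring, show m - 1 + 2 = m + 1 by ring, z3]
  linear_combination r1 - q ^ (2 * m + 1) * r2 - kq q m * z1 - kq q (m + 1) * z2

noncomputable def Hb (r : ℝ) : ℝ := ∑' s : ℤ, Cb r * r ^ s.natAbs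

theorem hq_bound {q : ℂ} (hq0 : q ≠ 0) (hq1 : ‖q‖ < 1) (m : ℤ) : ‖hq q m‖ ≤ Hb ‖q‖ := by
  unfold hq Hb
  exact tsum_of_norm_bounded ((summable_natAbs_pow (norm_nonneg q) hq1).mul_left (Cb ‖q‖)).hasSum
    (fun s => bz_norm hq0 hq1 _ _)

noncomputable def Pq (q : ℂ) : ℂ := Xq q 0

theorem Xq_nonneg {q : ℂ} (hq0 : q ≠ 0) (hq1 : ‖q‖ < 1) (m : ℕ) : Xq q m = Pq q := by
  induction m with
  | zero => rfl
  | succ m ih =>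
    have h := Xq_step hq0 hq1 ((m : ℤ) + 1)
    rw [if_neg (by omega), if_neg (by omega), if_neg (by omega)] at h
    rw [add_sub_cancel_right, ih] at h
    push_cast
    linear_combination h

theorem Xq_neg_one {q : ℂ} (hq0 : q ≠ 0) (hq1 : ‖q‖ < 1) : Xq q (-1) = Pq q - 1 := by
  have h := Xq_step hq0 hq1 0
  rw [if_pos (by omega), if_neg (by omega), if_neg (by omega)] at h
  norm_num at h
  unfold Pq
  linear_combination -h

theorem Xq_neg_three {q : ℂ} (hq0 : q ≠ 0) (hq1 : ‖q‖ < 1) : Xq q (-3) = Pq q := by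
  have h := Xq_step hq0 hq1 (-1)
  have h2 := Xq_step hq0 hq1 (-2)
  rw [if_neg (by omega), if_pos (by omega), if_neg (by omega)] at h
  rw [if_neg (by omega), if_neg (by omega), if_pos (by omega)] at h2
  have h3 := Xq_neg_one hq0 hq1
  norm_num at h h2
  have e2 : (q ^ 3)⁻¹ * q ^ 2 = q⁻¹ := by field_simp
  rw [e2] at h2
  linear_combination -h2 - h + h3

theorem Xq_neg {q : ℂ} (hq0 : q ≠ 0) (hq1 : ‖q‖ < 1) (k : ℕ) : Xq q (-3 - k) = Pq q := by
  induction k with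
  | zero => simpa using Xq_neg_three hq0 hq1
  | succ m ih =>
    have h := Xq_step hq0 hq1 (-3 - (m : ℤ))
    rw [if_neg (by omega), if_neg (by omega), if_neg (by omega)] at h
    rw [ih, show (-3 - (m : ℤ)) - 1 = -3 - ((m + 1 : ℕ) : ℤ) by push_cast; ring] at h
    linear_combination -h

noncomputable def psi (q : ℂ) (m : ℕ) : ℂ := ∑' j : ℕ, (-1) ^ j * q ^ (2 * j ^ 2 + j + 2 * m * j)

theorem psi_hasSum {q : ℂ} (hq1 : ‖q‖ < 1) (m : ℕ) :
    HasSum (fun j : ℕ => (-1) ^ j * q ^ (2 * j ^ 2 + j + 2 * m * j)) (psi q m) := by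
  apply Summable.hasSum
  refine Summable.of_norm_bounded (summable_geometric_of_lt_one (norm_nonneg q) hq1) ?_
  intro j
  rw [norm_mul, norm_pow, norm_pow, norm_neg, norm_one, one_pow, one_mul]
  apply pow_le_pow_of_le_one (norm_nonneg q) hq1.le
  nlinarith [Nat.zero_le (2 * j ^ 2), Nat.zero_le (2 * m * j)]

theorem psi_bound {q : ℂ} (hq1 : ‖q‖ < 1) (m : ℕ) : ‖psi q m‖ ≤ (1 - ‖q‖)⁻¹ := by
  refine tsum_of_norm_bounded (hasSum_geometric_of_lt_one (norm_nonneg q) hq1) ?_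
  intro j
  rw [norm_mul, norm_pow, norm_pow, norm_neg, norm_one, one_pow, one_mul]
  apply pow_le_pow_of_le_one (norm_nonneg q) hq1.le
  nlinarith [Nat.zero_le (2 * j ^ 2), Nat.zero_le (2 * m * j)]

theorem psi_rec {q : ℂ} (hq1 : ‖q‖ < 1) (m : ℕ) :
    psi q m = 1 - q ^ (2 * m + 3) * psi q (m + 2) := by
  have h := psi_hasSum hq1 m
  rw [← hasSum_nat_add_iff' 1] at h
  have h2 := (psi_hasSum hq1 (m + 2)).mul_left (-(q ^ (2 * m + 3)))
  have := h.unique (h2.congr_fun' (fun j => by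
    rw [pow_succ, show 2 * (j + 1) ^ 2 + (j + 1) + 2 * m * (j + 1)
      = (2 * m + 3) + (2 * j ^ 2 + j + 2 * (m + 2) * j) by ring, pow_add]
    ring))
  simp at this
  linear_combination this

theorem bdd_rec_zero {q : ℂ} (hq1 : ‖q‖ < 1) (e : ℕ → ℂ) (B : ℝ) (m0 : ℕ)
    (hB : ∀ m, m0 ≤ m → ‖e m‖ ≤ B) (he : ∀ m, m0 ≤ m → e m = - q ^ (2 * m + 3) * e (m + 2))
    (m : ℕ) (hm : m0 ≤ m) : e m = 0 := by
  have key : ∀ n m, m0 ≤ m → ‖e m‖ ≤ ‖q‖ ^ n * B := by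
    intro n
    induction n with
    | zero => intro m hm; simpa using hB m hm
    | succ n ih =>
      intro m hm
      rw [he m hm, norm_mul, norm_neg, norm_pow]
      have h1 := ih (m + 2) (by omega)
      have h2 : ‖q‖ ^ (2 * m + 3) ≤ ‖q‖ := by
        calc ‖q‖ ^ (2 * m + 3) ≤ ‖q‖ ^ 1 := pow_le_pow_of_le_one (norm_nonneg q) hq1.le (by omega)
          _ = ‖q‖ := pow_one _
      calc _ ≤ ‖q‖ * (‖q‖ ^ n * B) := by gcongr
        _ = _ := by ring
  have hl : Tendsto (fun n : ℕ => ‖q‖ ^ n * B) atTop (𝓝 0) := by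
    simpa using (tendsto_pow_atTop_nhds_zero_of_lt_one (norm_nonneg q) hq1).mul_const B
  have := ge_of_tendsto' hl (fun n => key n m hm)
  exact norm_le_zero_iff.1 this

theorem hq_nonneg_eq {q : ℂ} (hq0 : q ≠ 0) (hq1 : ‖q‖ < 1) (m : ℕ) :
    hq q m = Pq q * psi q m := by
  have := bdd_rec_zero hq1 (fun m : ℕ => hq q m - Pq q * psi q m)
    (Hb ‖q‖ + ‖Pq q‖ * (1 - ‖q‖)⁻¹) 0 ?_ ?_ m (Nat.zero_le _)
  · linear_combination this
  · intro m _
    refine (norm_sub_le _ _).trans ?_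
    rw [norm_mul]
    gcongr
    · exact hq_bound hq0 hq1 _
    · exact psi_bound hq1 m
  · intro m _
    have h := Xq_nonneg hq0 hq1 m
    unfold Xq at h
    have hz : q ^ (2 * (m : ℤ) + 3) = q ^ (2 * m + 3) := by rw [← zpow_natCast]; congr 1
    rw [hz] at h
    have h2 := psi_rec hq1 m
    push_cast
    linear_combination h - Pq q * h2

theorem hq_neg_rec {q : ℂ} (hq0 : q ≠ 0) (hq1 : ‖q‖ < 1) (k : ℕ) :
    hq q (-(k + 1 : ℕ)) = q ^ (2 * k + 3) * (Pq q - hq q (-(k + 3 : ℕ))) := by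
  have h := Xq_neg hq0 hq1 k
  unfold Xq at h
  rw [show -3 - (k : ℤ) + 2 = -(k + 1 : ℕ) by push_cast; ring,
    show -3 - (k : ℤ) = -(k + 3 : ℕ) by push_cast; ring,
    show 2 * (-((k + 3 : ℕ) : ℤ)) + 3 = -((2 * k + 3 : ℕ) : ℤ) by push_cast; ring, zpow_neg,
    zpow_natCast] at h
  have : q ^ (2 * k + 3) ≠ 0 := pow_ne_zero _ hq0
  field_simp at h
  linear_combination h

theorem hq_neg_eq {q : ℂ} (hq0 : q ≠ 0) (hq1 : ‖q‖ < 1) (k : ℕ) :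
    hq q (-(k + 1 : ℕ)) = Pq q * (q ^ (2 * k + 3) * psi q (k + 2)) := by
  have := bdd_rec_zero hq1 (fun m : ℕ => (Pq q - hq q (-(m + 1 : ℕ))) - Pq q * psi q m)
    ((‖Pq q‖ + Hb ‖q‖) + ‖Pq q‖ * (1 - ‖q‖)⁻¹) 0 ?_ ?_ (k + 2) (Nat.zero_le _)
  · have h := hq_neg_rec hq0 hq1 k
    rw [h]
    simp only [show k + 2 + 1 = k + 3 by ring] at this
    linear_combination q ^ (2 * k + 3) * this
  · intro m _
    refine (norm_sub_le _ _).trans ?_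
    rw [norm_mul]
    gcongr
    · refine (norm_sub_le _ _).trans ?_
      gcongr
      exact hq_bound hq0 hq1 _
    · exact psi_bound hq1 m
  · intro m _
    have h := hq_neg_rec hq0 hq1 m
    have h2 := psi_rec hq1 m
    simp only [show m + 2 + 1 = m + 3 by ring]
    rw [h, h2]
    ring

noncomputable def Thq (q : ℂ) : ℂ := psi q 0 - q * psi q 1

theorem Pq_mul_Thq {q : ℂ} (hq0 : q ≠ 0) (hq1 : ‖q‖ < 1) : Pq q * Thq q = 1 := by
  have h := Xq_neg_one hq0 hq1
  unfold Xq at h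
  have h1 := hq_nonneg_eq hq0 hq1 1
  have h2 := hq_neg_eq hq0 hq1 0
  have h3 := psi_rec hq1 0
  norm_num at h h1 h2 h3
  rw [h1, h2] at h
  unfold Thq
  linear_combination Pq q * h3 - h

theorem Thq_hasSum {q : ℂ} (hq0 : q ≠ 0) (hq1 : ‖q‖ < 1) :
    HasSum (fun n : ℤ => (-1) ^ n * q ^ (2 * n ^ 2 + n)) (Thq q) := by
  have h1 := psi_hasSum hq1 0
  have h2 := (psi_hasSum hq1 1).mul_left (-q)
  have : Thq q = psi q 0 + -q * psi q 1 := by unfold Thq; ring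
  rw [this]
  refine HasSum.of_nat_of_neg_add_one ?_ ?_
  · refine h1.congr_fun' (fun j => ?_)
    rw [zpow_natCast, ← zpow_natCast q]
    congr 2
    push_cast; ring
  · refine h2.congr_fun' (fun j => ?_)
    have e1 : (-1 : ℂ) ^ (-((j : ℤ) + 1)) = (-1) ^ (j + 1) := by
      rw [zpow_neg, ← Nat.cast_succ, zpow_natCast, ← inv_pow]; norm_num
    have e2 : q ^ (2 * (-((j : ℤ) + 1)) ^ 2 + -((j : ℤ) + 1)) = q * q ^ (2 * j ^ 2 + j + 2 * 1 * j) := by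
      rw [← pow_succ', ← zpow_natCast q]; congr 1; push_cast; ring
    rw [e1, e2]; ring

/-! Product formula for `Pq`. -/

theorem bq_summable {q : ℂ} (hq0 : q ≠ 0) (hq1 : ‖q‖ < 1) (N : ℕ) :
    Summable (fun s : ℕ => bq q N s) := by
  refine Summable.of_norm_bounded ((summable_geometric_of_lt_one (norm_nonneg q) hq1).mul_left
    (Cb ‖q‖)) ?_
  intro s; exact bq_norm_bound hq0 hq1 N s

noncomputable def Bq (q : ℂ) (N : ℕ) : ℂ := ∑' s : ℕ, bq q N s

theorem one_sub_pow_ne {q : ℂ} (hq1 : ‖q‖ < 1) (n : ℕ) (hn : n ≠ 0) : 1 - q ^ n ≠ 0 := by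
  intro h
  have : ‖q ^ n‖ = 1 := by rw [← sub_eq_zero.1 h]; simp
  rw [norm_pow] at this
  have h2 := pow_lt_one₀ (norm_nonneg q) hq1 hn
  linarith

theorem Bq_succ {q : ℂ} (hq0 : q ≠ 0) (hq1 : ‖q‖ < 1) (N : ℕ) :
    Bq q (N + 1) * (1 - q ^ (2 * N + 2)) = Bq q N * (1 + q ^ (2 * N + 1)) := by
  have h1 := (bq_summable hq0 hq1 (N + 1)).hasSum
  have h0 := (bq_summable hq0 hq1 N).hasSum
  have h1' := (hasSum_nat_add_iff' 1).2 h1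
  have h0' := (hasSum_nat_add_iff' 1).2 h0
  have := h1'.unique (((h0'.add (h0.mul_left (q ^ (2 * N + 1)))).add
    (h1.mul_left (q ^ (2 * N + 2)))).congr_fun' (fun s => bq_succ q N s))
  simp [bq_zero_right] at this
  unfold Bq
  linear_combination this

theorem Bq_zero (q : ℂ) : Bq q 0 = 1 := by
  unfold Bq
  rw [tsum_eq_single 0]
  · simp [bq]
  · intro s hs
    obtain ⟨t, rfl⟩ := Nat.exists_eq_succ_of_ne_zero hs
    simp [bq]

theorem Bq_eq_prod {q : ℂ} (hq0 : q ≠ 0) (hq1 : ‖q‖ < 1) (N : ℕ) :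
    Bq q N = ∏ j ∈ Finset.range N, ((1 + q ^ (2 * j + 1)) / (1 - q ^ (2 * j + 2))) := by
  induction N with
  | zero => simp [Bq_zero]
  | succ N ih =>
    rw [Finset.prod_range_succ, ← ih, ← mul_div_assoc, eq_div_iff (one_sub_pow_ne hq1 _ (by omega))]
    exact Bq_succ hq0 hq1 N

theorem bq_diff {q : ℂ} (hq0 : q ≠ 0) (hq1 : ‖q‖ < 1) (N s : ℕ) :
    ‖bq q (N + 1) s - bq q N s‖ ≤ 2 * Cb ‖q‖ * ‖q‖ ^ (2 * N + s) := by
  have hC : 0 < Cb ‖q‖ := Real.exp_pos _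
  cases s with
  | zero => simp [bq_zero_right]; positivity
  | succ s =>
    rw [bq_succ, show bq q N (s + 1) + q ^ (2 * N + 1) * bq q N s + q ^ (2 * N + 2) * bq q (N + 1) s
      - bq q N (s + 1) = q ^ (2 * N + 1) * bq q N s + q ^ (2 * N + 2) * bq q (N + 1) s by ring]
    refine (norm_add_le _ _).trans ?_
    rw [norm_mul, norm_mul, norm_pow, norm_pow]
    have h1 := bq_norm_bound hq0 hq1 N s
    have h2 := bq_norm_bound hq0 hq1 (N + 1) s
    have h3 : ‖q‖ ^ (2 * N + 2) ≤ ‖q‖ ^ (2 * N + 1) :=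
      pow_le_pow_of_le_one (norm_nonneg q) hq1.le (by omega)
    calc _ ≤ ‖q‖ ^ (2 * N + 1) * (Cb ‖q‖ * ‖q‖ ^ s) + ‖q‖ ^ (2 * N + 1) * (Cb ‖q‖ * ‖q‖ ^ s) := by
          gcongr
      _ = _ := by rw [show 2 * N + (s + 1) = 2 * N + 1 + s by ring, pow_add]; ring

theorem bq_diff2 {q : ℂ} (hq0 : q ≠ 0) (hq1 : ‖q‖ < 1) (N s k : ℕ) :
    ‖bq q (N + k) s - bq q N s‖ ≤ k * (2 * Cb ‖q‖ * ‖q‖ ^ (2 * N + s)) := by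
  have hC : 0 < Cb ‖q‖ := Real.exp_pos _
  induction k with
  | zero => simp
  | succ k ih =>
    have h := bq_diff hq0 hq1 (N + k) s
    have h2 : ‖q‖ ^ (2 * (N + k) + s) ≤ ‖q‖ ^ (2 * N + s) :=
      pow_le_pow_of_le_one (norm_nonneg q) hq1.le (by omega)
    calc _ = ‖(bq q (N + k + 1) s - bq q (N + k) s) + (bq q (N + k) s - bq q N s)‖ := by
          rw [← add_assoc]; ring_nf
      _ ≤ _ := norm_add_le _ _
      _ ≤ 2 * Cb ‖q‖ * ‖q‖ ^ (2 * N + s) + k * (2 * Cb ‖q‖ * ‖q‖ ^ (2 * N + s)) := by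
          refine add_le_add (h.trans ?_) ih
          gcongr
      _ = _ := by push_cast; ring

theorem hq_nat_hasSum {q : ℂ} (hq0 : q ≠ 0) (hq1 : ‖q‖ < 1) (m : ℕ) :
    HasSum (fun s : ℕ => bq q (m + s) s) (hq q m) := by
  have h := hq_hasSum hq0 hq1 m
  have hz : ∀ s : ℤ, s ∉ Set.range ((↑) : ℕ → ℤ) → bz q (s + m) s = 0 := by
    intro s hs
    apply bz_neg_right
    by_contra hc
    exact hs ⟨s.toNat, by simp; omega⟩
  have := (Nat.cast_injective (R := ℤ)).hasSum_iff hz |>.2 h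
  refine this.congr_fun' (fun s => ?_)
  simp only [Function.comp]
  rw [← bz_coe]; push_cast; rw [add_comm]

theorem hq_sub_Bq {q : ℂ} (hq0 : q ≠ 0) (hq1 : ‖q‖ < 1) (m : ℕ) :
    ‖hq q m - Bq q m‖ ≤ ‖q‖ ^ (2 * m) * (∑' s : ℕ, 2 * Cb ‖q‖ * (s * ‖q‖ ^ s)) := by
  have h := (hq_nat_hasSum hq0 hq1 m).sub (bq_summable hq0 hq1 m).hasSum
  have hs : Summable (fun s : ℕ => 2 * Cb ‖q‖ * (s * ‖q‖ ^ s)) := by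
    have := summable_pow_mul_geometric_of_norm_lt_one 1 (r := ‖q‖) (by simpa using hq1)
    simpa using this.mul_left (2 * Cb ‖q‖)
  unfold Bq
  rw [← h.tsum_eq]
  refine tsum_of_norm_bounded (hs.hasSum.mul_left _) ?_
  intro s
  refine (bq_diff2 hq0 hq1 m s s).trans (le_of_eq ?_)
  rw [pow_add]; ring

theorem tendsto_hq {q : ℂ} (hq0 : q ≠ 0) (hq1 : ‖q‖ < 1) :
    Tendsto (fun m : ℕ => hq q m) atTop (𝓝 (Pq q)) := by
  have hl : Tendsto (fun m : ℕ => ‖q‖ ^ m * Hb ‖q‖) atTop (𝓝 0) := by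
    simpa using (tendsto_pow_atTop_nhds_zero_of_lt_one (norm_nonneg q) hq1).mul_const (Hb ‖q‖)
  rw [tendsto_iff_norm_sub_tendsto_zero]
  refine squeeze_zero (fun _ => norm_nonneg _) (fun m => ?_) hl
  have h := Xq_nonneg hq0 hq1 m
  unfold Xq at h
  rw [← h]
  have hz : q ^ (2 * (m : ℤ) + 3) = q ^ (2 * m + 3) := by rw [← zpow_natCast]; congr 1
  rw [hz, sub_add_cancel_left, norm_neg, norm_mul, norm_pow]
  have h1 := hq_bound hq0 hq1 (m + 2)
  have h3 : ‖q‖ ^ (2 * m + 3) ≤ ‖q‖ ^ m := pow_le_pow_of_le_one (norm_nonneg q) hq1.le (by omega)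
  gcongr

theorem tendsto_Bq {q : ℂ} (hq0 : q ≠ 0) (hq1 : ‖q‖ < 1) :
    Tendsto (fun N : ℕ => ∏ j ∈ Finset.range N, ((1 + q ^ (2 * j + 1)) / (1 - q ^ (2 * j + 2))))
      atTop (𝓝 (Pq q)) := by
  have h1 : Tendsto (fun m : ℕ => hq q m - Bq q m) atTop (𝓝 0) := by
    rw [tendsto_zero_iff_norm_tendsto_zero]
    have hl : Tendsto (fun m : ℕ => ‖q‖ ^ (2 * m) * (∑' s : ℕ, 2 * Cb ‖q‖ * (s * ‖q‖ ^ s)))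
        atTop (𝓝 0) := by
      have := (tendsto_pow_atTop_nhds_zero_of_lt_one (norm_nonneg q) hq1).comp
        (tendsto_id.const_mul_atTop' (r := 2) (by norm_num))
      simpa using this.mul_const (∑' s : ℕ, 2 * Cb ‖q‖ * (s * ‖q‖ ^ s))
    exact squeeze_zero (fun _ => norm_nonneg _) (fun m => hq_sub_Bq hq0 hq1 m) hl
  have h2 := (tendsto_hq hq0 hq1).sub h1
  simp only [sub_sub_cancel, sub_zero] at h2
  exact h2.congr (fun N => Bq_eq_prod hq0 hq1 N)

/-! The double series. -/

noncomputable def Fterm (z q : ℂ) (p : ℤ × ℤ) : ℂ :=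
  z ^ (p.1 - p.2) * (bz q p.1 p.2 - bz q (p.1 - 1) p.2)

theorem bz_diff_norm {q : ℂ} (hq0 : q ≠ 0) (hq1 : ‖q‖ < 1) (N s : ℤ) :
    ‖bz q N s - bz q (N - 1) s‖ ≤ (2 * Cb ‖q‖ * ‖q‖⁻¹ ^ 2) * (‖q‖ ^ N.natAbs * ‖q‖ ^ s.natAbs) := by
  have hC : 0 < Cb ‖q‖ := Real.exp_pos _
  have hr : 0 < ‖q‖ := norm_pos_iff.2 hq0
  rcases lt_or_ge s 0 with hs | hs
  · rw [bz_neg_right q _ hs, bz_neg_right q _ hs]; simp; positivity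
  rcases lt_trichotomy N 0 with h | rfl | h
  · rw [bz_neg_left q _ h, bz_neg_left q _ (by omega)]; simp; positivity
  · rw [bz_neg_left q _ (by omega : (0:ℤ) - 1 < 0), sub_zero]
    refine (bz_norm hq0 hq1 0 s).trans ?_
    have : 1 ≤ ‖q‖⁻¹ ^ 2 := one_le_pow₀ ((one_le_inv₀ hr).2 hq1.le)
    have h3 : 0 ≤ ‖q‖ ^ s.natAbs := by positivity
    simp only [Int.natAbs_zero, pow_zero, one_mul]
    gcongr
    nlinarith
  · obtain ⟨n, rfl⟩ : ∃ n : ℕ, N = (n : ℤ) + 1 := ⟨(N - 1).toNat, by omega⟩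
    obtain ⟨t, rfl⟩ := Int.eq_ofNat_of_zero_le hs
    have := bq_diff hq0 hq1 n t
    rw [add_sub_cancel_right, bz_coe, ← Nat.cast_succ, bz_coe]
    refine this.trans ?_
    have h3 : ‖q‖⁻¹ ^ 2 * ‖q‖ ^ (n + 2) = ‖q‖ ^ n := by
      rw [pow_add]; field_simp
    simp only [Int.natAbs_natCast]
    have h4 : ‖q‖ ^ (2 * n + t) ≤ ‖q‖⁻¹ ^ 2 * (‖q‖ ^ (n + 1) * ‖q‖ ^ t) := by
      calc ‖q‖ ^ (2 * n + t) ≤ ‖q‖ ^ (n + t) :=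
            pow_le_pow_of_le_one hr.le hq1.le (by omega)
        _ = ‖q‖⁻¹ ^ 2 * (‖q‖ ^ (n + 2) * ‖q‖ ^ t) := by rw [pow_add, ← h3]; ring
        _ ≤ _ := by
          gcongr ‖q‖⁻¹ ^ 2 * (?_ * ‖q‖ ^ t)
          exact pow_le_pow_of_le_one hr.le hq1.le (by omega)
    calc _ ≤ 2 * Cb ‖q‖ * (‖q‖⁻¹ ^ 2 * (‖q‖ ^ (n + 1) * ‖q‖ ^ t)) := by gcongr
      _ = _ := by rw [Nat.succ_eq_add_one]; ring

theorem Fterm_summable {z q : ℂ} (hz : ‖z‖ = 1) (hq0 : q ≠ 0) (hq1 : ‖q‖ < 1) :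
    Summable (Fterm z q) := by
  have h := summable_natAbs_pow (norm_nonneg q) hq1
  have h2 := (h.mul_of_nonneg h (fun s => by positivity) (fun s => by positivity)).mul_left
    (2 * Cb ‖q‖ * ‖q‖⁻¹ ^ 2)
  refine Summable.of_norm_bounded h2 ?_
  rintro ⟨N, s⟩
  unfold Fterm
  rw [norm_mul, norm_zpow, hz, one_zpow, one_mul]
  exact bz_diff_norm hq0 hq1 N s

noncomputable def Fq (z q : ℂ) : ℂ := ∑' p : ℤ × ℤ, Fterm z q p

theorem Fq_hasSum_h {z q : ℂ} (hz : ‖z‖ = 1) (hq0 : q ≠ 0) (hq1 : ‖q‖ < 1) :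
    HasSum (fun m : ℤ => z ^ m * (hq q m - hq q (m - 1))) (Fq z q) := by
  have hs := (Fterm_summable hz hq0 hq1).hasSum
  let e : ℤ × ℤ ≃ ℤ × ℤ :=
    ⟨fun p => (p.2 + p.1, p.2), fun p => (p.1 - p.2, p.2), fun p => by simp, fun p => by simp⟩
  have h2 := (e.hasSum_iff).2 hs
  refine h2.prod_fiberwise (fun m => ?_)
  refine (((hq_hasSum hq0 hq1 m).sub (hq_hasSum hq0 hq1 (m - 1))).mul_left (z ^ m)).congr_fun' ?_
  intro s
  simp only [Function.comp, Fterm, e, Equiv.coe_fn_mk]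
  congr 2
  · ring
  · rw [add_sub_assoc]

theorem swap_geom {r : ℝ} (h0 : 0 ≤ r) (hr : r < 1) (c Q : ℕ → ℂ) (hc : ∀ j, ‖c j‖ ≤ r ^ j)
    (hQ : ∀ j, ‖Q j‖ ≤ r) :
    HasSum (fun j => c j / (1 - Q j)) (∑' j, c j / (1 - Q j)) ∧
    HasSum (fun m => ∑' j, c j * Q j ^ m) (∑' j, c j / (1 - Q j)) := by
  have hg := summable_geometric_of_lt_one h0 hr
  have hb : ∀ p : ℕ × ℕ, ‖c p.1 * Q p.1 ^ p.2‖ ≤ r ^ p.1 * r ^ p.2 := by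
    rintro ⟨j, m⟩
    rw [norm_mul, norm_pow]
    have := hc j
    have := hQ j
    gcongr
  have hs : Summable (fun p : ℕ × ℕ => c p.1 * Q p.1 ^ p.2) :=
    Summable.of_norm_bounded (hg.mul_of_nonneg hg (fun s => by positivity) (fun s => by positivity)) hb
  have h1 := hs.hasSum.prod_fiberwise (g := fun j => c j / (1 - Q j)) (fun j => by
    have := (hasSum_geometric_of_norm_lt_one ((hQ j).trans_lt hr)).mul_left (c j)
    simpa [div_eq_mul_inv] using this)
  have hs2 := (Equiv.prodComm ℕ ℕ).hasSum_iff.2 hs.hasSum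
  have h2 := hs2.prod_fiberwise (g := fun m => ∑' j, c j * Q j ^ m) (fun m => by
    exact (hs2.summable.prod_factor m).hasSum)
  rw [h1.tsum_eq]
  exact ⟨h1, h2⟩

noncomputable def Sterm (z q : ℂ) (r : ℤ) : ℂ := (-1) ^ r * q ^ (2 * r ^ 2 + r) / (1 - z * q ^ (2 * r))
noncomputable def Sq (z q : ℂ) : ℂ := ∑' r : ℤ, Sterm z q r

noncomputable def cP (q : ℂ) (j : ℕ) : ℂ := (-1) ^ (j + 1) * q ^ (2 * j ^ 2 + 5 * j + 3)
noncomputable def QP (z q : ℂ) (j : ℕ) : ℂ := z * q ^ (2 * j + 2)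

theorem cP_norm {q : ℂ} (hq1 : ‖q‖ < 1) (j : ℕ) : ‖cP q j‖ ≤ ‖q‖ ^ j := by
  unfold cP
  rw [norm_mul, norm_pow, norm_pow, norm_neg, norm_one, one_pow, one_mul]
  apply pow_le_pow_of_le_one (norm_nonneg q) hq1.le
  nlinarith [Nat.zero_le (2 * j ^ 2)]

theorem QP_norm {z q : ℂ} (hz : ‖z‖ = 1) (hq1 : ‖q‖ < 1) (j : ℕ) : ‖QP z q j‖ ≤ ‖q‖ := by
  unfold QP
  rw [norm_mul, norm_pow, hz, one_mul]
  calc ‖q‖ ^ (2 * j + 2) ≤ ‖q‖ ^ 1 := pow_le_pow_of_le_one (norm_nonneg q) hq1.le (by omega)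
    _ = ‖q‖ := pow_one _

theorem Sq_hasSum {z q : ℂ} (hz : ‖z‖ = 1) (hq0 : q ≠ 0) (hq1 : ‖q‖ < 1) :
    HasSum (Sterm z q) (Sq z q) ∧
    Sq z q = 1 / (1 - z) + (∑' j, cP q j / (1 - QP z q j))
      + ∑' j, (-z⁻¹ * cP q j) / (1 - QP z⁻¹ q j) := by
  have hzi : ‖z⁻¹‖ = 1 := by simp [hz]
  have hz0 : z ≠ 0 := by intro h; simp [h] at hz
  have h1 := (swap_geom (norm_nonneg q) hq1 (cP q) (QP z q) (cP_norm hq1) (QP_norm hz hq1)).1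
  have h2 := (swap_geom (norm_nonneg q) hq1 (fun j => -z⁻¹ * cP q j) (QP z⁻¹ q)
    (fun j => by rw [norm_mul, norm_neg, hzi, one_mul]; exact cP_norm hq1 j) (QP_norm hzi hq1)).1
  have key : HasSum (Sterm z q) (1 / (1 - z) + (∑' j, cP q j / (1 - QP z q j))
      + ∑' j, (-z⁻¹ * cP q j) / (1 - QP z⁻¹ q j)) := by
    refine HasSum.of_nat_of_neg_add_one ?_ ?_
    · rw [← hasSum_nat_add_iff' 1]
      simp only [Finset.range_one, Finset.sum_singleton]
      have e0 : Sterm z q ((0 : ℕ) : ℤ) = 1 / (1 - z) := by simp [Sterm]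
      rw [e0, add_sub_cancel_left]
      refine h1.congr_fun' (fun j => ?_)
      unfold Sterm cP QP
      rw [zpow_natCast]
      congr 2
      rw [← zpow_natCast q]; congr 1; push_cast; ring
    · refine h2.congr_fun' (fun j => ?_)
      unfold Sterm cP QP
      have e1 : (-1 : ℂ) ^ (-((j : ℤ) + 1)) = (-1) ^ (j + 1) := by
        rw [zpow_neg, ← Nat.cast_succ, zpow_natCast, ← inv_pow]; norm_num
      have e2 : q ^ (2 * (-((j : ℤ) + 1)) ^ 2 + -((j : ℤ) + 1)) = q ^ (2 * j ^ 2 + 3 * j + 1) := by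
        rw [← zpow_natCast q]; congr 1; push_cast; ring
      have e3 : q ^ (2 * (-((j : ℤ) + 1))) = (q ^ (2 * j + 2))⁻¹ := by
        rw [← zpow_natCast q, ← zpow_neg]; congr 1
      rw [e1, e2, e3, show 2 * j ^ 2 + 5 * j + 3 = (2 * j ^ 2 + 3 * j + 1) + (2 * j + 2) by ring,
        pow_add q (2 * j ^ 2 + 3 * j + 1) (2 * j + 2)]
      have hne : q ^ (2 * j + 2) ≠ 0 := pow_ne_zero _ hq0
      have hlt : ‖q ^ (2 * j + 2)‖ < 1 := by
        rw [norm_pow]; exact pow_lt_one₀ (norm_nonneg q) hq1 (by omega)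
      generalize q ^ (2 * j + 2) = y at *
      have hd : z - y ≠ 0 := by
        intro h; rw [← sub_eq_zero.1 h, hz] at hlt; exact lt_irrefl _ hlt
      have hd2 : y - z ≠ 0 := by rw [← neg_sub]; exact neg_ne_zero.2 hd
      have e4 : 1 - z * y⁻¹ = (y - z) / y := by field_simp
      have e5 : 1 - z⁻¹ * y = (z - y) / z := by field_simp
      rw [e4, e5]
      generalize q ^ (2 * j ^ 2 + 3 * j + 1) = Y
      field_simp
      ring
  refine ⟨key.summable.hasSum, key.tsum_eq⟩

theorem Fq_eq {z q : ℂ} (hz : ‖z‖ = 1) (hz1 : z ≠ 1) (hq0 : q ≠ 0) (hq1 : ‖q‖ < 1) :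
    Fq z q = (1 - z) * (Pq q * Sq z q) := by
  have hzi : ‖z⁻¹‖ = 1 := by simp [hz]
  have hz0 : z ≠ 0 := by intro h; simp [h] at hz
  have h1 := (swap_geom (norm_nonneg q) hq1 (cP q) (QP z q) (cP_norm hq1) (QP_norm hz hq1)).2
  have h2 := (swap_geom (norm_nonneg q) hq1 (fun j => -z⁻¹ * cP q j) (QP z⁻¹ q)
    (fun j => by rw [norm_mul, norm_neg, hzi, one_mul]; exact cP_norm hq1 j) (QP_norm hzi hq1)).2
  set T1 := ∑' j, cP q j / (1 - QP z q j)
  set T2 := ∑' j, (-z⁻¹ * cP q j) / (1 - QP z⁻¹ q j)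
  let g : ℤ → ℂ := fun m => z ^ m * (hq q m - if 0 ≤ m then Pq q else 0)
  have hT : HasSum g (Pq q * T1 + Pq q * T2) := by
    refine HasSum.of_nat_of_neg_add_one ?_ ?_
    · refine (h1.mul_left (Pq q)).congr_fun' (fun m => ?_)
      simp only [g]
      rw [if_pos (by positivity), hq_nonneg_eq hq0 hq1 m, zpow_natCast]
      have := (hasSum_nat_add_iff' 1).2 (psi_hasSum hq1 m)
      simp only [Finset.range_one, Finset.sum_singleton, pow_zero, mul_zero, add_zero, one_mul] at this
      norm_num at this
      rw [((this.mul_left (z ^ m)).congr_fun' (g := fun j => cP q j * QP z q j ^ m) ?_).tsum_eq]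
      · ring
      · intro j
        unfold cP QP
        rw [mul_pow, ← pow_mul,
          show 2 * (j + 1) ^ 2 + (j + 1) + 2 * m * (j + 1) =
            (2 * j ^ 2 + 5 * j + 3) + (2 * j + 2) * m by ring, pow_add q]
        ring
    · refine (h2.mul_left (Pq q)).congr_fun' (fun m => ?_)
      simp only [g]
      rw [if_neg (by omega), ← Nat.cast_succ, hq_neg_eq hq0 hq1 m, sub_zero, zpow_neg, zpow_natCast]
      have := psi_hasSum hq1 (m + 2)
      rw [((this.mul_left (z⁻¹ ^ (m + 1) * q ^ (2 * m + 3))).congr_fun'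
        (g := fun j => -z⁻¹ * cP q j * QP z⁻¹ q j ^ m) ?_).tsum_eq]
      · rw [Nat.succ_eq_add_one, inv_pow]; ring
      · intro j
        unfold cP QP
        rw [mul_pow, ← pow_mul]
        have : q ^ (2 * m + 3) * q ^ (2 * j ^ 2 + j + 2 * (m + 2) * j)
          = q ^ (2 * j ^ 2 + 5 * j + 3) * q ^ ((2 * j + 2) * m) := by
          rw [← pow_add, ← pow_add]; congr 1; ring
        linear_combination (z⁻¹ ^ (m + 1) * (-1) ^ (j + 1)) * this
  have hT' := hasSum_shift (hT.mul_left z) (fun m => z * g (m - 1)) (fun _ => rfl)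
  have hF := Fq_hasSum_h hz hq0 hq1
  have h3 := (hT.sub hT').add (hasSum_ite_eq (0 : ℤ) (Pq q))
  have := hF.unique (h3.congr_fun' (fun m => by
    have e : z * z ^ (m - 1) = z ^ m := by
      rw [← zpow_one_add₀ hz0]; congr 1; ring
    simp only [g]
    rw [← mul_assoc, e]
    rcases lt_trichotomy m 0 with h | h | h
    · rw [if_neg (by omega), if_neg (by omega), if_neg (by omega)]; ring
    · subst h; norm_num; ring
    · rw [if_pos (by omega), if_pos (by omega), if_neg (by omega)]; ring))
  rw [this, (Sq_hasSum hz hq0 hq1).2]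
  have : 1 - z ≠ 0 := sub_ne_zero.2 hz1.symm
  change _ = (1 - z) * (Pq q * (1 / (1 - z) + T1 + T2))
  have e : (1 - z) * (Pq q * (1 / (1 - z) + T1 + T2))
    = ((1 - z) * (1 / (1 - z))) * Pq q + (1 - z) * Pq q * (T1 + T2) := by ring
  rw [e, mul_one_div_cancel this]
  ring

noncomputable def MM : ℕ → ℕ → Finset (Multiset ℕ)
  | 0, 0 => {0}
  | 0, _ + 1 => ∅
  | _ + 1, 0 => {0}
  | N + 1, s + 1 => MM N (s + 1) ∪ ((MM N s).image (Multiset.cons (2 * N + 1)) ∪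
      (MM (N + 1) s).image (Multiset.cons (2 * N + 2)))

def AdmP (m : Multiset ℕ) : Prop := (∀ i ∈ m, 1 ≤ i) ∧ ∀ j, Odd j → m.count j ≤ 1

theorem mem_MM (N s : ℕ) (m : Multiset ℕ) :
    m ∈ MM N s ↔ Multiset.card m = s ∧ (∀ i ∈ m, i ≤ 2 * N) ∧ AdmP m := by
  induction N generalizing s m with
  | zero =>
    cases s with
    | zero =>
      simp only [MM, Finset.mem_singleton, Multiset.card_eq_zero]
      constructor
      · rintro rfl; simp [AdmP]
      · exact fun h => h.1
    | succ s =>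
      simp only [MM, Finset.notMem_empty, false_iff]
      rintro ⟨h1, h2, h3⟩
      obtain ⟨a, ha⟩ := Multiset.card_pos_iff_exists_mem.1 (by omega : 0 < Multiset.card m)
      have := h2 a ha
      have := h3.1 a ha
      omega
  | succ N ihN =>
    induction s generalizing m with
    | zero =>
      simp only [MM, Finset.mem_singleton, Multiset.card_eq_zero]
      constructor
      · rintro rfl; simp [AdmP]
      · exact fun h => h.1
    | succ s ihs =>
      simp only [MM, Finset.mem_union, Finset.mem_image, ihN, ihs]
      constructor
      · rintro (⟨h1, h2, h3⟩ | ⟨a, ⟨h1, h2, h3, h4⟩, rfl⟩ | ⟨a, ⟨h1, h2, h3, h4⟩, rfl⟩)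
        · exact ⟨h1, fun i hi => by have := h2 i hi; omega, h3⟩
        · refine ⟨by simp [h1], ?_, ?_, ?_⟩
          · intro i hi
            rcases Multiset.mem_cons.1 hi with rfl | hi
            · omega
            · have := h2 i hi; omega
          · intro i hi
            rcases Multiset.mem_cons.1 hi with rfl | hi
            · omega
            · exact h3 i hi
          · intro j hj
            rw [Multiset.count_cons]
            by_cases e : j = 2 * N + 1
            · have : a.count j = 0 := by
                rw [Multiset.count_eq_zero]; intro hm; have := h2 j hm; omega
              rw [this]; split_ifs <;> omega
            · simp [e]; exact h4 j hj
        · refine ⟨by simp [h1], ?_, ?_, ?_⟩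
          · intro i hi
            rcases Multiset.mem_cons.1 hi with rfl | hi
            · omega
            · have := h2 i hi; omega
          · intro i hi
            rcases Multiset.mem_cons.1 hi with rfl | hi
            · omega
            · exact h3 i hi
          · intro j hj
            rw [Multiset.count_cons]
            have e : j ≠ 2 * N + 2 := by rintro rfl; rcases hj with ⟨k, hk⟩; omega
            simp [e]; exact h4 j hj
      · rintro ⟨h1, h2, h3, h4⟩
        by_cases a1 : 2 * N + 2 ∈ m
        · right; right
          refine ⟨m.erase (2 * N + 2), ⟨?_, ?_, ?_, ?_⟩, Multiset.cons_erase a1⟩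
          · rw [Multiset.card_erase_of_mem a1, h1]; rfl
          · intro i hi; exact h2 i (Multiset.mem_of_mem_erase hi)
          · intro i hi; exact h3 i (Multiset.mem_of_mem_erase hi)
          · intro j hj
            exact (Multiset.count_le_of_le j (Multiset.erase_le _ _)).trans (h4 j hj)
        · by_cases a2 : 2 * N + 1 ∈ m
          · right; left
            refine ⟨m.erase (2 * N + 1), ⟨?_, ?_, ?_, ?_⟩, Multiset.cons_erase a2⟩
            · rw [Multiset.card_erase_of_mem a2, h1]; rfl
            · intro i hi
              have hm := Multiset.mem_of_mem_erase hi
              have := h2 i hm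
              have e1 : i ≠ 2 * N + 2 := by rintro rfl; exact a1 hm
              have e2 : i ≠ 2 * N + 1 := by
                rintro rfl
                have c := h4 (2 * N + 1) ⟨N, rfl⟩
                have c2 := Multiset.count_erase_self (2 * N + 1) m
                have c3 := Multiset.count_pos.2 hi
                omega
              omega
            · intro i hi; exact h3 i (Multiset.mem_of_mem_erase hi)
            · intro j hj
              exact (Multiset.count_le_of_le j (Multiset.erase_le _ _)).trans (h4 j hj)
          · left
            refine ⟨h1, ?_, h3, h4⟩
            intro i hi
            have := h2 i hi
            have e1 : i ≠ 2 * N + 2 := by rintro rfl; exact a1 hi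
            have e2 : i ≠ 2 * N + 1 := by rintro rfl; exact a2 hi
            omega

theorem sum_MM {R : Type*} [CommRing R] (q : R) (N s : ℕ) :
    ∑ m ∈ MM N s, q ^ m.sum = bq q N s := by
  induction N generalizing s with
  | zero => cases s <;> simp [MM, bq]
  | succ N ihN =>
    induction s with
    | zero => simp [MM, bq]
    | succ s ihs =>
      have d2 : Disjoint ((MM N s).image (Multiset.cons (2 * N + 1)))
          ((MM (N + 1) s).image (Multiset.cons (2 * N + 2))) := by
        rw [Finset.disjoint_left]
        intro m h1 h2
        obtain ⟨a, ha, rfl⟩ := Finset.mem_image.1 h1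
        obtain ⟨b, hb, e⟩ := Finset.mem_image.1 h2
        have : 2 * N + 2 ∈ Multiset.cons (2 * N + 1) a := by rw [← e]; simp
        rcases Multiset.mem_cons.1 this with h | h
        · omega
        · have := ((mem_MM _ _ _).1 ha).2.1 _ h; omega
      have d1 : Disjoint (MM N (s + 1)) ((MM N s).image (Multiset.cons (2 * N + 1)) ∪
          (MM (N + 1) s).image (Multiset.cons (2 * N + 2))) := by
        rw [Finset.disjoint_left]
        intro m h1 h2
        have h3 := ((mem_MM _ _ _).1 h1).2.1
        rcases Finset.mem_union.1 h2 with h2 | h2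
        · obtain ⟨a, ha, rfl⟩ := Finset.mem_image.1 h2
          have := h3 (2 * N + 1) (by simp); omega
        · obtain ⟨a, ha, rfl⟩ := Finset.mem_image.1 h2
          have := h3 (2 * N + 2) (by simp); omega
      rw [MM, Finset.sum_union d1, Finset.sum_union d2, ihN,
        Finset.sum_image (fun a _ b _ h => (Multiset.cons_inj_right _).1 h),
        Finset.sum_image (fun a _ b _ h => (Multiset.cons_inj_right _).1 h), bq_succ]
      simp only [Multiset.sum_cons, pow_add q]
      rw [← Finset.mul_sum, ← Finset.mul_sum, ihN, ihs]
      ring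

noncomputable def DD (N s : ℕ) : Finset (Multiset ℕ) :=
  (MM N s).filter (fun m => (m.sup + 1) / 2 = N)

theorem sup_le_iff' (m : Multiset ℕ) (N : ℕ) : (∀ i ∈ m, i ≤ 2 * N) ↔ (m.sup + 1) / 2 ≤ N := by
  rw [← Multiset.sup_le]; omega

theorem mem_DD (N s : ℕ) (m : Multiset ℕ) :
    m ∈ DD N s ↔ Multiset.card m = s ∧ (m.sup + 1) / 2 = N ∧ AdmP m := by
  rw [DD, Finset.mem_filter, mem_MM, sup_le_iff']
  constructor
  · rintro ⟨⟨h1, h2, h3⟩, h4⟩; exact ⟨h1, h4, h3⟩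
  · rintro ⟨h1, h2, h3⟩; exact ⟨⟨h1, h2.le, h3⟩, h2⟩

theorem sum_DD (q : ℂ) (N s : ℕ) :
    ∑ m ∈ DD N s, q ^ m.sum = bz q N s - bz q (N - 1) s := by
  have h := Finset.sum_filter_add_sum_filter_not (MM N s) (fun m => (m.sup + 1) / 2 = N)
    (fun m => q ^ m.sum)
  rw [sum_MM] at h
  rw [DD, bz_coe, ← h, eq_comm, sub_eq_iff_eq_add, add_right_inj]
  cases N with
  | zero =>
    rw [bz_neg_left q _ (by simp)]
    apply Finset.sum_eq_zero
    intro m hm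
    rw [Finset.mem_filter, mem_MM, sup_le_iff'] at hm
    omega
  | succ N =>
    push_cast
    rw [add_sub_cancel_right, bz_coe, ← sum_MM]
    apply Finset.sum_congr _ (fun _ _ => rfl)
    ext m
    rw [Finset.mem_filter, mem_MM, mem_MM, sup_le_iff', sup_le_iff']
    constructor
    · rintro ⟨⟨h1, h2, h3⟩, h4⟩; exact ⟨h1, by omega, h3⟩
    · rintro ⟨h1, h2, h3⟩; exact ⟨⟨h1, by omega, h3⟩, by omega⟩

abbrev Adm := {m : Multiset ℕ // AdmP m}

noncomputable def rk (m : Multiset ℕ) : ℤ := (((m.sup + 1) / 2 : ℕ) : ℤ) - (Multiset.card m : ℤ)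

noncomputable def fAdm (z q : ℂ) (m : Adm) : ℂ := z ^ rk m.1 * q ^ m.1.sum

def g1 (m : Adm) : ℕ × ℕ := ((m.1.sup + 1) / 2, Multiset.card m.1)

noncomputable def fibEquiv (p : ℕ × ℕ) : {x : Adm // g1 x = p} ≃ {m // m ∈ DD p.1 p.2} where
  toFun x := ⟨x.1.1, by
    rw [mem_DD]; obtain ⟨⟨m, hm⟩, rfl⟩ := x; exact ⟨rfl, rfl, hm⟩⟩
  invFun m := ⟨⟨m.1, ((mem_DD _ _ _).1 m.2).2.2⟩, by
    have := (mem_DD _ _ _).1 m.2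
    exact Prod.ext this.2.1 this.1⟩
  left_inv x := by simp
  right_inv x := by simp

theorem fiber_hasSum (z q : ℂ) (p : ℕ × ℕ) :
    HasSum (fun x : {x : Adm // g1 x = p} => fAdm z q x.1) (Fterm z q (p.1, p.2)) := by
  have h : HasSum (fun m : {m // m ∈ DD p.1 p.2} => z ^ ((p.1 : ℤ) - p.2) * q ^ m.1.sum)
      (∑ m ∈ DD p.1 p.2, z ^ ((p.1 : ℤ) - p.2) * q ^ m.sum) :=
    Finset.hasSum (DD p.1 p.2) (fun m => z ^ ((p.1 : ℤ) - p.2) * q ^ m.sum)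
  rw [← Finset.mul_sum, sum_DD] at h
  refine ((fibEquiv p).hasSum_iff.2 h).congr_fun' ?_
  rintro ⟨⟨m, hm⟩, rfl⟩
  rfl

theorem Fterm_nat_hasSum {z q : ℂ} (hz : ‖z‖ = 1) (hq0 : q ≠ 0) (hq1 : ‖q‖ < 1) :
    HasSum (fun p : ℕ × ℕ => Fterm z q (p.1, p.2)) (Fq z q) := by
  have h := (Fterm_summable hz hq0 hq1).hasSum
  have hi : Function.Injective (fun p : ℕ × ℕ => ((p.1 : ℤ), (p.2 : ℤ))) := by
    rintro ⟨a, b⟩ ⟨c, d⟩ e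
    simpa using e
  refine (hi.hasSum_iff ?_).2 h
  rintro ⟨N, s⟩ hp
  unfold Fterm
  by_cases hN : N < 0
  · simp [bz_neg_left q s hN, bz_neg_left q s (by omega : N - 1 < 0)]
  · by_cases hs : s < 0
    · simp [bz_neg_right q _ hs]
    · exact absurd ⟨(N.toNat, s.toNat), by ext <;> simp <;> omega⟩ hp

theorem fAdm_hasSum {z q : ℂ} (hz : ‖z‖ = 1) (hq0 : q ≠ 0) (hq1 : ‖q‖ < 1) :
    HasSum (fAdm z q) (Fq z q) := by
  have hs : Summable (fAdm z q) := by
    have hr0 : ((‖q‖ : ℝ) : ℂ) ≠ 0 := by simpa using hq0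
    have hr1 : ‖((‖q‖ : ℝ) : ℂ)‖ < 1 := by simpa using hq1
    apply Summable.of_norm
    have e : ∀ m : Adm, ‖fAdm z q m‖ = (fAdm 1 (‖q‖ : ℝ) m).re := by
      intro m
      unfold fAdm
      rw [norm_mul, norm_zpow, hz, one_zpow, one_zpow, norm_pow, one_mul, one_mul,
        ← Complex.ofReal_pow, Complex.ofReal_re]
    rw [← (Equiv.sigmaFiberEquiv g1).summable_iff]
    refine (summable_sigma_of_nonneg (fun _ => norm_nonneg _)).2 ?_
    have hf : ∀ p : ℕ × ℕ, HasSum (fun x : {x : Adm // g1 x = p} => ‖fAdm z q x.1‖)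
        (Fterm 1 (‖q‖ : ℝ) (p.1, p.2)).re := by
      intro p
      have := Complex.hasSum_re (fiber_hasSum 1 (‖q‖ : ℝ) p)
      exact this.congr_fun' (fun x => e x.1)
    refine ⟨fun p => (hf p).summable, ?_⟩
    have h2 := (Complex.hasSum_re (Fterm_nat_hasSum (z := 1) (by simp) hr0 hr1)).summable
    refine h2.congr (fun p => ?_)
    exact ((hf p).tsum_eq).symm
  have h2 := (Equiv.sigmaFiberEquiv g1).hasSum_iff.2 hs.hasSum
  have h3 := h2.sigma (fun p => fiber_hasSum z q p)
  rw [← h3.unique (Fterm_nat_hasSum hz hq0 hq1)]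
  exact hs.hasSum

def partEquiv (n : ℕ) : {x : Adm // x.1.sum = n} ≃ {P : n.Partition // NoRepeatedOddParts P} where
  toFun x := ⟨⟨x.1.1, fun h => x.1.2.1 _ h, x.2⟩, x.1.2.2⟩
  invFun P := ⟨⟨P.1.parts, fun _ h => P.1.parts_pos h, P.2⟩, P.1.parts_sum⟩
  left_inv x := by simp
  right_inv x := by simp

theorem Acoef_eq (n : ℕ) (z : ℂ) (hz : z = Complex.exp (Real.pi * Complex.I / 4)) :
    Acoef 1 8 n = ∑ P : {P : n.Partition // NoRepeatedOddParts P}, z ^ m2Rank P.1 := by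
  have hz8 : z ^ (8 : ℤ) = 1 := by
    rw [hz]
    norm_cast
    rw [← Complex.exp_nat_mul, ← Complex.exp_two_pi_mul_I]
    congr 1; push_cast; ring
  have hz0 : z ≠ 0 := by rw [hz]; exact Complex.exp_ne_zero _
  have hmap : ∀ P ∈ (Finset.univ : Finset {P : n.Partition // NoRepeatedOddParts P}),
      (m2Rank P.1 % 8).toNat ∈ Finset.range 8 := by
    intro P _
    rw [Finset.mem_range]; omega
  rw [← Finset.sum_fiberwise_of_maps_to hmap]
  unfold Acoef
  apply Finset.sum_congr rfl
  intro r hr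
  rw [Finset.mem_range] at hr
  have hc : ∀ P ∈ (Finset.univ : Finset {P : n.Partition // NoRepeatedOddParts P}).filter
      (fun P => (m2Rank P.1 % 8).toNat = r), z ^ m2Rank P.1 = z ^ r := by
    intro P hP
    have h := (Finset.mem_filter.1 hP).2
    have h1 : m2Rank P.1 = 8 * (m2Rank P.1 / 8) + (r : ℤ) := by omega
    rw [h1, zpow_add₀ hz0, zpow_mul, hz8, one_zpow, one_mul, zpow_natCast]
  rw [Finset.sum_congr rfl hc, Finset.sum_const, nsmul_eq_mul]
  congr 1
  · unfold N2
    rw [← Fintype.card_subtype, ← Nat.card_eq_fintype_card]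
    congr 1
    apply Nat.card_congr
    refine (Equiv.subtypeSubtypeEquivSubtypeInter _ (fun P : n.Partition => (m2Rank P % 8).toNat = r)).trans
      (Equiv.subtypeEquivRight ?_) |>.symm
    intro P
    unfold Int.ModEq
    simp only [and_congr_right_iff]
    intro _
    push_cast
    omega
  · rw [hz, ← Complex.exp_nat_mul]
    congr 1; push_cast; ring

theorem Acoef_hasSum {z q : ℂ} (hz : z = Complex.exp (Real.pi * Complex.I / 4)) (hq0 : q ≠ 0)
    (hq1 : ‖q‖ < 1) : HasSum (fun n : ℕ => Acoef 1 8 n * q ^ n) (Fq z q) := by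
  have hzn : ‖z‖ = 1 := by
    rw [hz, show (Real.pi * Complex.I / 4 : ℂ) = ((Real.pi / 4 : ℝ) : ℂ) * Complex.I by
      push_cast; ring, Complex.norm_exp_ofReal_mul_I]
  have h2 := (Equiv.sigmaFiberEquiv (fun m : Adm => m.1.sum)).hasSum_iff.2 (fAdm_hasSum hzn hq0 hq1)
  refine h2.sigma (fun n => ?_)
  have h := hasSum_fintype (fun P : {P : n.Partition // NoRepeatedOddParts P} =>
    z ^ m2Rank P.1 * q ^ n)
  rw [← Finset.sum_mul, ← Acoef_eq n z hz] at h
  refine ((partEquiv n).hasSum_iff.2 h).congr_fun' ?_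
  rintro ⟨⟨m, hm⟩, rfl⟩
  rfl

noncomputable def wq (q : ℂ) (m : ℕ) : ℂ := -(-q) ^ m
noncomputable def aq (q : ℂ) (m : ℕ) : ℝ := (wq q m / (1 - wq q m) / m).re

theorem wq_norm (q : ℂ) (m : ℕ) : ‖wq q m‖ = ‖q‖ ^ m := by simp [wq]

theorem one_sub_norm_ge {w : ℂ} {r : ℝ} (h : ‖w‖ ≤ r) : 1 - r ≤ ‖1 - w‖ := by
  have := norm_sub_norm_le 1 w
  rw [norm_one] at this
  linarith

theorem err_bound {q : ℂ} (hq1 : ‖q‖ < 1) (m k : ℕ) :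
    ‖wq q m ^ (k + 1) / (1 - wq q m) / m‖ ≤ ‖q‖ ^ k * (‖q‖ ^ m / (1 - ‖q‖)) := by
  have h1 : 0 < 1 - ‖q‖ := by linarith
  rcases Nat.eq_zero_or_pos m with rfl | hm
  · simp; positivity
  rw [norm_div, norm_div, norm_pow, wq_norm]
  have h2 : 1 - ‖q‖ ≤ ‖1 - wq q m‖ := by
    apply one_sub_norm_ge
    rw [wq_norm]
    calc ‖q‖ ^ m ≤ ‖q‖ ^ 1 := pow_le_pow_of_le_one (norm_nonneg q) hq1.le hm
      _ = _ := pow_one _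
  have h3 : (1 : ℝ) ≤ ‖(m : ℂ)‖ := by simp; exact_mod_cast hm
  have h4 : (‖q‖ ^ m) ^ (k + 1) ≤ ‖q‖ ^ k * ‖q‖ ^ m := by
    rw [← pow_mul, ← pow_add]
    apply pow_le_pow_of_le_one (norm_nonneg q) hq1.le
    nlinarith
  calc (‖q‖ ^ m) ^ (k + 1) / ‖1 - wq q m‖ / ‖(m : ℂ)‖ ≤ (‖q‖ ^ m) ^ (k + 1) / ‖1 - wq q m‖ :=
        div_le_self (by positivity) h3
    _ ≤ ‖q‖ ^ k * ‖q‖ ^ m / (1 - ‖q‖) := by gcongr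
    _ = _ := by ring

theorem aq_summable {q : ℂ} (hq1 : ‖q‖ < 1) : Summable (aq q) := by
  refine Summable.of_norm_bounded
    ((summable_geometric_of_lt_one (norm_nonneg q) hq1).div_const (1 - ‖q‖)) ?_
  intro m
  have := err_bound hq1 m 0
  simp only [zero_add, pow_one, pow_zero, one_mul] at this
  exact (Complex.abs_re_le_norm _).trans this

theorem hasSum_log_one_sub {w : ℂ} (hw : ‖w‖ < 1) :
    HasSum (fun m : ℕ => (w ^ m / m).re) (-Real.log ‖1 - w‖) := by
  have := Complex.hasSum_re (Complex.hasSum_taylorSeries_neg_log hw)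
  simpa [Complex.log_re] using this

theorem geom_odd_even {w : ℂ} (hw : 1 - w ≠ 0) (N : ℕ) :
    ∑ j ∈ Finset.range N, (w ^ (2 * j + 1) + w ^ (2 * j + 2)) = (w - w ^ (2 * N + 1)) / (1 - w) := by
  rw [eq_div_iff hw]
  induction N with
  | zero => simp
  | succ N ih => rw [Finset.sum_range_succ, add_mul, ih]; ring

theorem norm_qprod_le {q : ℂ} (hq0 : q ≠ 0) (hq1 : ‖q‖ < 1) (N : ℕ) :
    ‖∏ j ∈ Finset.range N, ((1 + q ^ (2 * j + 1)) / (1 - q ^ (2 * j + 2)))‖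
      ≤ Real.exp (∑' m, aq q m + ‖q‖ ^ (2 * N) * ∑' m : ℕ, ‖q‖ ^ m / (1 - ‖q‖)) := by
  set K := ∑' m : ℕ, ‖q‖ ^ m / (1 - ‖q‖)
  have hK := ((summable_geometric_of_lt_one (norm_nonneg q) hq1).div_const (1 - ‖q‖)).hasSum
  have hQ : ∀ k : ℕ, k ≠ 0 → ‖(-q) ^ k‖ < 1 := by
    intro k hk
    rw [norm_pow, norm_neg]; exact pow_lt_one₀ (norm_nonneg q) hq1 hk
  have hpos : ∀ k : ℕ, k ≠ 0 → 0 < ‖1 - (-q) ^ k‖ := by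
    intro k hk
    have := one_sub_norm_ge (le_refl ‖(-q) ^ k‖)
    linarith [hQ k hk]
  have hnorm : ∀ j : ℕ, ‖(1 + q ^ (2 * j + 1)) / (1 - q ^ (2 * j + 2))‖
      = Real.exp (Real.log ‖1 - (-q) ^ (2 * j + 1)‖ - Real.log ‖1 - (-q) ^ (2 * j + 2)‖) := by
    intro j
    rw [Real.exp_sub, Real.exp_log (hpos _ (by omega)), Real.exp_log (hpos _ (by omega)), norm_div,
      Odd.neg_pow ⟨j, rfl⟩, Even.neg_pow ⟨j + 1, by ring⟩, sub_neg_eq_add]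
  rw [norm_prod, Finset.prod_congr rfl (fun j _ => hnorm j), ← Real.exp_sum]
  apply Real.exp_le_exp.2
  have hs : HasSum (fun m : ℕ => ∑ j ∈ Finset.range N,
      (-(((-q) ^ (2 * j + 1)) ^ m / m).re + (((-q) ^ (2 * j + 2)) ^ m / m).re))
      (∑ j ∈ Finset.range N,
        (Real.log ‖1 - (-q) ^ (2 * j + 1)‖ - Real.log ‖1 - (-q) ^ (2 * j + 2)‖)) := by
    apply hasSum_sum
    intro j _
    have := (hasSum_log_one_sub (hQ (2 * j + 1) (by omega))).neg.add
      (hasSum_log_one_sub (hQ (2 * j + 2) (by omega)))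
    simpa [sub_eq_add_neg] using this
  refine hasSum_le ?_ hs ((aq_summable hq1).hasSum.add (hK.mul_left (‖q‖ ^ (2 * N))))
  intro m
  rcases Nat.eq_zero_or_pos m with rfl | hm
  · have h1 : 0 < 1 - ‖q‖ := by linarith
    simp [aq]
    positivity
  have hw : 1 - wq q m ≠ 0 := by
    have := one_sub_norm_ge (le_refl ‖wq q m‖)
    rw [wq_norm] at this
    have h2 := pow_lt_one₀ (norm_nonneg q) hq1 hm.ne'
    rw [← norm_pos_iff]; linarith
  have e : ∑ j ∈ Finset.range N,
      (-(((-q) ^ (2 * j + 1)) ^ m / m).re + (((-q) ^ (2 * j + 2)) ^ m / m).re)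
      = aq q m - (wq q m ^ (2 * N + 1) / (1 - wq q m) / m).re := by
    rw [aq, ← Complex.sub_re, ← sub_div, ← sub_div, ← geom_odd_even hw, Finset.sum_div, Complex.re_sum]
    apply Finset.sum_congr rfl
    intro j _
    rw [← Complex.neg_re, ← Complex.add_re]
    congr 1
    rw [← neg_div, ← add_div, wq, Odd.neg_pow ⟨j, rfl⟩ ((-q) ^ m), Even.neg_pow ⟨j + 1, by ring⟩ ((-q) ^ m),
      ← pow_mul, ← pow_mul, ← pow_mul, ← pow_mul, mul_comm m, mul_comm m]
  rw [e, sub_eq_add_neg]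
  gcongr
  refine (neg_le_abs _).trans ((Complex.abs_re_le_norm _).trans (err_bound hq1 m (2 * N)))

theorem norm_Pq_le {q : ℂ} (hq0 : q ≠ 0) (hq1 : ‖q‖ < 1) : ‖Pq q‖ ≤ Real.exp (∑' m, aq q m) := by
  have h1 := (tendsto_Bq hq0 hq1).norm
  have h2 : Tendsto (fun N : ℕ => Real.exp (∑' m, aq q m
      + ‖q‖ ^ (2 * N) * ∑' m : ℕ, ‖q‖ ^ m / (1 - ‖q‖))) atTop (𝓝 (Real.exp (∑' m, aq q m))) := by
    apply (Real.continuous_exp.tendsto _).comp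
    have := (tendsto_pow_atTop_nhds_zero_of_lt_one (norm_nonneg q) hq1).comp
        (tendsto_id.const_mul_atTop' (r := 2) (by norm_num))
    simpa using (this.mul_const (∑' m : ℕ, ‖q‖ ^ m / (1 - ‖q‖))).const_add (∑' m, aq q m)
  exact le_of_tendsto_of_tendsto' h1 h2 (norm_qprod_le hq0 hq1)

/-- cosine of the argument of `w_m` -/
noncomputable def cpsi (θ : ℝ) (m : ℕ) : ℝ := -(-1) ^ m * Real.cos (m * θ)

theorem re_frac_bound {w : ℂ} {X c : ℝ} (hX : 0 < X) (hc : c ≤ 1) (hn : ‖w‖ = Real.exp (-X))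
    (hre : w.re = Real.exp (-X) * c) : (w / (1 - w)).re ≤ X / (X ^ 2 + 2 * (1 - c)) := by
  set u := Real.exp (-X) with hu
  have hu0 : 0 < u := Real.exp_pos _
  have hu1 : u < 1 := by rw [hu, Real.exp_lt_one_iff]; linarith
  have hsq : w.re ^ 2 + w.im ^ 2 = u ^ 2 := by
    have := Complex.sq_norm w
    rw [Complex.normSq_apply, hn] at this
    linarith
  have e : (w / (1 - w)).re = (u * c - u ^ 2) / ((1 - u) ^ 2 + 2 * u * (1 - c)) := by
    rw [Complex.div_re, Complex.normSq_apply]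
    simp only [Complex.sub_re, Complex.one_re, Complex.sub_im, Complex.one_im]
    rw [← add_div]
    congr 1
    · rw [← hsq, ← hre]; ring
    · have h2 : (u * c) * (u * c) = u ^ 2 - w.im ^ 2 := by rw [← hre]; linarith
      rw [hre]; ring_nf; nlinarith
  rw [e]
  have h1 : 1 - u ≤ X := by have := Real.add_one_le_exp (-X); linarith
  have h2 : u * X ^ 2 ≤ (1 - u) ^ 2 := by
    have h3 : 1 + X ^ 2 / 2 ≤ Real.cosh X := by
      have e1 := Real.cosh_two_mul (X / 2)
      have e2 := Real.cosh_sq (X / 2)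
      have e3 : X / 2 ≤ Real.sinh (X / 2) := Real.self_le_sinh_iff.2 (by linarith)
      rw [mul_div_cancel₀ _ (by norm_num : (2 : ℝ) ≠ 0)] at e1
      nlinarith
    rw [Real.cosh_eq] at h3
    have h4 : Real.exp X * u = 1 := by rw [hu, ← Real.exp_add]; simp
    rw [← hu] at h3
    nlinarith
  have hd : 0 < X ^ 2 + 2 * (1 - c) := by
    have : 0 < X ^ 2 := by positivity
    linarith
  calc (u * c - u ^ 2) / ((1 - u) ^ 2 + 2 * u * (1 - c))
      ≤ (u * (1 - u)) / ((1 - u) ^ 2 + 2 * u * (1 - c)) := by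
        apply div_le_div_of_nonneg_right
        · nlinarith
        · have : 0 ≤ u * (1 - c) := mul_nonneg hu0.le (by linarith)
          nlinarith [sq_nonneg (1 - u)]
    _ ≤ (u * X) / (u * (X ^ 2 + 2 * (1 - c))) := by
        apply div_le_div₀
        · positivity
        · gcongr
        · positivity
        · nlinarith
    _ = _ := by rw [mul_div_mul_left _ _ hu0.ne']

theorem aq_le {x θ : ℝ} (hx : 0 < x) (m : ℕ) (hm : 1 ≤ m) :
    aq (Complex.exp (-(x + θ * Complex.I))) m ≤ x / (m ^ 2 * x ^ 2 + 2 * (1 - cpsi θ m)) := by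
  have hm' : (0 : ℝ) < m := by exact_mod_cast hm
  have hw : wq (Complex.exp (-(x + θ * Complex.I))) m
      = ((-(-1) ^ m : ℝ) : ℂ) * Complex.exp (((-(m * x) : ℝ) : ℂ) + ((-(m * θ) : ℝ) : ℂ) * Complex.I) := by
    rw [wq, neg_pow, ← Complex.exp_nat_mul]
    push_cast
    rw [neg_mul]
    congr 3
    ring
  have h := re_frac_bound (w := wq (Complex.exp (-(x + θ * Complex.I))) m) (X := m * x) (c := cpsi θ m)
    (by positivity) ?_ ?_ ?_
  · unfold aq
    rw [← Complex.ofReal_natCast, Complex.div_ofReal_re]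
    rw [div_le_iff₀ hm']
    refine h.trans (le_of_eq ?_)
    rw [mul_pow]; ring
  · unfold cpsi
    rcases neg_one_pow_eq_or ℝ m with h | h <;> rw [h]
    · linarith [Real.neg_one_le_cos (m * θ)]
    · linarith [Real.cos_le_one (m * θ)]
  · rw [wq_norm, Complex.norm_exp, ← Real.exp_nat_mul]
    congr 1; simp
  · rw [hw, Complex.re_ofReal_mul, Complex.exp_re]
    simp [cpsi]; ring

noncomputable def qe (x θ : ℝ) : ℂ := Complex.exp (-(x + θ * Complex.I))

theorem qe_norm (x θ : ℝ) : ‖qe x θ‖ = Real.exp (-x) := by simp [qe, Complex.norm_exp]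
theorem qe_ne (x θ : ℝ) : qe x θ ≠ 0 := Complex.exp_ne_zero _
theorem qe_lt {x : ℝ} (hx : 0 < x) (θ : ℝ) : ‖qe x θ‖ < 1 := by
  rw [qe_norm, Real.exp_lt_one_iff]; linarith

theorem cpsi_le_one (θ : ℝ) (m : ℕ) : cpsi θ m ≤ 1 := by
  unfold cpsi
  rcases neg_one_pow_eq_or ℝ m with h | h <;> rw [h]
  · linarith [Real.neg_one_le_cos (m * θ)]
  · linarith [Real.cos_le_one (m * θ)]

theorem cpsi_abs (θ : ℝ) (m : ℕ) : cpsi |θ| m = cpsi θ m := by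
  unfold cpsi
  rcases abs_choice θ with h | h <;> rw [h]
  rw [mul_neg, Real.cos_neg]

theorem aq_le' {x : ℝ} (hx : 0 < x) (θ : ℝ) (m : ℕ) (hm : 1 ≤ m) {d : ℝ} (hd : 0 ≤ d)
    (h : d ≤ 1 - cpsi θ m) : aq (qe x θ) m ≤ x / (m ^ 2 * x ^ 2 + 2 * d) := by
  have hm' : (0 : ℝ) < m := by exact_mod_cast hm
  refine (aq_le hx m hm).trans ?_
  gcongr

theorem aq_le_sq {x : ℝ} (hx : 0 < x) (θ : ℝ) (m : ℕ) (hm : 1 ≤ m) :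
    aq (qe x θ) m ≤ (1 / (m : ℝ) ^ 2) / x := by
  refine (aq_le' hx θ m hm le_rfl (by linarith [cpsi_le_one θ m])).trans (le_of_eq ?_)
  have hm' : (0 : ℝ) < m := by exact_mod_cast hm
  field_simp
  ring

theorem aq_le_big {x : ℝ} (hx : 0 < x) (θ : ℝ) (m : ℕ) (hm : 1 ≤ m) {d : ℝ} (hd : 0 < d)
    (h : d ≤ 1 - cpsi θ m) : aq (qe x θ) m ≤ x / (2 * d) := by
  refine (aq_le' hx θ m hm hd.le h).trans ?_
  gcongr
  have : 0 ≤ (m : ℝ) ^ 2 * x ^ 2 := by positivity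
  linarith

theorem zeta_tail (k : ℕ) : HasSum (fun m : ℕ => 1 / ((m + k : ℕ) : ℝ) ^ 2)
    (Real.pi ^ 2 / 6 - ∑ i ∈ Finset.range k, 1 / (i : ℝ) ^ 2) :=
  (hasSum_nat_add_iff' k).2 hasSum_zeta_two

theorem sum_aq_tail {x : ℝ} (hx : 0 < x) (θ : ℝ) (k : ℕ) (hk : 1 ≤ k) :
    ∑' m, aq (qe x θ) m ≤ ∑ i ∈ Finset.range k, aq (qe x θ) i
      + (Real.pi ^ 2 / 6 - ∑ i ∈ Finset.range k, 1 / (i : ℝ) ^ 2) / x := by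
  have hs := aq_summable (qe_lt hx θ)
  rw [← hs.sum_add_tsum_nat_add k]
  gcongr
  refine hasSum_le (fun m => ?_) ((summable_nat_add_iff k).2 hs).hasSum ((zeta_tail k).div_const x)
  exact aq_le_sq hx θ (m + k) (by omega)

theorem aq_zero (q : ℂ) : aq q 0 = 0 := by simp [aq]

theorem sum_aq_7 {x : ℝ} (hx : 0 < x) (θ : ℝ) :
    ∑' m, aq (qe x θ) m ≤ aq (qe x θ) 1 + aq (qe x θ) 2 + aq (qe x θ) 3 + aq (qe x θ) 4
      + aq (qe x θ) 5 + aq (qe x θ) 6 + 0.1536 / x := by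
  have h := sum_aq_tail hx θ 7 (by norm_num)
  have h2 : Real.pi ^ 2 / 6 - ∑ i ∈ Finset.range 7, 1 / (i : ℝ) ^ 2 ≤ 0.1536 := by
    have := Real.pi_lt_d4
    have h0 := Real.pi_pos
    norm_num [Finset.sum_range_succ]
    nlinarith
  have h3 : (Real.pi ^ 2 / 6 - ∑ i ∈ Finset.range 7, 1 / (i : ℝ) ^ 2) / x ≤ 0.1536 / x := by gcongr
  simp only [Finset.sum_range_succ (fun i => aq (qe x θ) i), Finset.sum_range_zero, aq_zero] at h
  linarith

theorem cos_five (θ : ℝ) :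
    Real.cos (5 * θ) = 16 * Real.cos θ ^ 5 - 20 * Real.cos θ ^ 3 + 5 * Real.cos θ := by
  rw [show 5 * θ = 3 * θ + 2 * θ by ring, Real.cos_add, Real.cos_three_mul, Real.cos_two_mul,
    Real.sin_three_mul, Real.sin_two_mul]
  have h := Real.sin_sq θ
  have e : (3 * Real.sin θ - 4 * Real.sin θ ^ 3) * (2 * Real.sin θ * Real.cos θ)
    = 2 * Real.cos θ * (3 * Real.sin θ ^ 2 - 4 * (Real.sin θ ^ 2) ^ 2) := by ring
  rw [e, h]; ring

theorem cpsi1 (θ : ℝ) : cpsi θ 1 = Real.cos θ := by simp [cpsi]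
theorem cpsi2 (θ : ℝ) : 1 - cpsi θ 2 = 2 * Real.cos θ ^ 2 := by
  simp [cpsi, Real.cos_two_mul]
theorem cpsi3 (θ : ℝ) : 1 - cpsi θ 3 = (1 - Real.cos θ) * (1 + 2 * Real.cos θ) ^ 2 := by
  norm_num [cpsi, Real.cos_three_mul]; ring
theorem cpsi4 (θ : ℝ) : 1 - cpsi θ 4 = 2 * (2 * Real.cos θ ^ 2 - 1) ^ 2 := by
  norm_num [cpsi]
  rw [show 4 * θ = 2 * (2 * θ) by ring, Real.cos_two_mul, Real.cos_two_mul]; ring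
theorem cpsi5 (θ : ℝ) : 1 - cpsi θ 5
    = 1 - (16 * Real.cos θ ^ 5 - 20 * Real.cos θ ^ 3 + 5 * Real.cos θ) := by
  norm_num [cpsi, cos_five]
theorem cpsi6 (θ : ℝ) : 1 - cpsi θ 6 = 2 * (4 * Real.cos θ ^ 3 - 3 * Real.cos θ) ^ 2 := by
  norm_num [cpsi]
  rw [show 6 * θ = 2 * (3 * θ) by ring, Real.cos_two_mul, Real.cos_three_mul]; ring

/-- `1 - cos φ ≥ 2 φ²/π²` -/
theorem one_sub_cos_ge {φ : ℝ} (h : |φ| ≤ Real.pi) : φ ^ 2 / 5 ≤ 1 - Real.cos φ := by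
  have h1 := Real.cos_le_one_sub_mul_cos_sq h
  have h2 := Real.pi_lt_d4
  have h0 := Real.pi_pos
  have h3 : (1:ℝ)/5 ≤ 2 / Real.pi ^ 2 := by
    rw [div_le_div_iff₀ (by norm_num) (by positivity)]; nlinarith
  nlinarith [sq_nonneg φ]

theorem aq_six_const {x : ℝ} (hx : 0 < x) (θ : ℝ) :
    aq (qe x θ) 4 + aq (qe x θ) 5 + aq (qe x θ) 6 ≤ 0.1303 / x := by
  have h4 := aq_le_sq hx θ 4 (by norm_num)
  have h5 := aq_le_sq hx θ 5 (by norm_num)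
  have h6 := aq_le_sq hx θ 6 (by norm_num)
  have hp : 0 < 1 / x := by positivity
  norm_num [div_eq_mul_inv] at h4 h5 h6 hp ⊢
  linarith [inv_pos.2 hx]

theorem x_le_inv {x : ℝ} (hx : 0 < x) (hx1 : x ≤ 1 / 1000) : x ≤ 0.000001 / x := by
  rw [le_div_iff₀ hx]; nlinarith

theorem aq_of_quad {x : ℝ} (hx : 0 < x) (θ : ℝ) (m : ℕ) (hm : 1 ≤ m) {K : ℝ} (hK : 0 < K)
    (h : K * x ^ 2 ≤ 1 - cpsi θ m) : aq (qe x θ) m ≤ (1 / (2 * K)) / x := by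
  refine (aq_le_big hx θ m hm (by positivity) h).trans (le_of_eq ?_)
  field_simp

theorem minor1 {x θ : ℝ} (hx : 0 < x) (hx1 : x ≤ 1 / 1000) (h1 : 20 * x ≤ |θ|)
    (h2 : |θ| ≤ Real.pi / 3) : ∑' m, aq (qe x θ) m ≤ 0.295 / x := by
  have h0 := Real.pi_pos
  have hs := sum_aq_7 hx θ
  have hc : 1 / 2 ≤ Real.cos θ := by
    rw [← Real.cos_abs, ← Real.cos_pi_div_three]
    exact Real.cos_le_cos_of_nonneg_of_le_pi (abs_nonneg _) (by linarith) h2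
  have hq : 80 * x ^ 2 ≤ 1 - Real.cos θ := by
    have := one_sub_cos_ge (φ := θ) (by linarith)
    have h3 : (20 * x) ^ 2 ≤ θ ^ 2 := by rw [← sq_abs θ]; gcongr
    linarith
  have a1 := aq_of_quad hx θ 1 le_rfl (K := 80) (by norm_num) (by rw [cpsi1]; exact hq)
  have a2 := aq_le_big hx θ 2 (by norm_num) (d := 1 / 2) (by norm_num) (by rw [cpsi2]; nlinarith)
  have a3 := aq_of_quad hx θ 3 (by norm_num) (K := 320) (by norm_num)
    (by rw [cpsi3]; nlinarith [mul_nonneg (by nlinarith : 0 ≤ 1 - Real.cos θ) (by nlinarith : 0 ≤ (1 + 2 * Real.cos θ) ^ 2 - 4)])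
  have a6 := aq_six_const hx θ
  have hxx := x_le_inv hx hx1
  have hp : 0 < 1 / x := by positivity
  norm_num [div_eq_mul_inv] at a1 a2 a3 a6 hs hxx hp ⊢
  linarith [inv_pos.2 hx]

theorem minor2 {x θ : ℝ} (hx : 0 < x) (hx1 : x ≤ 1 / 1000) (h1 : Real.pi / 3 ≤ |θ|)
    (h2 : |θ| ≤ Real.pi) (h3 : 20 * x ≤ |(|θ| - Real.pi / 2)|) :
    ∑' m, aq (qe x θ) m ≤ 0.295 / x := by
  have h0 := Real.pi_pos
  have hs := sum_aq_7 hx θ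
  have hc : Real.cos θ ≤ 1 / 2 := by
    rw [← Real.cos_abs, ← Real.cos_pi_div_three]
    exact Real.cos_le_cos_of_nonneg_of_le_pi (by positivity) h2 h1
  have hq : 160 * x ^ 2 ≤ Real.cos θ ^ 2 := by
    have e : Real.cos θ = - Real.sin (|θ| - Real.pi / 2) := by
      rw [← Real.cos_abs, Real.sin_sub_pi_div_two, neg_neg]
    have h4 := Real.mul_abs_le_abs_sin (x := |θ| - Real.pi / 2) (by rw [abs_le]; constructor <;> linarith [abs_nonneg θ])
    have h5 : 2 / Real.pi * (20 * x) ≤ |Real.cos θ| := by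
      rw [e, abs_neg]; exact le_trans (by gcongr) h4
    have h6 : (2 / Real.pi * (20 * x)) ^ 2 ≤ Real.cos θ ^ 2 := by rw [← sq_abs (Real.cos θ)]; gcongr
    have h7 : (1:ℝ)/5 ≤ 2 / Real.pi ^ 2 := by
      have := Real.pi_lt_d4
      rw [div_le_div_iff₀ (by norm_num) (by positivity)]; nlinarith
    have h8 : (2 / Real.pi * (20 * x)) ^ 2 = 2 / Real.pi ^ 2 * (800 * x ^ 2) := by field_simp; ring
    nlinarith [sq_nonneg x]
  have a1 := aq_le_big hx θ 1 le_rfl (d := 1 / 2) (by norm_num) (by rw [cpsi1]; linarith)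
  have a2 := aq_of_quad hx θ 2 (by norm_num) (K := 320) (by norm_num) (by rw [cpsi2]; linarith)
  have hxx := x_le_inv hx hx1
  have hp : 0 < 1 / x := by positivity
  by_cases h : 1 / 100 ≤ 1 - cpsi θ 3
  · have a3 := aq_le_big hx θ 3 (by norm_num) (d := 1 / 100) (by norm_num) h
    have a6 := aq_six_const hx θ
    norm_num [div_eq_mul_inv] at a1 a2 a3 a6 hs hxx hp ⊢
    linarith [inv_pos.2 hx]
  · rw [cpsi3] at h
    have a3 := aq_le_sq hx θ 3 (by norm_num)
    set c := Real.cos θ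
    have hh : (1 + 2 * c) ^ 2 < 1 / 50 := by nlinarith [sq_nonneg (1 + 2 * c)]
    have hl : -0.571 < c := by nlinarith
    have hu : c < -0.429 := by nlinarith
    have hcc : c ^ 2 < 0.3261 := by nlinarith
    have a4 := aq_le_big hx θ 4 (by norm_num) (d := 1 / 10) (by norm_num) (by rw [cpsi4]; nlinarith)
    have a5 := aq_le_big hx θ 5 (by norm_num) (d := 1 / 10) (by norm_num)
      (by rw [cpsi5]
          have h9 : 0 ≤ 16 * c ^ 4 - 20 * c ^ 2 + 5 := by nlinarith
          change 1 / 10 ≤ 1 - (16 * c ^ 5 - 20 * c ^ 3 + 5 * c)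
          nlinarith [mul_nonneg h9 (by linarith : 0 ≤ -c)])
    have a6 := aq_le_big hx θ 6 (by norm_num) (d := 1 / 10) (by norm_num)
      (by rw [cpsi6]
          change 1 / 10 ≤ 2 * (4 * c ^ 3 - 3 * c) ^ 2
          have h9 : 0.5 ≤ 4 * c ^ 3 - 3 * c := by nlinarith
          nlinarith)
    norm_num [div_eq_mul_inv] at a1 a2 a3 a4 a5 a6 hs hxx hp ⊢
    linarith [inv_pos.2 hx]

theorem near_i {x θ : ℝ} (hx : 0 < x) (hx1 : x ≤ 1 / 1000)
    (h3 : |(|θ| - Real.pi / 2)| ≤ 20 * x) :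
    ∑' m, aq (qe x θ) m ≤ (1 / 3.8) * (x / (x ^ 2 + (|θ| - Real.pi / 2) ^ 2)) + 0.183 / x := by
  have hs := sum_aq_7 hx θ
  have e : Real.cos θ = - Real.sin (|θ| - Real.pi / 2) := by
    rw [← Real.cos_abs, Real.sin_sub_pi_div_two, neg_neg]
  set y := |θ| - Real.pi / 2
  have hy : |y| ≤ 0.02 := by linarith
  have hcy : |Real.cos θ| ≤ |y| := by rw [e, abs_neg]; exact Real.abs_sin_le_abs
  have hc2 : 0.98 * y ^ 2 ≤ Real.cos θ ^ 2 := by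
    rw [e, neg_sq]
    have key : ∀ z : ℝ, 0 ≤ z → z ≤ 0.02 → 0.99 * z ≤ Real.sin z := by
      intro z hz hz1
      rcases hz.eq_or_lt with rfl | hz
      · simp
      · have := Real.sin_gt_sub_cube hz
        nlinarith [mul_pos hz hz]
    have h := key |y| (abs_nonneg _) hy
    have h' : Real.sin |y| ^ 2 = Real.sin y ^ 2 := by
      rcases abs_choice y with h | h <;> rw [h] <;> simp
    rw [← h', ← sq_abs y]
    nlinarith [abs_nonneg y]
  have hxx := x_le_inv hx hx1
  have hp : 0 < 1 / x := by positivity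
  have a2 : aq (qe x θ) 2 ≤ (1 / 3.8) * (x / (x ^ 2 + y ^ 2)) := by
    refine (aq_le' hx θ 2 (by norm_num) (d := 2 * (0.98 * y ^ 2)) (by positivity) (by rw [cpsi2]; linarith)).trans ?_
    rw [div_mul_div_comm, one_mul]
    gcongr
    push_cast
    nlinarith [sq_nonneg y, sq_nonneg x]
  obtain ⟨hl, hu⟩ := abs_le.1 (hcy.trans hy)
  have a6 := aq_le_sq hx θ 6 (by norm_num)
  have a1 := aq_le_big hx θ 1 le_rfl (d := 1 / 2) (by norm_num) (by rw [cpsi1]; linarith)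
  set c := Real.cos θ
  have a3 := aq_le_big hx θ 3 (by norm_num) (d := 1 / 2) (by norm_num) (by 
    rw [cpsi3]; change 1 / 2 ≤ (1 - c) * (1 + 2 * c) ^ 2
    have : 0.9 ≤ (1 + 2 * c) ^ 2 := by nlinarith
    nlinarith)
  have hcc : c ^ 2 < 0.0005 := by nlinarith
  have a4 := aq_le_big hx θ 4 (by norm_num) (d := 1 / 2) (by norm_num) (by 
    rw [cpsi4]; change 1 / 2 ≤ 2 * (2 * c ^ 2 - 1) ^ 2; nlinarith)
  have a5 := aq_le_big hx θ 5 (by norm_num) (d := 1 / 2) (by norm_num) (by 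
    rw [cpsi5]; change 1 / 2 ≤ 1 - (16 * c ^ 5 - 20 * c ^ 3 + 5 * c)
    have h9 : |16 * c ^ 4 - 20 * c ^ 2 + 5| ≤ 6 := by rw [abs_le]; constructor <;> nlinarith [sq_nonneg c]
    have h10 : |c * (16 * c ^ 4 - 20 * c ^ 2 + 5)| ≤ 0.02 * 6 := by
      rw [abs_mul]; exact mul_le_mul (hcy.trans hy) h9 (abs_nonneg _) (by norm_num)
    have := (abs_le.1 h10).2
    nlinarith)
  norm_num [div_eq_mul_inv] at a1 a2 a3 a4 a5 a6 hs hxx hp ⊢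
  linarith [inv_pos.2 hx]

noncomputable def z8 : ℂ := Complex.exp (Real.pi * Complex.I / 4)

theorem z8_eq : z8 = Complex.exp ((Real.pi / 4 : ℝ) * Complex.I) := by
  unfold z8; congr 1; push_cast; ring

theorem z8_norm : ‖z8‖ = 1 := by rw [z8_eq, Complex.norm_exp_ofReal_mul_I]

theorem z8_re : z8.re = Real.sqrt 2 / 2 := by
  rw [z8_eq, Complex.exp_ofReal_mul_I_re, Real.cos_pi_div_four]

theorem z8_ne_one : z8 ≠ 1 := by
  intro h
  have h1 := z8_re
  rw [h, Complex.one_re] at h1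
  have h2 : Real.sqrt 2 = 2 := by linarith
  have h3 := Real.sq_sqrt (show (0:ℝ) ≤ 2 by norm_num)
  rw [h2] at h3; norm_num at h3

theorem tsum_ratio_norm {r : ℝ} (h0 : 0 ≤ r) (hr : r < 1) (c Q : ℕ → ℂ) (hc : ∀ j, ‖c j‖ ≤ r ^ j)
    (hQ : ∀ j, ‖Q j‖ ≤ r) : ‖∑' j, c j / (1 - Q j)‖ ≤ 1 / (1 - r) ^ 2 := by
  have hp : 0 < 1 - r := by linarith
  have hg := (hasSum_geometric_of_lt_one h0 hr).div_const (1 - r)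
  have : 1 / (1 - r) ^ 2 = (1 - r)⁻¹ / (1 - r) := by field_simp
  rw [this]
  refine tsum_of_norm_bounded hg (fun j => ?_)
  rw [norm_div]
  exact div_le_div₀ (by positivity) (hc j) hp (one_sub_norm_ge (hQ j))

theorem norm_S_le {x : ℝ} (hx : 0 < x) (hx1 : x ≤ 1 / 1000) (θ : ℝ) :
    ‖(1 - z8) * Sq z8 (qe x θ)‖ ≤ 17 / x ^ 2 := by
  have hz := z8_norm
  have hzi : ‖z8⁻¹‖ = 1 := by simp [hz]
  have hq1 := qe_lt hx θ
  have hq0 := qe_ne x θ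
  have h1 := tsum_ratio_norm (norm_nonneg _) hq1 (cP (qe x θ)) (QP z8 (qe x θ)) (cP_norm hq1) (QP_norm hz hq1)
  have h2 := tsum_ratio_norm (norm_nonneg _) hq1 (fun j => -z8⁻¹ * cP (qe x θ) j) (QP z8⁻¹ (qe x θ))
    (fun j => by rw [norm_mul, norm_neg, hzi, one_mul]; exact cP_norm hq1 j) (QP_norm hzi hq1)
  rw [(Sq_hasSum hz hq0 hq1).2]
  have hb : 1 / (1 - ‖qe x θ‖) ^ 2 ≤ 4 / x ^ 2 := by
    rw [qe_norm]
    have h3 : x / 2 ≤ 1 - Real.exp (-x) := by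
      have h4 : Real.exp (-x) ≤ 1 / (1 + x) := by
        rw [Real.exp_neg, ← one_div]
        gcongr
        linarith [Real.add_one_le_exp x]
      have : 1 / (1 + x) ≤ 1 - x / 2 := by
        rw [div_le_iff₀ (by linarith)]; nlinarith
      linarith
    have : 4 / x ^ 2 = 1 / (x / 2) ^ 2 := by field_simp; norm_num
    rw [this]
    gcongr
  have hne : 1 - z8 ≠ 0 := sub_ne_zero.2 z8_ne_one.symm
  have h5 : ‖1 - z8‖ ≤ 2 := by
    refine (norm_sub_le _ _).trans ?_
    rw [hz, norm_one]; norm_num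
  set T1 := ∑' j, cP (qe x θ) j / (1 - QP z8 (qe x θ) j)
  set T2 := ∑' j, (-z8⁻¹ * cP (qe x θ) j) / (1 - QP z8⁻¹ (qe x θ) j)
  have e : (1 - z8) * (1 / (1 - z8) + T1 + T2) = 1 + (1 - z8) * (T1 + T2) := by field_simp; ring
  rw [e]
  have h6 : ‖(1 - z8) * (T1 + T2)‖ ≤ 2 * (8 / x ^ 2) := by
    rw [norm_mul]
    refine mul_le_mul h5 ?_ (norm_nonneg _) (by norm_num)
    refine (norm_add_le _ _).trans ?_
    have : 8 / x ^ 2 = 4 / x ^ 2 + 4 / x ^ 2 := by ring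
    rw [this]
    exact add_le_add (h1.trans hb) (h2.trans hb)
  have h7 : (1:ℝ) ≤ 1 / x ^ 2 := by
    rw [le_div_iff₀ (by positivity)]; nlinarith
  refine (norm_add_le _ _).trans ?_
  rw [norm_one]
  have : 17 / x ^ 2 = 1 / x ^ 2 + 2 * (8 / x ^ 2) := by ring
  rw [this]
  exact add_le_add h7 h6

theorem norm_F_minor {x θ : ℝ} (hx : 0 < x) (hx1 : x ≤ 1 / 1000) (h1 : 20 * x ≤ |θ|)
    (h2 : |θ| ≤ Real.pi) (h3 : 20 * x ≤ |(|θ| - Real.pi / 2)|) :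
    ‖Fq z8 (qe x θ)‖ ≤ 17 / x ^ 2 * Real.exp (0.295 / x) := by
  rw [Fq_eq z8_norm z8_ne_one (qe_ne x θ) (qe_lt hx θ)]
  have : (1 - z8) * (Pq (qe x θ) * Sq z8 (qe x θ)) = (1 - z8) * Sq z8 (qe x θ) * Pq (qe x θ) := by ring
  rw [this, norm_mul]
  refine mul_le_mul (norm_S_le hx hx1 θ) ?_ (norm_nonneg _) (by positivity)
  refine (norm_Pq_le (qe_ne x θ) (qe_lt hx θ)).trans (Real.exp_le_exp.2 ?_)
  rcases le_total |θ| (Real.pi / 3) with h | h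
  · exact minor1 hx hx1 h1 h
  · exact minor2 hx hx1 h h2 h3

theorem strip_shift (f : ℂ → ℂ) (U : Set ℂ) (hf : DifferentiableOn ℂ f U) (b : ℝ)
    (hs : ∀ u v : ℝ, v ∈ Set.uIcc 0 b → (u + v * Complex.I : ℂ) ∈ U)
    (hd : ∀ ε > 0, ∃ R : ℝ, ∀ u v : ℝ, R ≤ |u| → v ∈ Set.uIcc 0 b → ‖f (u + v * Complex.I)‖ ≤ ε)
    (hi : MeasureTheory.Integrable (fun u : ℝ => f u - f (u + b * Complex.I))) :
    ∫ u : ℝ, (f u - f (u + b * Complex.I)) = 0 := by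
  have hcont : ∀ v ∈ Set.uIcc 0 b, Continuous (fun u : ℝ => f (u + v * Complex.I)) := by
    intro v hv
    rw [← continuousOn_univ]
    exact hf.continuousOn.comp (by fun_prop) (fun u _ => hs u v hv)
  have rect : ∀ R : ℝ, (∫ u in (-R)..R, (f u - f (u + b * Complex.I)))
      = - (Complex.I • ∫ v in (0:ℝ)..b, f (R + v * Complex.I))
        + Complex.I • ∫ v in (0:ℝ)..b, f (-R + v * Complex.I) := by
    intro R
    have h := Complex.integral_boundary_rect_eq_zero_of_differentiableOn f (-R : ℂ) (R + b * Complex.I) ?_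
    · simp only [Complex.neg_re, Complex.ofReal_re, Complex.neg_im, Complex.ofReal_im, neg_zero, Complex.add_re, Complex.mul_re, Complex.I_re, mul_zero, Complex.I_im, mul_one,
        sub_zero, add_zero, Complex.add_im, Complex.mul_im, zero_add, Complex.ofReal_zero, zero_mul, Complex.ofReal_neg] at h
      have h1 := hcont 0 Set.left_mem_uIcc
      simp only [Complex.ofReal_zero, zero_mul, add_zero] at h1
      rw [intervalIntegral.integral_sub (h1.intervalIntegrable _ _) ((hcont b Set.right_mem_uIcc).intervalIntegrable _ _)]
      linear_combination h
    · refine hf.mono ?_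
      rintro w ⟨_, hw⟩
      have := hs w.re w.im (by simpa using hw)
      rwa [Complex.re_add_im] at this
  have hv : ∀ σ : ℝ, |σ| = 1 → Tendsto (fun R : ℝ => Complex.I • ∫ v in (0:ℝ)..b, f ((σ * R : ℝ) + v * Complex.I)) atTop (𝓝 0) := by
    intro σ hσ
    have hz : Tendsto (fun R : ℝ => ∫ v in (0:ℝ)..b, f ((σ * R : ℝ) + v * Complex.I)) atTop (𝓝 0) → Tendsto (fun R : ℝ => Complex.I • ∫ v in (0:ℝ)..b, f ((σ * R : ℝ) + v * Complex.I)) atTop (𝓝 0) := by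
      intro h
      simpa using h.const_smul Complex.I
    apply hz
    rw [Metric.tendsto_atTop]
    intro ε hε
    obtain ⟨R, hR⟩ := hd (ε / (|b| + 1)) (by positivity)
    refine ⟨R, fun n hn => ?_⟩
    rw [dist_zero_right]
    have : ‖∫ v in (0:ℝ)..b, f ((σ * n : ℝ) + v * Complex.I)‖ ≤ ε / (|b| + 1) * |b - 0| := by
      apply intervalIntegral.norm_integral_le_of_norm_le_const
      intro v hv
      apply hR _ _ _ (Set.uIoc_subset_uIcc hv)
      rw [abs_mul, hσ, one_mul]; exact hn.trans (le_abs_self _)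
    refine this.trans_lt ?_
    rw [sub_zero, div_mul_eq_mul_div, div_lt_iff₀ (by positivity)]
    nlinarith [abs_nonneg b]
  have hlim := MeasureTheory.intervalIntegral_tendsto_integral hi tendsto_neg_atTop_atBot tendsto_id
  refine tendsto_nhds_unique hlim ?_
  have h1 := (hv 1 (by simp)).neg.add (hv (-1) (by simp))
  simp only [neg_zero, add_zero] at h1
  refine h1.congr (fun R => ?_)
  simp only [id]
  rw [rect]
  simp

/-- real-translation corollary -/
theorem line_shift (f : ℂ → ℂ) (U : Set ℂ) (hf : DifferentiableOn ℂ f U) (a : ℂ)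
    (hs : ∀ u v : ℝ, v ∈ Set.uIcc 0 a.im → (u + v * Complex.I : ℂ) ∈ U)
    (hd : ∀ ε > 0, ∃ R : ℝ, ∀ u v : ℝ, R ≤ |u| → v ∈ Set.uIcc 0 a.im → ‖f (u + v * Complex.I)‖ ≤ ε)
    (h0 : MeasureTheory.Integrable (fun u : ℝ => f u))
    (h1 : MeasureTheory.Integrable (fun u : ℝ => f (u + a))) :
    ∫ u : ℝ, f u = ∫ u : ℝ, f (u + a) := by
  have e : ∀ u : ℝ, f (((u - a.re : ℝ) : ℂ) + a) = f (u + a.im * Complex.I) := by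
    intro u; congr 1
    apply Complex.ext <;> simp
  have h2 : MeasureTheory.Integrable (fun u : ℝ => f (u + a.im * Complex.I)) := by
    have := h1.comp_sub_right a.re
    simpa only [e] using this
  have h := strip_shift f U hf a.im hs hd (h0.sub h2)
  rw [MeasureTheory.integral_sub h0 h2, sub_eq_zero] at h
  rw [h, ← MeasureTheory.integral_sub_right_eq_self (fun u : ℝ => f (u + a)) a.re]
  simp only [e]

/-- crossing one pole sitting halfway -/
theorem line_shift_pole (f p : ℂ → ℂ) (U : Set ℂ) (hU : IsOpen U) (hp : DifferentiableOn ℂ p U) (a : ℂ)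
    (ha : 0 < a.im)
    (hfp : ∀ w, w ≠ a / 2 → f w = p w / (w - a / 2))
    (hs : ∀ u v : ℝ, v ∈ Set.uIcc 0 a.im → (u + v * Complex.I : ℂ) ∈ U)
    (hd : ∀ ε > 0, ∃ R : ℝ, ∀ u v : ℝ, R ≤ |u| → v ∈ Set.uIcc 0 a.im → ‖f (u + v * Complex.I)‖ ≤ ε)
    (h0 : MeasureTheory.Integrable (fun u : ℝ => f u))
    (h1 : MeasureTheory.Integrable (fun u : ℝ => f (u + a))) :
    ∫ u : ℝ, f u = (∫ u : ℝ, f (u + a)) + 2 * Real.pi * Complex.I * p (a / 2) := by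
  have e : ∀ u : ℝ, f (((u - a.re : ℝ) : ℂ) + a) = f (u + a.im * Complex.I) := by
    intro u; congr 1
    apply Complex.ext <;> simp
  have h2 : MeasureTheory.Integrable (fun u : ℝ => f (u + a.im * Complex.I)) := by
    have := h1.comp_sub_right a.re
    simpa only [e] using this
  set w0 := a / 2 with hw0
  have hre : w0.re = a.re / 2 := by simp [hw0]
  have him : w0.im = a.im / 2 := by simp [hw0]
  have hmem : w0 ∈ U := by
    have := hs w0.re w0.im (by rw [him, Set.uIcc_of_le ha.le]; constructor <;> linarith)
    rwa [Complex.re_add_im] at this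
  set F := dslope p w0
  have hF : DifferentiableOn ℂ F U := (Complex.differentiableOn_dslope (hU.mem_nhds hmem)).2 hp
  have hFe : ∀ w, w ≠ w0 → F w = f w - p w0 / (w - w0) := by
    intro w hw
    have : w - w0 ≠ 0 := sub_ne_zero.2 hw
    rw [show F w = slope p w0 w from dslope_of_ne _ hw, slope_def_field, hfp w hw]
    ring
  have hne0 : ∀ u : ℝ, (u : ℂ) ≠ w0 := by
    intro u h
    have := congrArg Complex.im h
    rw [him] at this; simp at this; linarith
  have hne1 : ∀ u : ℝ, (u + a.im * Complex.I : ℂ) ≠ w0 := by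
    intro u h
    have := congrArg Complex.im h
    rw [him] at this; simp at this; linarith
  set s := a.im / 2 with hs'
  have hs0 : 0 < s := by positivity
  have hdiff : ∀ u : ℝ, F u - F (u + a.im * Complex.I) = (f u - f (u + a.im * Complex.I))
      - 2 * Complex.I * p w0 * ((s * (1 + ((u - w0.re) / s) ^ 2))⁻¹ : ℝ) := by
    intro u
    rw [hFe _ (hne0 u), hFe _ (hne1 u)]
    have h3 : (u : ℂ) - w0 = (u - w0.re : ℝ) - s * Complex.I := by
      apply Complex.ext <;> simp [him, hs']
    have h4 : (u + a.im * Complex.I : ℂ) - w0 = (u - w0.re : ℝ) + s * Complex.I := by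
      apply Complex.ext <;> simp [him, hs']; ring
    have h5 := sub_ne_zero.2 (hne0 u)
    have h6 := sub_ne_zero.2 (hne1 u)
    rw [h3] at h5 ⊢; rw [h4] at h6 ⊢
    generalize u - w0.re = y at *
    have h7 : ((y:ℂ) - s * Complex.I) * (y + s * Complex.I) = ((y ^ 2 + s ^ 2 : ℝ) : ℂ) := by
      push_cast; linear_combination (-(s:ℂ)^2) * Complex.I_sq
    have h8 : (s * (1 + (y / s) ^ 2))⁻¹ = s / (y ^ 2 + s ^ 2) := by
      field_simp; rw [add_comm]
    have h9 : ((y ^ 2 + s ^ 2 : ℝ) : ℂ) ≠ 0 := by rw [← h7]; exact mul_ne_zero h5 h6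
    rw [h8, Complex.ofReal_div s (y ^ 2 + s ^ 2), ← h7]
    field_simp
    ring
  have hInt1 : MeasureTheory.Integrable (fun u : ℝ => ((s * (1 + ((u - w0.re) / s) ^ 2))⁻¹ : ℝ)) := by
    simp only [mul_inv]
    exact ((integrable_inv_one_add_sq.comp_div hs0.ne').comp_sub_right w0.re).const_mul s⁻¹
  have hval : ∫ u : ℝ, (s * (1 + ((u - w0.re) / s) ^ 2))⁻¹ = Real.pi := by
    rw [MeasureTheory.integral_sub_right_eq_self (fun u : ℝ => (s * (1 + (u / s) ^ 2))⁻¹)]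
    simp only [mul_inv]
    rw [MeasureTheory.integral_const_mul, MeasureTheory.Measure.integral_comp_div (fun u : ℝ => (1 + u ^ 2)⁻¹),
      integral_univ_inv_one_add_sq, abs_of_pos hs0, smul_eq_mul]
    field_simp
  have hInt2 : MeasureTheory.Integrable (fun u : ℝ => 2 * Complex.I * p w0 *
      (((s * (1 + ((u - w0.re) / s) ^ 2))⁻¹ : ℝ) : ℂ)) :=
    (hInt1.ofReal (𝕜 := ℂ)).const_mul (2 * Complex.I * p w0)
  have hI : MeasureTheory.Integrable (fun u : ℝ => F u - F (u + a.im * Complex.I)) := by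
    simp only [hdiff]
    exact (h0.sub h2).sub hInt2
  have h := strip_shift F U hF a.im hs ?_ hI
  · simp only [hdiff] at h
    rw [MeasureTheory.integral_sub (f := fun u : ℝ => f u - f (u + a.im * Complex.I)) (h0.sub h2) hInt2, MeasureTheory.integral_sub h0 h2,
      MeasureTheory.integral_const_mul, integral_complex_ofReal, hval] at h
    have h3 : ∫ u : ℝ, f (u + a) = ∫ u : ℝ, f (u + a.im * Complex.I) := by
      rw [← MeasureTheory.integral_sub_right_eq_self (fun u : ℝ => f (u + a)) a.re]
      simp only [e]
    rw [h3]
    linear_combination h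
  · intro ε hε
    obtain ⟨R, hR⟩ := hd (ε / 2) (by positivity)
    refine ⟨max R (|w0.re| + 1 + ‖p w0‖ / (ε / 2)), fun u v hu hv => ?_⟩
    have hu1 := (le_max_left _ _).trans hu
    have hu2 := (le_max_right _ _).trans hu
    have hpos : 0 ≤ ‖p w0‖ / (ε / 2) := by positivity
    have hn : 1 + ‖p w0‖ / (ε / 2) ≤ ‖(u + v * Complex.I : ℂ) - w0‖ := by
      have h3 := Complex.abs_re_le_norm ((u + v * Complex.I : ℂ) - w0)
      simp at h3
      have := abs_sub_abs_le_abs_sub u w0.re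
      linarith
    have hne : (u + v * Complex.I : ℂ) ≠ w0 := by
      intro h; rw [h, sub_self, norm_zero] at hn; linarith
    rw [hFe _ hne]
    refine (norm_sub_le _ _).trans ?_
    have h4 : ‖p w0 / ((u + v * Complex.I : ℂ) - w0)‖ ≤ ε / 2 := by
      rw [norm_div, div_le_iff₀ (by linarith)]
      have : ‖p w0‖ = ε / 2 * (‖p w0‖ / (ε / 2)) := by field_simp
      nlinarith
    linarith [hR u v hu1 hv]

noncomputable def Nk (t : ℂ) (ζ : ℝ) (w : ℂ) : ℂ :=
  Complex.exp (-2 * Real.pi * Complex.I * ζ * w - t * (2 * w ^ 2 + w))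
noncomputable def Dk (t : ℂ) (α : ℝ) (w : ℂ) : ℂ := 1 - Complex.exp (α * Complex.I - 2 * t * w)
noncomputable def Hk (t : ℂ) (α ζ : ℝ) (w : ℂ) : ℂ := Nk t ζ w / Dk t α w

def Sect (t : ℂ) : Prop := 0 < t.re ∧ |t.im| ≤ 20 * t.re

theorem Sect.ne {t : ℂ} (h : Sect t) : t ≠ 0 := by
  rintro rfl; simpa using h.1

theorem Sect.norm_le {t : ℂ} (h : Sect t) : ‖t‖ ≤ 21 * t.re := by
  have := Complex.norm_le_abs_re_add_abs_im t
  rw [abs_of_pos h.1] at this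
  linarith [h.2]

theorem Sect.r_eq {t : ℂ} : (t⁻¹).re = t.re / (t.re ^ 2 + t.im ^ 2) := by
  rw [Complex.inv_re, Complex.normSq_apply]; ring_nf

theorem Sect.r_pos {t : ℂ} (h : Sect t) : 0 < (t⁻¹).re := by
  rw [Sect.r_eq]; have := h.1; positivity

theorem Sect.r_ge {t : ℂ} (h : Sect t) : 1 / (401 * t.re) ≤ (t⁻¹).re := by
  rw [Sect.r_eq]
  have h1 := h.1
  have h2 : t.im ^ 2 ≤ (20 * t.re) ^ 2 := by rw [← sq_abs t.im]; gcongr; exact h.2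
  rw [div_le_div_iff₀ (by positivity) (by positivity)]
  nlinarith

theorem Sect.r_le {t : ℂ} (h : Sect t) : (t⁻¹).re ≤ 1 / t.re := by
  rw [Sect.r_eq]
  have h1 := h.1
  rw [div_le_div_iff₀ (by positivity) (by positivity)]
  nlinarith [sq_nonneg t.im]

theorem norm_exp_beta (t : ℂ) (β u : ℝ) :
    ‖Complex.exp (β * Complex.I - 2 * t * u)‖ = Real.exp (-2 * (t.re * u)) := by
  rw [Complex.norm_exp]; congr 1; simp; ring

theorem den_far (t : ℂ) (β u : ℝ) (h : 1 / 500 ≤ |t.re * u|) :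
    1 / 300 ≤ ‖1 - Complex.exp (β * Complex.I - 2 * t * u)‖ := by
  have h1 := norm_exp_beta t β u
  rcases le_abs.1 h with h | h
  · have h2 : Real.exp (-2 * (t.re * u)) ≤ 1 / (1 + 1 / 250) := by
      rw [show -2 * (t.re * u) = -(2 * (t.re * u)) by ring, Real.exp_neg, ← one_div]
      gcongr
      linarith [Real.add_one_le_exp (2 * (t.re * u))]
    have h3 : (1:ℝ) / (1 + 1 / 250) ≤ 1 - 1 / 300 := by norm_num
    have := norm_sub_norm_le 1 (Complex.exp (β * Complex.I - 2 * t * u))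
    rw [h1, norm_one] at this
    linarith
  · have h2 := Real.add_one_le_exp (-2 * (t.re * u))
    have := norm_sub_norm_le (Complex.exp (β * Complex.I - 2 * t * u)) 1
    rw [h1, norm_one, norm_sub_rev] at this
    linarith

theorem den_ge {t : ℂ} (ht : Sect t) (β u : ℝ) (hb : 0.3 ≤ ‖1 - Complex.exp (β * Complex.I)‖) :
    1 / 300 ≤ ‖1 - Complex.exp (β * Complex.I - 2 * t * u)‖ := by
  rcases le_total (1 / 500) |t.re * u| with h | h
  · exact den_far t β u h
  · have e : 1 - Complex.exp (β * Complex.I - 2 * t * u) = (1 - Complex.exp (β * Complex.I))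
        - Complex.exp (β * Complex.I) * (Complex.exp (-(2 * t * u)) - 1) := by
      rw [sub_eq_add_neg (β * Complex.I), Complex.exp_add]; ring
    have h2 : ‖-(2 * t * u)‖ ≤ 0.084 := by
      rw [norm_neg, norm_mul, norm_mul, Complex.norm_real, Complex.norm_two, Real.norm_eq_abs]
      have := ht.norm_le
      have h3 : ‖t‖ * |u| ≤ 21 * t.re * |u| := by gcongr
      rw [abs_mul, abs_of_pos ht.1] at h
      nlinarith
    have h3 := Complex.norm_exp_sub_one_le (h2.trans (by norm_num))
    have h4 := norm_sub_norm_le (1 - Complex.exp (β * Complex.I))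
      (Complex.exp (β * Complex.I) * (Complex.exp (-(2 * t * u)) - 1))
    rw [norm_mul, Complex.norm_exp_ofReal_mul_I, one_mul] at h4
    rw [e]
    linarith

theorem Dk_line {t : ℂ} (ht : t ≠ 0) (α κ u : ℝ) :
    Dk t α (u + κ * Complex.I / t) = 1 - Complex.exp ((α - 2 * κ : ℝ) * Complex.I - 2 * t * u) := by
  unfold Dk; congr 2; push_cast; field_simp; ring

theorem Nk_line {t : ℂ} (ht : t ≠ 0) (ζ κ u : ℝ) :
    ‖Nk t ζ (u + κ * Complex.I / t)‖ = Real.exp (-(2 * t.re * u ^ 2 + t.re * u)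
      + (2 * κ ^ 2 + 2 * Real.pi * ζ * κ) * (t⁻¹).re) := by
  unfold Nk
  rw [Complex.norm_exp]
  congr 1
  have : (-2 * Real.pi * Complex.I * ζ * (u + κ * Complex.I / t)
      - t * (2 * (u + κ * Complex.I / t) ^ 2 + (u + κ * Complex.I / t)))
      = -(t * (2 * u ^ 2 + u : ℝ)) + ((2 * κ ^ 2 + 2 * Real.pi * ζ * κ : ℝ) : ℂ) * t⁻¹
        + ((-2 * Real.pi * ζ * u - 4 * κ * u - κ : ℝ) : ℂ) * Complex.I := by
    push_cast
    field_simp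
    linear_combination (-2 * κ ^ 2 - 2 * Real.pi * ζ * κ) * Complex.I_sq
  rw [this]
  simp only [Complex.add_re, Complex.neg_re, Complex.re_mul_ofReal, Complex.re_ofReal_mul, Complex.I_re, mul_zero]
  ring

theorem Hk_line_le {t : ℂ} (ht : Sect t) (α ζ κ u : ℝ)
    (hD : 1 / 300 ≤ ‖1 - Complex.exp ((α - 2 * κ : ℝ) * Complex.I - 2 * t * u)‖) :
    ‖Hk t α ζ (u + κ * Complex.I / t)‖ ≤ 300 * Real.exp (t.re / 4
      + (2 * κ ^ 2 + 2 * Real.pi * ζ * κ) * (t⁻¹).re) * Real.exp (-t.re * u ^ 2) := by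
  unfold Hk
  rw [norm_div, Nk_line ht.ne, Dk_line ht.ne, div_le_iff₀ (by linarith), mul_assoc 300, ← Real.exp_add]
  have h1 : Real.exp (-(2 * t.re * u ^ 2 + t.re * u) + (2 * κ ^ 2 + 2 * Real.pi * ζ * κ) * (t⁻¹).re)
    ≤ Real.exp (t.re / 4 + (2 * κ ^ 2 + 2 * Real.pi * ζ * κ) * (t⁻¹).re + -t.re * u ^ 2) := by
    rw [Real.exp_le_exp]
    nlinarith [mul_nonneg ht.1.le (sq_nonneg (u + 1 / 2))]
  refine h1.trans ?_
  have := Real.exp_pos (t.re / 4 + (2 * κ ^ 2 + 2 * Real.pi * ζ * κ) * (t⁻¹).re + -t.re * u ^ 2)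
  nlinarith

theorem im_line (t : ℂ) (κ : ℝ) : (κ * Complex.I / t).im = κ * (t⁻¹).re := by
  rw [div_eq_mul_inv, mul_assoc, Complex.im_ofReal_mul, Complex.I_mul_im]

theorem re_line (t : ℂ) (κ : ℝ) : (κ * Complex.I / t).re = -(κ * (t⁻¹).im) := by
  rw [div_eq_mul_inv, mul_assoc, Complex.re_ofReal_mul, Complex.I_mul_re]; ring

/-- points of the strip in skew coordinates -/
theorem strip_pt {t : ℂ} (ht : Sect t) (κ0 u v : ℝ) (hv : v ∈ Set.uIcc 0 (κ0 * Complex.I / t).im) :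
    ∃ κ ∈ Set.uIcc 0 κ0, (u + v * Complex.I : ℂ) = ((u + κ * (t⁻¹).im : ℝ) : ℂ) + κ * Complex.I / t := by
  have hr := ht.r_pos
  rw [im_line] at hv
  refine ⟨v / (t⁻¹).re, ?_, ?_⟩
  · rcases le_total 0 κ0 with h | h
    · rw [Set.uIcc_of_le (by positivity)] at hv
      rw [Set.uIcc_of_le h]
      exact ⟨div_nonneg hv.1 hr.le, (div_le_iff₀ hr).2 hv.2⟩
    · rw [Set.uIcc_of_ge (by nlinarith)] at hv
      rw [Set.uIcc_of_ge h]
      exact ⟨(le_div_iff₀ hr).2 hv.1, div_nonpos_of_nonpos_of_nonneg hv.2 hr.le⟩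
  · have e1 := re_line t (v / (t⁻¹).re)
    have e2 := im_line t (v / (t⁻¹).re)
    have e3 : v = v / (t⁻¹).re * (t⁻¹).re := (div_mul_cancel₀ v hr.ne').symm
    generalize v / (t⁻¹).re = κ at *
    generalize (t⁻¹).im = ρ at *
    apply Complex.ext
    · rw [Complex.add_re, Complex.add_re, e1]; simp
    · rw [Complex.add_im, Complex.add_im, e2, ← e3]; simp

theorem Hk_decay {t : ℂ} (ht : Sect t) (α ζ κ0 : ℝ) : ∀ ε > 0, ∃ R : ℝ, ∀ u v : ℝ, R ≤ |u| →
    v ∈ Set.uIcc 0 (κ0 * Complex.I / t).im → ‖Hk t α ζ (u + v * Complex.I)‖ ≤ ε := by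
  intro ε hε
  have hx := ht.1
  have hr := ht.r_pos
  set E := (2 * |κ0| ^ 2 + 2 * Real.pi * |ζ| * |κ0|) * (t⁻¹).re
  have hlim : Tendsto (fun s : ℝ => 300 * Real.exp (t.re / 4 + E) * Real.exp (-t.re * s ^ 2)) atTop (𝓝 0) := by
    rw [← mul_zero (300 * Real.exp (t.re / 4 + E))]
    refine Tendsto.const_mul _ (Real.tendsto_exp_atBot.comp ?_)
    have : Tendsto (fun s : ℝ => s ^ 2) atTop atTop := tendsto_pow_atTop (by norm_num)
    simpa using (this.const_mul_atTop_of_neg (by linarith : -t.re < 0))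
  obtain ⟨S, hS⟩ := (hlim.eventually (ge_mem_nhds hε)).exists_forall_of_atTop
  refine ⟨max S (1 / (500 * t.re)) + |κ0| * |(t⁻¹).im|, fun u v hu hv => ?_⟩
  obtain ⟨κ, hκ, e⟩ := strip_pt ht κ0 u v hv
  have hκa : |κ| ≤ |κ0| := by
    have := Set.abs_sub_left_of_mem_uIcc hκ
    simpa using this
  rw [e]
  set u' := u + κ * (t⁻¹).im
  have hu' : max S (1 / (500 * t.re)) ≤ |u'| := by
    have h1 : |u| ≤ |u'| + |κ * (t⁻¹).im| := by
      have := abs_sub u' (κ * (t⁻¹).im)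
      have e : u = u' - κ * (t⁻¹).im := by simp [u']
      rw [e]; exact this
    have h2 : |κ * (t⁻¹).im| ≤ |κ0| * |(t⁻¹).im| := by rw [abs_mul]; gcongr
    linarith
  refine (Hk_line_le ht α ζ κ u' (den_far t _ _ ?_)).trans ?_
  · rw [abs_mul, abs_of_pos hx]
    have h3 := (le_max_right _ _).trans hu'
    rw [div_le_iff₀ (by positivity)] at h3
    linarith
  · refine le_trans ?_ (hS |u'| ((le_max_left _ _).trans hu'))
    rw [sq_abs]
    gcongr
    refine mul_le_mul_of_nonneg_right ?_ hr.le
    have h4 : κ ^ 2 ≤ |κ0| ^ 2 := by rw [← sq_abs κ]; gcongr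
    have h5 : ζ * κ ≤ |ζ| * |κ0| := (le_abs_self _).trans (by rw [abs_mul]; gcongr)
    nlinarith [Real.pi_pos]

theorem Hk_cont (t : ℂ) (α ζ : ℝ) (a : ℂ) (h : ∀ u : ℝ, Dk t α (u + a) ≠ 0) :
    Continuous (fun u : ℝ => Hk t α ζ (u + a)) := by
  unfold Hk
  refine Continuous.div ?_ ?_ h
  · unfold Nk; fun_prop
  · unfold Dk; fun_prop

theorem Hk_integrable {t : ℂ} (ht : Sect t) (α ζ κ : ℝ)
    (hb : 0.3 ≤ ‖1 - Complex.exp ((α - 2 * κ : ℝ) * Complex.I)‖) :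
    MeasureTheory.Integrable (fun u : ℝ => Hk t α ζ (u + κ * Complex.I / t)) ∧
    ‖∫ u : ℝ, Hk t α ζ (u + κ * Complex.I / t)‖ ≤ 300 * Real.exp (t.re / 4
      + (2 * κ ^ 2 + 2 * Real.pi * ζ * κ) * (t⁻¹).re) * Real.sqrt (Real.pi / t.re) := by
  have hg := (integrable_exp_neg_mul_sq ht.1).const_mul (300 * Real.exp (t.re / 4
      + (2 * κ ^ 2 + 2 * Real.pi * ζ * κ) * (t⁻¹).re))
  have hle := fun u : ℝ => Hk_line_le ht α ζ κ u (den_ge ht _ u hb)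
  refine ⟨hg.mono' (Hk_cont _ _ _ _ (fun u => ?_)).aestronglyMeasurable (Eventually.of_forall hle), ?_⟩
  · rw [Dk_line ht.ne, ← norm_ne_zero_iff]
    have := den_ge ht _ u hb
    intro h0; rw [h0] at this; norm_num at this
  · refine (MeasureTheory.norm_integral_le_of_norm_le hg (Eventually.of_forall hle)).trans (le_of_eq ?_)
    rw [MeasureTheory.integral_const_mul, integral_gaussian]

theorem Dk_open (t : ℂ) (α : ℝ) : IsOpen {w | Dk t α w ≠ 0} := by
  refine isOpen_ne_fun ?_ continuous_const
  unfold Dk; fun_prop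

theorem Hk_diff (t : ℂ) (α ζ : ℝ) : DifferentiableOn ℂ (Hk t α ζ) {w | Dk t α w ≠ 0} := by
  unfold Hk
  refine DifferentiableOn.div ?_ ?_ (fun w hw => hw)
  · unfold Nk; fun_prop
  · unfold Dk; fun_prop

theorem Hk_shift {t : ℂ} (ht : Sect t) (α ζ κ0 : ℝ)
    (hb : ∀ κ ∈ Set.uIcc 0 κ0, 0.3 ≤ ‖1 - Complex.exp ((α - 2 * κ : ℝ) * Complex.I)‖) :
    ‖∫ u : ℝ, Hk t α ζ u‖ ≤ 300 * Real.exp (t.re / 4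
      + (2 * κ0 ^ 2 + 2 * Real.pi * ζ * κ0) * (t⁻¹).re) * Real.sqrt (Real.pi / t.re) := by
  have h0 := Hk_integrable ht α ζ 0 (hb 0 Set.left_mem_uIcc)
  have h1 := Hk_integrable ht α ζ κ0 (hb κ0 Set.right_mem_uIcc)
  have := line_shift (Hk t α ζ) _ (Hk_diff t α ζ) (κ0 * Complex.I / t) ?_ (Hk_decay ht α ζ κ0)
    (by simpa using h0.1) h1.1
  · rw [this]; exact h1.2
  · intro u v hv
    obtain ⟨κ, hκ, e⟩ := strip_pt ht κ0 u v hv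
    rw [e, Set.mem_ofPred_eq, Dk_line ht.ne, ← norm_ne_zero_iff]
    have := den_ge ht _ (u + κ * (t⁻¹).im) (hb κ hκ)
    intro h0; rw [h0] at this; norm_num at this

theorem Hk_mul_exp (t : ℂ) (α ζ ξ : ℝ) (w : ℂ) :
    Complex.exp (-2 * Real.pi * Complex.I * ξ * w) * Hk t α ζ w = Hk t α (ζ + ξ) w := by
  unfold Hk Nk
  rw [← mul_div_assoc, ← Complex.exp_add]
  congr 2; push_cast; ring

theorem Hk_isBigO {t : ℂ} (ht : Sect t) (α ζ : ℝ) (hb : 0.3 ≤ ‖1 - Complex.exp (α * Complex.I)‖) :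
    (fun u : ℝ => Hk t α ζ u) =O[cocompact ℝ] (fun u : ℝ => |u| ^ (-2 : ℝ)) := by
  have h1 := (cexp_neg_quadratic_isLittleO_abs_rpow_cocompact (a := (-t.re : ℂ))
    (by simpa using ht.1) 0 (-2)).isBigO
  refine Asymptotics.IsBigO.trans ?_ h1
  refine Asymptotics.IsBigO.of_bound (300 * Real.exp (t.re / 4)) (Eventually.of_forall fun u => ?_)
  have h2 := Hk_line_le ht α ζ 0 u (den_ge ht _ u (by simpa using hb))
  simp only [Complex.ofReal_zero, zero_mul, zero_div, add_zero] at h2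
  refine h2.trans (le_of_eq ?_)
  rw [Complex.norm_exp]
  congr 2
  · simp
  · rw [← Complex.ofReal_neg, Complex.add_re, Complex.re_ofReal_mul, ← Complex.ofReal_pow, Complex.ofReal_re]; simp

theorem poisson_Hk {t : ℂ} (ht : Sect t) (α ξ : ℝ) (hb : 0.3 ≤ ‖1 - Complex.exp (α * Complex.I)‖)
    (hs : Summable (fun k : ℤ => ∫ u : ℝ, Hk t α (k - ξ) u)) :
    ∑' n : ℤ, Complex.exp (2 * Real.pi * Complex.I * ξ * n) * Hk t α 0 n
      = ∑' k : ℤ, ∫ u : ℝ, Hk t α (k - ξ) u := by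
  have hF : ∀ k : ℤ, FourierTransform.fourier (fun u : ℝ => Hk t α (-ξ) u) k = ∫ u : ℝ, Hk t α (k - ξ) u := by
    intro k
    rw [Real.fourier_real_eq_integral_exp_smul]
    congr 1; ext u
    rw [smul_eq_mul, show (k - ξ : ℝ) = -ξ + k by ring, ← Hk_mul_exp]
    congr 2; push_cast; ring
  have hc : Continuous (fun u : ℝ => Hk t α (-ξ) u) := by
    have := Hk_cont t α (-ξ) 0 (fun u => ?_)
    · simpa using this
    · have h1 := Dk_line ht.ne α 0 u
      simp only [Complex.ofReal_zero, zero_mul, zero_div, mul_zero, sub_zero] at h1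
      rw [h1, ← norm_ne_zero_iff]
      have := den_ge ht _ u hb
      intro h0; rw [h0] at this; norm_num at this
  have h := Real.tsum_eq_tsum_fourier_of_rpow_decay_of_summable hc one_lt_two
    (Hk_isBigO ht α (-ξ) hb) (by simpa only [hF] using hs) 0
  simp only [hF] at h
  simp only [zero_add, QuotientAddGroup.mk_zero, fourier_eval_zero, mul_one] at h
  rw [← h]
  congr 1; ext n
  rw [show -ξ = 0 + -ξ by ring, ← Hk_mul_exp]
  congr 2; push_cast; ring_nf

theorem beta_ok {β : ℝ} (h1 : Real.pi / 8 ≤ β) (h2 : β ≤ 15 * Real.pi / 8) :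
    0.3 ≤ ‖1 - Complex.exp (β * Complex.I)‖ := by
  have hp := Real.pi_pos
  have h3 : Real.cos β ≤ Real.cos (Real.pi / 8) := by
    rcases le_total β Real.pi with h | h
    · exact Real.cos_le_cos_of_nonneg_of_le_pi (by positivity) h h1
    · rw [← Real.cos_two_pi_sub]
      exact Real.cos_le_cos_of_nonneg_of_le_pi (by positivity) (by linarith) (by linarith)
  have h4 : Real.cos (Real.pi / 8) ≤ 0.95 := by
    rw [Real.cos_pi_div_eight]
    have h5 : Real.sqrt 2 ≤ 1.5 := Real.sqrt_le_iff.2 (by norm_num)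
    have h6 : Real.sqrt (2 + Real.sqrt 2) ≤ 1.9 := Real.sqrt_le_iff.2 (by constructor <;> linarith)
    linarith
  have h7 : ‖1 - Complex.exp (β * Complex.I)‖ ^ 2 = 2 - 2 * Real.cos β := by
    rw [← Complex.normSq_eq_norm_sq, Complex.normSq_apply]
    simp [Complex.exp_ofReal_mul_I_re, Complex.exp_ofReal_mul_I_im]
    nlinarith [Real.sin_sq_add_cos_sq β]
  by_contra h
  push Not at h
  have := norm_nonneg (1 - Complex.exp (β * Complex.I))
  nlinarith

noncomputable def K1 : ℝ := ∑' k : ℤ, Real.exp (-|(k : ℝ)|)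

theorem K1_summable : Summable (fun k : ℤ => Real.exp (-|(k : ℝ)|)) := by
  have hg := Real.summable_exp_neg_nat
  refine Summable.of_nat_of_neg ?_ ?_ <;> simpa using hg

theorem K1_hasSum : HasSum (fun k : ℤ => Real.exp (-|(k : ℝ)|)) K1 := K1_summable.hasSum

theorem const_bd {x : ℝ} (hx : 0 < x) (hx1 : x ≤ 1 / 1000) (c E : ℝ) (hc : c ≤ 1) :
    300 * Real.exp (x / 4 + (c + E)) * Real.sqrt (Real.pi / x) ≤ 2400 * Real.sqrt (1 / x) * Real.exp E := by
  have h1 : Real.sqrt (Real.pi / x) ≤ 2 * Real.sqrt (1 / x) := by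
    rw [div_eq_mul_one_div, Real.sqrt_mul Real.pi_pos.le]
    gcongr
    exact Real.sqrt_le_iff.2 ⟨by norm_num, by linarith [Real.pi_lt_d2]⟩
  have h2 : Real.exp (x / 4 + (c + E)) ≤ 4 * Real.exp E := by
    rw [← add_assoc, Real.exp_add]
    gcongr
    refine (Real.exp_le_exp.2 (show x / 4 + c ≤ 1 + 1 / 1000 by linarith)).trans ?_
    rw [Real.exp_add]
    have h3 := Real.exp_one_lt_d9
    have h4 := Real.exp_bound_div_one_sub_of_interval (x := 1 / 1000) (by norm_num) (by norm_num)
    norm_num at h4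
    have := Real.exp_pos (1 / 1000)
    nlinarith
  calc _ ≤ 300 * (4 * Real.exp E) * (2 * Real.sqrt (1 / x)) := by gcongr
    _ = _ := by ring

theorem Sect.r_two {t : ℂ} (h : Sect t) (hx1 : t.re ≤ 1 / 1000) : 2 ≤ (t⁻¹).re := by
  refine le_trans ?_ h.r_ge
  have := h.1
  rw [le_div_iff₀ (by positivity)]; linarith

theorem sumI_term {t : ℂ} (ht : Sect t) (hx1 : t.re ≤ 1 / 1000) {α ξ : ℝ}
    (hα : α = Real.pi / 4 ∨ α = 5 * Real.pi / 4) (hξ : |ξ| = 1 / 4) (k : ℤ) :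
    ‖∫ u : ℝ, Hk t α (k - ξ) u‖ ≤ 2400 * Real.sqrt (1 / t.re)
      * Real.exp (-(3 * Real.pi ^ 2 / 128) * (t⁻¹).re) * Real.exp (-|(k : ℝ)|) := by
  have hp := Real.pi_pos
  have hp3 := Real.pi_gt_three
  have hr := ht.r_two hx1
  have hz1 : |(k : ℝ)| - 1 / 4 ≤ |(k - ξ : ℝ)| := by
    rw [← hξ]; exact abs_sub_abs_le_abs_sub _ _
  have hz2 : 1 / 4 ≤ |(k - ξ : ℝ)| := by
    rcases eq_or_ne k 0 with rfl | hk
    · simp [hξ]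
    · have : (1 : ℝ) ≤ |(k : ℝ)| := by exact_mod_cast Int.one_le_abs hk
      linarith
  have key : ∀ κ0 : ℝ, |κ0| = Real.pi / 16 → (k - ξ) * κ0 = - (|(k - ξ : ℝ)| * (Real.pi / 16)) →
      ‖∫ u : ℝ, Hk t α (k - ξ) u‖ ≤ 2400 * Real.sqrt (1 / t.re)
      * Real.exp (-(3 * Real.pi ^ 2 / 128) * (t⁻¹).re) * Real.exp (-|(k : ℝ)|) := by
    intro κ0 hκ0 hsg
    refine (Hk_shift ht α (k - ξ) κ0 ?_).trans ?_
    · intro κ hκ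
      have hκa : |κ| ≤ Real.pi / 16 := by
        have := Set.abs_sub_left_of_mem_uIcc hκ
        rw [← hκ0]; simpa using this
      obtain ⟨h1, h2⟩ := abs_le.1 hκa
      rcases hα with rfl | rfl <;> apply beta_ok <;> linarith
    · have e : (2 * κ0 ^ 2 + 2 * Real.pi * (k - ξ) * κ0) = Real.pi ^ 2 / 128 - Real.pi ^ 2 / 8 * |(k - ξ : ℝ)| := by
        rw [← sq_abs κ0, hκ0]; linear_combination 2 * Real.pi * hsg
      rw [e, mul_assoc _ (Real.exp _) (Real.exp _), ← Real.exp_add]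
      refine le_trans ?_ (const_bd ht.1 hx1 (1 / 2) _ (by norm_num))
      gcongr
      have h9 : 0 ≤ (|(k - ξ : ℝ)| - 1 / 4) * (Real.pi ^ 2 / 8 * (t⁻¹).re - 1) :=
        mul_nonneg (by linarith) (by nlinarith)
      nlinarith
  rcases le_total 0 (k - ξ : ℝ) with h | h
  · refine key (-(Real.pi / 16)) (by rw [abs_neg, abs_of_pos (by positivity)]) ?_
    rw [abs_of_nonneg h]; ring
  · refine key (Real.pi / 16) (by rw [abs_of_pos (by positivity)]) ?_
    rw [abs_of_nonpos h]; ring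

theorem sumI_bound {t : ℂ} (ht : Sect t) (hx1 : t.re ≤ 1 / 1000) {α ξ : ℝ}
    (hα : α = Real.pi / 4 ∨ α = 5 * Real.pi / 4) (hξ : |ξ| = 1 / 4) :
    ‖∑' n : ℤ, Complex.exp (2 * Real.pi * Complex.I * ξ * n) * Hk t α 0 n‖
      ≤ 2400 * Real.sqrt (1 / t.re) * Real.exp (-(3 * Real.pi ^ 2 / 128) * (t⁻¹).re) * K1 := by
  have hp := Real.pi_pos
  have hsum := K1_hasSum.mul_left (2400 * Real.sqrt (1 / t.re) * Real.exp (-(3 * Real.pi ^ 2 / 128) * (t⁻¹).re))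
  have hs := Summable.of_norm_bounded hsum.summable (sumI_term ht hx1 hα hξ)
  rw [poisson_Hk ht α ξ (by rcases hα with rfl | rfl <;> apply beta_ok <;> linarith) hs]
  exact tsum_of_norm_bounded hsum (sumI_term ht hx1 hα hξ)

noncomputable def mainS (t : ℂ) : ℂ :=
  Real.pi * Complex.I / t * Complex.exp (-(Real.pi * Complex.I / 8)) * Complex.exp (-(3 * Real.pi ^ 2 / 32) / t)

theorem beta_m : 0.3 ≤ ‖1 - Complex.exp ((Real.pi / 4 - 2 * (Real.pi / 4) : ℝ) * Complex.I)‖ := by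
  have h := beta_ok (β := 7 * Real.pi / 4) (by linarith [Real.pi_pos]) (by linarith [Real.pi_pos])
  have e : ((Real.pi / 4 - 2 * (Real.pi / 4) : ℝ) : ℂ) * Complex.I
    = ((7 * Real.pi / 4 : ℝ) : ℂ) * Complex.I - 2 * Real.pi * Complex.I := by push_cast; ring
  rw [e, Complex.exp_periodic.sub_eq]
  exact h

theorem Dk_zero_iff {t : ℂ} (ht : Sect t) {κ u : ℝ} (h0 : 0 ≤ κ) (h1 : κ ≤ Real.pi / 4)
    (h : Dk t (Real.pi / 4) (u + κ * Complex.I / t) = 0) : u = 0 ∧ κ = Real.pi / 8 := by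
  have hp := Real.pi_pos
  rw [Dk_line ht.ne, sub_eq_zero] at h
  have hn := norm_exp_beta t (Real.pi / 4 - 2 * κ) u
  rw [← h, norm_one] at hn
  have hu : u = 0 := by
    have := (Real.exp_eq_one_iff _).1 hn.symm
    have hx := ht.1.ne'
    simpa [hx] using this
  refine ⟨hu, ?_⟩
  rw [hu, Complex.ofReal_zero, mul_zero, sub_zero] at h
  have him := congrArg Complex.im h
  rw [Complex.exp_ofReal_mul_I_im, Complex.one_im] at him
  have := (Real.sin_eq_zero_iff_of_lt_of_lt (by linarith) (by linarith)).1 him.symm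
  linarith

theorem Hk_pole {t : ℂ} (ht : Sect t) :
    ∫ u : ℝ, Hk t (Real.pi / 4) (-1 / 2) u = (∫ u : ℝ, Hk t (Real.pi / 4) (-1 / 2)
      (u + (Real.pi / 4 : ℝ) * Complex.I / t)) + mainS t := by
  have hp := Real.pi_pos
  have ht0 := ht.ne
  set α := Real.pi / 4 with hα
  set a : ℂ := (α : ℝ) * Complex.I / t with ha
  have h0 := Hk_integrable ht α (-1 / 2) 0 (beta_ok (by linarith) (by linarith))
  have h1 := Hk_integrable ht α (-1 / 2) α beta_m
  set w0 := a / 2 with hw0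
  have hD0 : Dk t α w0 = 0 := by
    unfold Dk
    rw [sub_eq_zero, eq_comm, Complex.exp_eq_one_iff]
    refine ⟨0, ?_⟩
    rw [hw0, ha]; field_simp; simp
  have hDd : Differentiable ℂ (Dk t α) := by unfold Dk; fun_prop
  have hder : deriv (Dk t α) w0 = 2 * t := by
    have e : Complex.exp (α * Complex.I - 2 * t * w0) = 1 := by
      unfold Dk at hD0; exact (sub_eq_zero.1 hD0).symm
    have : HasDerivAt (Dk t α) (-(Complex.exp (α * Complex.I - 2 * t * w0) * (-(2 * t)))) w0 := by
      unfold Dk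
      have h2 : HasDerivAt (fun w : ℂ => α * Complex.I - 2 * t * w) (-(2 * t)) w0 := by
        simpa using ((hasDerivAt_id w0).const_mul (2 * t)).const_sub (α * Complex.I)
      exact h2.cexp.const_sub 1
    rw [this.deriv, e]; ring
  set d := dslope (Dk t α) w0 with hd
  have hdd : Differentiable ℂ d := by
    rw [← differentiableOn_univ]
    exact (Complex.differentiableOn_dslope univ_mem).2 hDd.differentiableOn
  have hd0 : d w0 = 2 * t := by rw [hd, dslope_same, hder]
  have hdne : ∀ w, w ≠ w0 → Dk t α w = (w - w0) * d w := by
    intro w hw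
    have := sub_smul_dslope (Dk t α) w0 w
    rw [hD0, sub_zero, smul_eq_mul] at this
    exact this.symm
  set p : ℂ → ℂ := fun w => Nk t (-1 / 2) w / d w with hpdef
  have hpd : DifferentiableOn ℂ p {w | d w ≠ 0} := by
    refine DifferentiableOn.div ?_ hdd.differentiableOn (fun w hw => hw)
    unfold Nk; fun_prop
  have hmem : ∀ u v : ℝ, v ∈ Set.uIcc 0 a.im → (u + v * Complex.I : ℂ) ∈ {w | d w ≠ 0} := by
    intro u v hv
    obtain ⟨κ, hκ, e⟩ := strip_pt ht α u v hv
    rw [Set.uIcc_of_le (by positivity)] at hκ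
    rw [Set.mem_ofPred_eq]
    by_cases hw : (u + v * Complex.I : ℂ) = w0
    · rw [hw, hd0]; simpa using ht0
    · intro hdz
      have h3 := hdne _ hw
      rw [hdz, mul_zero, e] at h3
      obtain ⟨h4, h5⟩ := Dk_zero_iff ht hκ.1 hκ.2 h3
      apply hw
      rw [e, h4, h5, hw0, ha, hα]
      push_cast; field_simp; ring
  have hmain := line_shift_pole (Hk t α (-1 / 2)) p {w | d w ≠ 0} (isOpen_ne_fun hdd.continuous continuous_const)
    hpd a (by rw [ha, im_line]; have := ht.r_pos; positivity) (fun w hw => by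
      rw [hpdef]; unfold Hk; rw [hdne w hw]
      rw [div_div, mul_comm]) hmem (Hk_decay ht α (-1 / 2) α) (by simpa using h0.1) h1.1
  rw [hmain]
  congr 1
  simp only [hpdef]
  rw [← hw0, hd0]
  unfold Nk mainS
  rw [mul_assoc _ (Complex.exp _) (Complex.exp _), ← Complex.exp_add]
  have e : (-2 * Real.pi * Complex.I * ((-1 / 2 : ℝ) : ℂ) * w0 - t * (2 * w0 ^ 2 + w0))
    = (-(Real.pi * Complex.I / 8) + -(3 * Real.pi ^ 2 / 32) / t : ℂ) := by
    rw [hw0, ha, hα]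
    push_cast
    field_simp
    linear_combination (768 * Real.pi : ℂ) * Complex.I_sq
  rw [e]
  field_simp

theorem sum1_term {t : ℂ} (ht : Sect t) (hx1 : t.re ≤ 1 / 1000) (k : ℤ) :
    ‖(∫ u : ℝ, Hk t (Real.pi / 4) (k - (1 / 2 : ℝ)) u) - (if k = 0 then mainS t else 0)‖
      ≤ 2400 * Real.sqrt (1 / t.re)
      * Real.exp (-(Real.pi ^ 2 / 8) * (t⁻¹).re) * Real.exp (-|(k : ℝ)|) := by
  have hp := Real.pi_pos
  have hp3 := Real.pi_gt_three
  have hr := ht.r_two hx1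
  rw [mul_assoc _ (Real.exp _) (Real.exp _), ← Real.exp_add]
  refine le_trans ?_ (const_bd ht.1 hx1 1 _ le_rfl)
  rcases lt_trichotomy k 0 with hk | rfl | hk
  · rw [if_neg hk.ne, sub_zero]
    have hk' : (k : ℝ) ≤ -1 := by exact_mod_cast (by omega : k ≤ -1)
    refine (Hk_shift ht _ (k - (1 / 2 : ℝ)) (Real.pi / 16) ?_).trans ?_
    · intro κ hκ
      rw [Set.uIcc_of_le (by positivity)] at hκ
      apply beta_ok <;> linarith [hκ.1, hκ.2]
    · gcongr
      rw [abs_of_neg (by linarith)]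
      have e : (2 * (Real.pi / 16) ^ 2 + 2 * Real.pi * (k - (1 / 2 : ℝ)) * (Real.pi / 16)) * (t⁻¹).re
        = -(Real.pi ^ 2 / 8) * (t⁻¹).re - (-1 - k) * (Real.pi ^ 2 / 8 * (t⁻¹).re) - 7 * Real.pi ^ 2 / 128 * (t⁻¹).re := by ring
      rw [e]
      have h9 : 0 ≤ (-1 - (k : ℝ)) * (Real.pi ^ 2 / 8 * (t⁻¹).re - 1) :=
        mul_nonneg (by linarith) (by nlinarith)
      have h10 : 0 ≤ 7 * Real.pi ^ 2 / 128 * (t⁻¹).re := by positivity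
      linarith
  · rw [if_pos rfl]
    have e : ((0 : ℤ) : ℝ) - (1 / 2 : ℝ) = -1 / 2 := by norm_num
    rw [e, Hk_pole ht, add_sub_cancel_right]
    refine (Hk_integrable ht (Real.pi / 4) (-1 / 2) (Real.pi / 4) beta_m).2.trans ?_
    gcongr
    have : (2 * (Real.pi / 4) ^ 2 + 2 * Real.pi * (-1 / 2) * (Real.pi / 4)) = -(Real.pi ^ 2 / 8) := by ring
    rw [this]; simp
  · rw [if_neg hk.ne', sub_zero]
    have hk' : 1 ≤ (k : ℝ) := by exact_mod_cast (by omega : 1 ≤ k)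
    refine (Hk_shift ht _ (k - (1 / 2 : ℝ)) (-(Real.pi / 4)) ?_).trans ?_
    · intro κ hκ
      rw [Set.uIcc_of_ge (by linarith)] at hκ
      apply beta_ok <;> linarith [hκ.1, hκ.2]
    · gcongr
      rw [abs_of_pos (by linarith)]
      have e : (2 * (-(Real.pi / 4)) ^ 2 + 2 * Real.pi * (k - (1 / 2 : ℝ)) * (-(Real.pi / 4))) * (t⁻¹).re
        = -(Real.pi ^ 2 / 8) * (t⁻¹).re - (k - 1) * (Real.pi ^ 2 / 2 * (t⁻¹).re) := by ring
      rw [e]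
      have h9 : 0 ≤ ((k : ℝ) - 1) * (Real.pi ^ 2 / 2 * (t⁻¹).re - 1) :=
        mul_nonneg (by linarith) (by nlinarith)
      linarith

theorem sum1_bound {t : ℂ} (ht : Sect t) (hx1 : t.re ≤ 1 / 1000) :
    ‖(∑' n : ℤ, Complex.exp (2 * Real.pi * Complex.I * (1 / 2 : ℝ) * n) * Hk t (Real.pi / 4) 0 n) - mainS t‖
      ≤ 2400 * Real.sqrt (1 / t.re) * Real.exp (-(Real.pi ^ 2 / 8) * (t⁻¹).re) * K1 := by
  have hp := Real.pi_pos
  have hsum := K1_hasSum.mul_left (2400 * Real.sqrt (1 / t.re) * Real.exp (-(Real.pi ^ 2 / 8) * (t⁻¹).re))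
  have hs := Summable.of_norm_bounded hsum.summable (sum1_term ht hx1)
  have hi := hasSum_ite_eq (0 : ℤ) (mainS t)
  have hs2 := hs.add hi.summable
  simp only [sub_add_cancel] at hs2
  rw [poisson_Hk ht _ _ (beta_ok (by linarith) (by linarith)) hs2]
  rw [← hi.tsum_eq, ← hs2.tsum_sub hi.summable]
  exact tsum_of_norm_bounded hsum (sum1_term ht hx1)

theorem Hk_zpow (t : ℂ) (α : ℝ) (n : ℤ) : Hk t α 0 n =
    Complex.exp (-t) ^ (2 * n ^ 2 + n) / (1 - Complex.exp (α * Complex.I) * Complex.exp (-t) ^ (2 * n)) := by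
  unfold Hk Nk Dk
  rw [← Complex.exp_int_mul, ← Complex.exp_int_mul, ← Complex.exp_add]
  congr 2
  · push_cast; ring
  · congr 2; push_cast; ring

theorem Hk_summable {t : ℂ} (ht : Sect t) (α ξ : ℝ) (hb : 0.3 ≤ ‖1 - Complex.exp (α * Complex.I)‖) :
    Summable (fun n : ℤ => Complex.exp (2 * Real.pi * Complex.I * ξ * n) * Hk t α 0 n) := by
  have h := summable_of_isBigO (Real.summable_abs_int_rpow one_lt_two)
    ((Hk_isBigO ht α (-ξ) hb).comp_tendsto Int.tendsto_coe_cofinite)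
  refine h.congr (fun n => ?_)
  simp only [Function.comp]
  rw [show -ξ = 0 + -ξ by ring, ← Hk_mul_exp]
  push_cast
  congr 2; ring

theorem Sq_near_one (t : ℂ) : Sq z8 (Complex.exp (-t)) =
    ∑' n : ℤ, Complex.exp (2 * Real.pi * Complex.I * (1 / 2 : ℝ) * n) * Hk t (Real.pi / 4) 0 n := by
  unfold Sq
  congr 1; ext n
  have : Complex.exp (2 * Real.pi * Complex.I * (1 / 2 : ℝ) * n) = (-1) ^ n := by
    rw [← Complex.exp_pi_mul_I, ← Complex.exp_int_mul]; congr 1; push_cast; ring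
  rw [this, Hk_zpow, ← z8_eq, ← mul_div_assoc]
  rfl

theorem split_alg {c e z : ℂ} (hc : c ^ 2 = -1) (n : ℤ) :
    (-1) ^ n * (c * e) ^ (2 * n ^ 2 + n) / (1 - z * (c * e) ^ (2 * n))
     = 1 / 2 * (c ^ n * (e ^ (2 * n ^ 2 + n) / (1 - z * e ^ (2 * n)))) +
       1 / 2 * ((-c) ^ n * (e ^ (2 * n ^ 2 + n) / (1 - z * e ^ (2 * n)))) +
       1 / 2 * (c ^ n * (e ^ (2 * n ^ 2 + n) / (1 - -z * e ^ (2 * n)))) -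
       1 / 2 * ((-c) ^ n * (e ^ (2 * n ^ 2 + n) / (1 - -z * e ^ (2 * n)))) := by
  have hc0 : c ≠ 0 := by rintro rfl; norm_num at hc
  have h2 : c ^ (2 * n) = (-1) ^ n := by rw [zpow_mul]; congr 1
  have h3 : c ^ (2 * n ^ 2 + n) = (-1) ^ (n ^ 2) * c ^ n := by
    rw [zpow_add₀ hc0, zpow_mul]; congr 2
  rw [mul_zpow, mul_zpow, h2, h3]
  rcases Int.even_or_odd n with h | h
  · rw [h.neg_one_zpow, h.neg_zpow, (h.pow_of_ne_zero two_ne_zero).neg_one_zpow]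
    ring
  · rw [h.neg_one_zpow, h.neg_zpow, h.pow.neg_one_zpow]
    ring

theorem S_near_i {t : ℂ} (ht : Sect t) (hx1 : t.re ≤ 1 / 1000) {σ : ℝ} (hσ : |σ| = 1) :
    ‖Sq z8 (Complex.exp (-(σ * (Real.pi / 2) * Complex.I)) * Complex.exp (-t))‖
      ≤ 4800 * K1 * Real.sqrt (1 / t.re) * Real.exp (-(3 * Real.pi ^ 2 / 128) * (t⁻¹).re) := by
  have hp := Real.pi_pos
  set c := Complex.exp (-(σ * (Real.pi / 2) * Complex.I)) with hcdef
  have hc : c ^ 2 = -1 := by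
    rw [hcdef, ← Complex.exp_nat_mul]
    rcases eq_or_eq_neg_of_abs_eq hσ with rfl | rfl
    · rw [← Complex.exp_neg_pi_mul_I]; congr 1; push_cast; ring
    · rw [← Complex.exp_pi_mul_I]; congr 1; push_cast; ring
  have hcn : ∀ n : ℤ, c ^ n = Complex.exp (2 * Real.pi * Complex.I * (-σ / 4 : ℝ) * n) := by
    intro n
    rw [hcdef, ← Complex.exp_int_mul]; congr 1; push_cast; ring
  have hcn' : ∀ n : ℤ, (-c) ^ n = Complex.exp (2 * Real.pi * Complex.I * (σ / 4 : ℝ) * n) := by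
    intro n
    have hc0 : c ≠ 0 := Complex.exp_ne_zero _
    have : -c = c⁻¹ := by
      exact eq_inv_of_mul_eq_one_left (by linear_combination -hc)
    rw [this, hcdef, ← Complex.exp_neg, ← Complex.exp_int_mul]; congr 1; push_cast; ring
  have hz : -z8 = Complex.exp ((5 * Real.pi / 4 : ℝ) * Complex.I) := by
    have : ((5 * Real.pi / 4 : ℝ) : ℂ) * Complex.I = (Real.pi / 4 : ℝ) * Complex.I + Real.pi * Complex.I := by
      push_cast; ring
    rw [this, Complex.exp_add, Complex.exp_pi_mul_I, ← z8_eq]; ring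
  have b1 : 0.3 ≤ ‖1 - Complex.exp ((Real.pi / 4 : ℝ) * Complex.I)‖ := by apply beta_ok <;> linarith
  have b2 : 0.3 ≤ ‖1 - Complex.exp ((5 * Real.pi / 4 : ℝ) * Complex.I)‖ := by apply beta_ok <;> linarith
  have e : Sq z8 (c * Complex.exp (-t)) =
      1 / 2 * (∑' n : ℤ, Complex.exp (2 * Real.pi * Complex.I * (-σ / 4 : ℝ) * n) * Hk t (Real.pi / 4) 0 n) +
      1 / 2 * (∑' n : ℤ, Complex.exp (2 * Real.pi * Complex.I * (σ / 4 : ℝ) * n) * Hk t (Real.pi / 4) 0 n) +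
      1 / 2 * (∑' n : ℤ, Complex.exp (2 * Real.pi * Complex.I * (-σ / 4 : ℝ) * n) * Hk t (5 * Real.pi / 4) 0 n) -
      1 / 2 * (∑' n : ℤ, Complex.exp (2 * Real.pi * Complex.I * (σ / 4 : ℝ) * n) * Hk t (5 * Real.pi / 4) 0 n) := by
    have hs := (((((Hk_summable ht _ (-σ / 4) b1).hasSum.mul_left (1 / 2)).add
      ((Hk_summable ht _ (σ / 4) b1).hasSum.mul_left (1 / 2))).add
      ((Hk_summable ht _ (-σ / 4) b2).hasSum.mul_left (1 / 2))).sub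
      ((Hk_summable ht _ (σ / 4) b2).hasSum.mul_left (1 / 2)))
    rw [← hs.tsum_eq]
    unfold Sq
    congr 1; ext n
    rw [← hcn, ← hcn', Hk_zpow, Hk_zpow, ← z8_eq, ← hz]
    exact split_alg hc n
  have n1 : |-σ / 4| = 1 / 4 := by rw [abs_div, abs_neg, hσ]; norm_num
  have n2 : |σ / 4| = 1 / 4 := by rw [abs_div, hσ]; norm_num
  have s1 := sumI_bound ht hx1 (α := Real.pi / 4) (Or.inl rfl) n1
  have s2 := sumI_bound ht hx1 (α := Real.pi / 4) (Or.inl rfl) n2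
  have s3 := sumI_bound ht hx1 (α := 5 * Real.pi / 4) (Or.inr rfl) n1
  have s4 := sumI_bound ht hx1 (α := 5 * Real.pi / 4) (Or.inr rfl) n2
  rw [e]
  refine (norm_sub_le _ _).trans ?_
  refine (add_le_add_left ((norm_add_le _ _).trans (add_le_add_left (norm_add_le _ _) _)) _).trans ?_
  simp only [norm_mul, norm_div, norm_one, Complex.norm_two]
  linarith

theorem norm_F_near_i {x θ : ℝ} (hx : 0 < x) (hx1 : x ≤ 1 / 1000)
    (h3 : |(|θ| - Real.pi / 2)| ≤ 20 * x) :
    ‖Fq z8 (qe x θ)‖ ≤ 9600 * K1 * Real.sqrt (1 / x) * Real.exp (0.22 / x) := by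
  have hp := Real.pi_gt_d4
  obtain ⟨σ, hσ, hθ⟩ : ∃ σ : ℝ, |σ| = 1 ∧ θ = σ * |θ| := by
    rcases abs_choice θ with h | h
    · exact ⟨1, by simp, by rw [h]; ring⟩
    · exact ⟨-1, by simp, by rw [h]; ring⟩
  set y := |θ| - Real.pi / 2 with hy
  set t : ℂ := x + (σ * y : ℝ) * Complex.I with htdef
  have hre : t.re = x := by simp [htdef]
  have him : t.im = σ * y := by simp [htdef]
  have ht : Sect t := by
    constructor
    · rw [hre]; exact hx
    · rw [hre, him, abs_mul, hσ, one_mul]; exact h3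
  have hq : qe x θ = Complex.exp (-(σ * (Real.pi / 2) * Complex.I)) * Complex.exp (-t) := by
    unfold qe
    rw [← Complex.exp_add]; congr 1
    rw [htdef]
    have : θ = σ * (Real.pi / 2) + σ * y := by rw [hy]; linear_combination hθ
    have h' : (θ : ℂ) = σ * (Real.pi / 2) + ((σ * y : ℝ) : ℂ) := by rw [this]; push_cast; ring
    rw [h']; ring
  have hS := S_near_i ht (hre ▸ hx1) hσ
  rw [← hq, hre] at hS
  have hr : (t⁻¹).re = x / (x ^ 2 + y ^ 2) := by
    rw [Sect.r_eq, hre, him, mul_pow, ← sq_abs σ, hσ]; ring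
  have hP := (norm_Pq_le (qe_ne x θ) (qe_lt hx θ)).trans (Real.exp_le_exp.2 (near_i hx hx1 h3))
  rw [← hy, ← hr] at hP
  have hr1 := ht.r_le
  have hr0 := ht.r_pos
  rw [hre] at hr1
  have hK : 0 ≤ K1 := K1_hasSum.nonneg (fun k => by positivity)
  rw [Fq_eq z8_norm z8_ne_one (qe_ne x θ) (qe_lt hx θ), norm_mul, norm_mul]
  have h5 : ‖1 - z8‖ ≤ 2 := by
    refine (norm_sub_le _ _).trans ?_
    rw [z8_norm, norm_one]; norm_num
  calc _ ≤ 2 * (Real.exp (1 / 3.8 * (t⁻¹).re + 0.183 / x) * (4800 * K1 * Real.sqrt (1 / x) * Real.exp (-(3 * Real.pi ^ 2 / 128) * (t⁻¹).re))) := by gcongr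
    _ = 9600 * K1 * Real.sqrt (1 / x) * Real.exp (1 / 3.8 * (t⁻¹).re + 0.183 / x + -(3 * Real.pi ^ 2 / 128) * (t⁻¹).re) := by
      rw [Real.exp_add _ (-(3 * Real.pi ^ 2 / 128) * (t⁻¹).re)]; ring
    _ ≤ _ := by
      gcongr
      have h6 : (0.231 : ℝ) ≤ 3 * Real.pi ^ 2 / 128 := by nlinarith
      have h7 : 0.183 / x = 0.183 * (1 / x) := by ring
      have h8 : 0.22 / x = 0.22 * (1 / x) := by ring
      rw [h7, h8]
      norm_num at *
      nlinarith

noncomputable def TL (t : ℂ) : ℂ :=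
  (Real.sqrt 2 : ℝ) * (1 / ((2 * t / Real.pi) ^ (1 / 2 : ℂ))) * Complex.exp (t / 8 - Real.pi ^ 2 / (8 * t))

noncomputable def gT (t : ℂ) (n : ℤ) : ℂ :=
  Complex.exp (Real.pi * Complex.I * (n - 1 / 2) / 2) * Complex.exp (-(Real.pi ^ 2 / (2 * t)) * (n * (n - 1)))

theorem gT_norm (t : ℂ) (n : ℤ) :
    ‖gT t n‖ = Real.exp (-(Real.pi ^ 2 / 2 * (t⁻¹).re * (n * (n - 1)))) := by
  rw [gT, norm_mul, Complex.norm_exp, Complex.norm_exp]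
  have e1 : (Real.pi * Complex.I * ((n : ℂ) - 1 / 2) / 2).re = 0 := by
    have : (Real.pi * Complex.I * ((n : ℂ) - 1 / 2) / 2) = ((Real.pi * ((n : ℝ) - 1 / 2) / 2 : ℝ) : ℂ) * Complex.I := by
      push_cast; ring
    rw [this, Complex.re_ofReal_mul]; simp
  have e2 : (-((Real.pi : ℂ) ^ 2 / (2 * t)) * ((n : ℂ) * (n - 1))).re
      = -(Real.pi ^ 2 / 2 * (t⁻¹).re * (n * (n - 1))) := by
    have : (-((Real.pi : ℂ) ^ 2 / (2 * t)) * ((n : ℂ) * (n - 1)))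
      = ((-(Real.pi ^ 2 / 2 * ((n : ℝ) * (n - 1))) : ℝ) : ℂ) * t⁻¹ := by
      push_cast; field_simp
    rw [this, Complex.re_ofReal_mul]; ring
  rw [e1, e2, Real.exp_zero, one_mul]

theorem gT_bd {t : ℂ} (ht : Sect t) (hx1 : t.re ≤ 1 / 1000) (n : ℤ) (h : ¬ (n = 0 ∨ n = 1)) :
    ‖gT t n‖ ≤ Real.exp (-(t⁻¹).re) * Real.exp (-|(n : ℝ)|) := by
  rw [gT_norm, ← Real.exp_add]
  apply Real.exp_le_exp.2
  have hr := ht.r_two hx1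
  set r := (t⁻¹).re
  have hn : |(n : ℝ)| ≤ n * (n - 1) ∧ (2 : ℝ) ≤ n * (n - 1) := by
    have : |n| ≤ n * (n - 1) ∧ 2 ≤ n * (n - 1) := by
      have h' : n ≤ -1 ∨ 2 ≤ n := by omega
      rcases h' with h' | h'
      · rw [abs_of_nonpos (by omega)]; constructor <;> nlinarith
      · rw [abs_of_nonneg (by omega)]; constructor <;> nlinarith
    exact_mod_cast this
  obtain ⟨h1, h2⟩ := hn
  set N : ℝ := (n : ℝ) * (n - 1)
  have hp : 4 ≤ Real.pi ^ 2 / 2 := by nlinarith [Real.pi_gt_three]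
  have : 4 * (r * N) ≤ Real.pi ^ 2 / 2 * (r * N) := mul_le_mul_of_nonneg_right hp (by nlinarith)
  nlinarith

theorem gT_zero_one (t : ℂ) : gT t 0 + gT t 1 = (Real.sqrt 2 : ℝ) := by
  have h1 : gT t 0 = Complex.exp (-((Real.pi / 4 : ℝ) : ℂ) * Complex.I) := by
    simp only [gT, Int.cast_zero, zero_mul, mul_zero, Complex.exp_zero, mul_one]; congr 1; push_cast; ring
  have h2 : gT t 1 = Complex.exp (((Real.pi / 4 : ℝ) : ℂ) * Complex.I) := by
    simp only [gT, Int.cast_one, sub_self, mul_zero, Complex.exp_zero, mul_one]; congr 1; push_cast; ring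
  rw [h1, h2, add_comm]
  have := Complex.two_cos (((Real.pi / 4 : ℝ) : ℂ))
  rw [← this, ← Complex.ofReal_cos, Real.cos_pi_div_four]
  push_cast; ring

theorem gT_sum {t : ℂ} (ht : Sect t) (hx1 : t.re ≤ 1 / 1000) :
    ‖(∑' n : ℤ, gT t n) - (Real.sqrt 2 : ℝ)‖ ≤ 401 * K1 * t.re := by
  set h : ℤ → ℂ := fun n => if n = 0 ∨ n = 1 then 0 else gT t n with hh
  have hb : ∀ n, ‖h n‖ ≤ Real.exp (-(t⁻¹).re) * Real.exp (-|(n : ℝ)|) := by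
    intro n
    simp only [hh]
    split_ifs with hn
    · simp; positivity
    · exact gT_bd ht hx1 n hn
  have hS := K1_hasSum.mul_left (Real.exp (-(t⁻¹).re))
  have hs : Summable h := Summable.of_norm_bounded hS.summable hb
  have h0 : HasSum (fun n : ℤ => if n = 0 ∨ n = 1 then gT t n else 0) (gT t 0 + gT t 1) := by
    have := hasSum_sum_of_ne_finset_zero (L := .unconditional ℤ) (f := fun n : ℤ => if n = 0 ∨ n = 1 then gT t n else 0)
      (s := {0, 1}) (by intro b hb; simp at hb; simp [hb])
    simpa using this
  have h1 := h0.add hs.hasSum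
  have h2 : (∑' n : ℤ, gT t n) = gT t 0 + gT t 1 + ∑' n, h n := by
    rw [← h1.tsum_eq]
    apply tsum_congr; intro n
    simp only [hh]; split_ifs <;> simp
  rw [h2, gT_zero_one, add_sub_cancel_left]
  have h3 := tsum_of_norm_bounded hS hb
  have hr := ht.r_ge
  have hrp := ht.r_pos
  have hx := ht.1
  have hK : 0 ≤ K1 := K1_hasSum.nonneg (fun _ => (Real.exp_pos _).le)
  have h4 : Real.exp (-(t⁻¹).re) ≤ 401 * t.re := by
    rw [Real.exp_neg]
    have : (t⁻¹).re ≤ Real.exp (t⁻¹).re := by linarith [Real.add_one_le_exp (t⁻¹).re]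
    calc (Real.exp (t⁻¹).re)⁻¹ ≤ (1 / (401 * t.re))⁻¹ := inv_anti₀ (by positivity) (hr.trans this)
      _ = 401 * t.re := by rw [one_div, inv_inv]
  calc _ ≤ _ := h3
    _ ≤ 401 * t.re * K1 := mul_le_mul_of_nonneg_right h4 hK
    _ = _ := by ring

theorem theta_near_one {t : ℂ} (ht : Sect t) (hx1 : t.re ≤ 1 / 1000) :
    ∃ δ : ℂ, ‖δ‖ ≤ 401 * K1 * t.re ∧ Thq (Complex.exp (-t)) = TL t * (1 + δ) := by
  have hp : (Real.pi : ℂ) ≠ 0 := by exact_mod_cast Real.pi_ne_zero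
  have ht0 := ht.ne
  have hs2 : ((Real.sqrt 2 : ℝ) : ℂ) ≠ 0 := by
    have : Real.sqrt 2 ≠ 0 := by positivity
    exact_mod_cast this
  refine ⟨((∑' n : ℤ, gT t n) - (Real.sqrt 2 : ℝ)) / (Real.sqrt 2 : ℝ), ?_, ?_⟩
  · rw [norm_div]
    have h1 : 1 ≤ ‖((Real.sqrt 2 : ℝ) : ℂ)‖ := by
      rw [Complex.norm_real, Real.norm_eq_abs, abs_of_nonneg (Real.sqrt_nonneg _)]
      exact Real.one_le_sqrt.2 (by norm_num)
    exact (div_le_self (norm_nonneg _) h1).trans (gT_sum ht hx1)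
  · have hq1 : ‖Complex.exp (-t)‖ < 1 := by
      rw [Complex.norm_exp]; simpa using ht.1
    have hT := (Thq_hasSum (Complex.exp_ne_zero (-t)) hq1).tsum_eq
    have ha : 0 < (2 * t / Real.pi).re := by
      have : (2 * t / Real.pi) = ((2 / Real.pi : ℝ) : ℂ) * t := by push_cast; ring
      rw [this, Complex.re_ofReal_mul]
      have := ht.1
      have := Real.pi_pos
      positivity
    have hP := Complex.tsum_exp_neg_quadratic ha (Complex.I / 2 - t / (2 * Real.pi))
    have e1 : (∑' n : ℤ, Complex.exp (-Real.pi * (2 * t / Real.pi) * (n : ℂ) ^ 2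
        + 2 * Real.pi * (Complex.I / 2 - t / (2 * Real.pi)) * n)) = Thq (Complex.exp (-t)) := by
      rw [← hT]
      apply tsum_congr; intro n
      have : (-1 : ℂ) = Complex.exp (Real.pi * Complex.I) := Complex.exp_pi_mul_I.symm
      rw [this, ← Complex.exp_int_mul, ← Complex.exp_int_mul, ← Complex.exp_add]
      congr 1; push_cast; field_simp; ring
    have e2 : (∑' n : ℤ, Complex.exp (-Real.pi / (2 * t / Real.pi) * ((n : ℂ)
        + Complex.I * (Complex.I / 2 - t / (2 * Real.pi))) ^ 2))
        = Complex.exp (t / 8 - Real.pi ^ 2 / (8 * t)) * ∑' n : ℤ, gT t n := by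
      rw [← tsum_mul_left]
      apply tsum_congr; intro n
      rw [gT, ← Complex.exp_add, ← Complex.exp_add]
      congr 1
      have hI : Complex.I * (Complex.I / 2 - t / (2 * Real.pi)) = -1 / 2 - Complex.I * t / (2 * Real.pi) := by
        linear_combination (1 / 2 : ℂ) * Complex.I_mul_I
      rw [hI]
      field_simp
      ring_nf
      simp only [Complex.I_sq]
      ring
    rw [← e1, hP, e2, TL]
    field_simp
    ring

noncomputable def FL (t : ℂ) : ℂ := (1 - z8) * mainS t / TL t

theorem K1_nonneg : 0 ≤ K1 := K1_hasSum.nonneg (fun _ => (Real.exp_pos _).le)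

theorem mainS_norm (t : ℂ) :
    ‖mainS t‖ = Real.pi / ‖t‖ * Real.exp (-(3 * Real.pi ^ 2 / 32) * (t⁻¹).re) := by
  rw [mainS, norm_mul, norm_mul, Complex.norm_exp, Complex.norm_exp]
  have e1 : (-(Real.pi * Complex.I / 8)).re = 0 := by
    have : (-(Real.pi * Complex.I / 8)) = ((-(Real.pi / 8) : ℝ) : ℂ) * Complex.I := by push_cast; ring
    rw [this, Complex.re_ofReal_mul]; simp
  have e2 : (-(3 * (Real.pi : ℂ) ^ 2 / 32) / t).re = -(3 * Real.pi ^ 2 / 32) * (t⁻¹).re := by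
    have : (-(3 * (Real.pi : ℂ) ^ 2 / 32) / t) = ((-(3 * Real.pi ^ 2 / 32) : ℝ) : ℂ) * t⁻¹ := by
      push_cast; ring
    rw [this, Complex.re_ofReal_mul]
  rw [e1, e2, Real.exp_zero, mul_one, norm_div, norm_mul, Complex.norm_I, mul_one, Complex.norm_real,
    Real.norm_eq_abs, abs_of_pos Real.pi_pos]

theorem S_rel {t : ℂ} (ht : Sect t) (hx1 : t.re ≤ 1 / 1000) :
    ‖Sq z8 (Complex.exp (-t)) - mainS t‖ ≤ 16800 * K1 * Real.sqrt t.re * ‖mainS t‖ := by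
  have h := sum1_bound ht hx1
  rw [← Sq_near_one t] at h
  refine h.trans ?_
  rw [mainS_norm]
  have hx := ht.1
  have hr := ht.r_pos
  have hK := K1_nonneg
  have ht0 : 0 < ‖t‖ := norm_pos_iff.2 ht.ne
  have hs : Real.sqrt (1 / t.re) = Real.sqrt t.re / t.re := by
    rw [Real.sqrt_div' _ hx.le, Real.sqrt_one, Real.sqrt_div_self']
  rw [hs]
  have hE : Real.exp (-(Real.pi ^ 2 / 8) * (t⁻¹).re) ≤ Real.exp (-(3 * Real.pi ^ 2 / 32) * (t⁻¹).re) := by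
    apply Real.exp_le_exp.2
    have : 0 ≤ Real.pi ^ 2 * (t⁻¹).re := by positivity
    nlinarith
  have hb : 1 / t.re ≤ 7 * (Real.pi / ‖t‖) := by
    rw [← mul_div_assoc, div_le_div_iff₀ hx ht0]
    nlinarith [ht.norm_le, Real.pi_gt_three]
  calc 2400 * (Real.sqrt t.re / t.re) * Real.exp (-(Real.pi ^ 2 / 8) * (t⁻¹).re) * K1
      = (2400 * K1 * Real.sqrt t.re) * ((1 / t.re) * Real.exp (-(Real.pi ^ 2 / 8) * (t⁻¹).re)) := by ring
    _ ≤ (2400 * K1 * Real.sqrt t.re) * ((7 * (Real.pi / ‖t‖)) * Real.exp (-(3 * Real.pi ^ 2 / 32) * (t⁻¹).re)) := by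
        gcongr
    _ = _ := by ring

theorem F_near_one : ∃ C x0 : ℝ, 0 ≤ C ∧ 0 < x0 ∧ x0 ≤ 1 / 1000 ∧ ∀ t : ℂ, Sect t → t.re ≤ x0 →
    ‖Fq z8 (Complex.exp (-t)) - FL t‖ ≤ C * Real.sqrt t.re * ‖FL t‖ := by
  have hK := K1_nonneg
  refine ⟨2 * (16800 * K1 + 401 * K1), min (1 / 1000) (1 / (802 * (K1 + 1))), by positivity, by positivity,
    min_le_left _ _, ?_⟩
  intro t ht hx0
  have hx := ht.1
  have hx1 : t.re ≤ 1 / 1000 := hx0.trans (min_le_left _ _)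
  have hx2 : t.re ≤ 1 / (802 * (K1 + 1)) := hx0.trans (min_le_right _ _)
  obtain ⟨δ, hδ, hT⟩ := theta_near_one ht hx1
  have hS := S_rel ht hx1
  have hq1 : ‖Complex.exp (-t)‖ < 1 := by
    rw [Complex.norm_exp]; simpa using hx
  have hPT := Pq_mul_Thq (Complex.exp_ne_zero (-t)) hq1
  rw [Fq_eq z8_norm z8_ne_one (Complex.exp_ne_zero (-t)) hq1]
  have hδ2 : ‖δ‖ ≤ 1 / 2 := by
    refine hδ.trans ?_
    rw [le_div_iff₀ (by positivity)] at hx2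
    nlinarith
  have h1δ : 1 / 2 ≤ ‖1 + δ‖ := by
    have := norm_sub_norm_le (1 : ℂ) (-δ)
    rw [norm_one, norm_neg, sub_neg_eq_add] at this
    linarith
  have h10 : 1 + δ ≠ 0 := by
    intro h; rw [h, norm_zero] at h1δ; norm_num at h1δ
  rw [hT] at hPT
  have hT0 : TL t ≠ 0 := by
    intro h; rw [h] at hPT; simp at hPT
  have hP : Pq (Complex.exp (-t)) = 1 / (TL t * (1 + δ)) := by
    rw [eq_div_iff (mul_ne_zero hT0 h10)]; exact hPT
  set S := Sq z8 (Complex.exp (-t))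
  have e : (1 - z8) * (Pq (Complex.exp (-t)) * S) - FL t
      = ((1 - z8) / TL t) * (((S - mainS t) - δ * mainS t) / (1 + δ)) := by
    rw [hP, FL]; field_simp; ring
  rw [e, norm_mul, norm_div ((S - mainS t) - δ * mainS t)]
  have hsq : t.re ≤ Real.sqrt t.re := by
    apply Real.le_sqrt_of_sq_le; nlinarith
  have hnum : ‖(S - mainS t) - δ * mainS t‖ ≤ (16800 * K1 + 401 * K1) * Real.sqrt t.re * ‖mainS t‖ := by
    calc _ ≤ ‖S - mainS t‖ + ‖δ * mainS t‖ := norm_sub_le _ _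
      _ ≤ 16800 * K1 * Real.sqrt t.re * ‖mainS t‖ + 401 * K1 * Real.sqrt t.re * ‖mainS t‖ := by
          rw [norm_mul]
          gcongr
          exact hδ.trans (by gcongr)
      _ = _ := by ring
  have hF : ‖FL t‖ = ‖(1 - z8) / TL t‖ * ‖mainS t‖ := by
    rw [← norm_mul, FL]; congr 1; ring
  rw [hF]
  calc _ ≤ ‖(1 - z8) / TL t‖ * (((16800 * K1 + 401 * K1) * Real.sqrt t.re * ‖mainS t‖) / (1 / 2)) := by
        gcongr
    _ = _ := by ring

theorem FL_eq {t : ℂ} (ht : 0 < t.re) : FL t = (2 * Real.sin (Real.pi / 8) : ℝ) * (Real.pi / t)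
    * ((2 * t / Real.pi) ^ (1 / 2 : ℂ) / (Real.sqrt 2 : ℝ)) * Complex.exp (-t / 8)
    * Complex.exp (Real.pi ^ 2 / 32 / t) := by
  have ht0 : t ≠ 0 := by rintro rfl; simp at ht
  have hp : (Real.pi : ℂ) ≠ 0 := by exact_mod_cast Real.pi_ne_zero
  have ha : (2 * t / Real.pi) ^ (1 / 2 : ℂ) ≠ 0 := by
    rw [Complex.cpow_ne_zero_iff]; left
    exact div_ne_zero (mul_ne_zero two_ne_zero ht0) hp
  have hs : (1 - z8) * (Complex.I * Complex.exp (-(Real.pi * Complex.I / 8))) = (2 * Real.sin (Real.pi / 8) : ℝ) := by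
    have := Complex.two_sin ((Real.pi / 8 : ℝ) : ℂ)
    push_cast at this ⊢
    rw [this]
    have e1 : z8 * Complex.exp (-(Real.pi * Complex.I / 8)) = Complex.exp (Real.pi / 8 * Complex.I) := by
      rw [z8, ← Complex.exp_add]; congr 1; ring
    have e2 : Complex.exp (-(Real.pi * Complex.I / 8)) = Complex.exp (-(Real.pi / 8) * Complex.I) := by
      congr 1; ring
    rw [← e1, ← e2]; ring
  have hE : Complex.exp (-(3 * Real.pi ^ 2 / 32) / t) = Complex.exp (t / 8 - Real.pi ^ 2 / (8 * t)) *
      (Complex.exp (-t / 8) * Complex.exp (Real.pi ^ 2 / 32 / t)) := by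
    rw [← Complex.exp_add, ← Complex.exp_add]; congr 1; field_simp; ring
  have hs2 : ((Real.sqrt 2 : ℝ) : ℂ) ≠ 0 := by
    have : Real.sqrt 2 ≠ 0 := by positivity
    exact_mod_cast this
  have hE0 := Complex.exp_ne_zero (t / 8 - Real.pi ^ 2 / (8 * t))
  rw [FL, mainS, TL, hE, ← hs]
  set A := (2 * t / Real.pi) ^ (1 / 2 : ℂ)
  field_simp

theorem Acoef_hasSum_qe {x : ℝ} (hx : 0 < x) (θ : ℝ) :
    HasSum (fun n : ℕ => Acoef 1 8 n * (qe x θ) ^ n) (Fq z8 (qe x θ)) :=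
  Acoef_hasSum rfl (qe_ne x θ) (qe_lt hx θ)

theorem Acoef_summable {x : ℝ} (hx : 0 < x) :
    Summable (fun n : ℕ => ‖Acoef 1 8 n‖ * Real.exp (-x) ^ n) := by
  have := (Acoef_hasSum_qe hx 0).summable.norm
  refine this.congr fun n => ?_
  rw [norm_mul, norm_pow, qe_norm]

theorem Fq_qe_cont {x : ℝ} (hx : 0 < x) : Continuous (fun θ : ℝ => Fq z8 (qe x θ)) := by
  have : (fun θ : ℝ => Fq z8 (qe x θ)) = fun θ => ∑' n : ℕ, Acoef 1 8 n * (qe x θ) ^ n := by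
    funext θ; exact (Acoef_hasSum_qe hx θ).tsum_eq.symm
  rw [this]
  refine continuous_tsum (fun n => ?_) (Acoef_summable hx) (fun n θ => ?_)
  · unfold qe; fun_prop
  · rw [norm_mul, norm_pow, qe_norm]

theorem cauchy_A {x : ℝ} (hx : 0 < x) (n : ℕ) :
    ∫ θ in (-Real.pi)..Real.pi, Fq z8 (qe x θ) * Complex.exp (n * (x + θ * Complex.I))
      = 2 * Real.pi * Acoef 1 8 n := by
  have hs := Acoef_summable hx
  have key := intervalIntegral.hasSum_integral_of_dominated_convergence
    (μ := MeasureTheory.volume) (a := -Real.pi) (b := Real.pi)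
    (F := fun (m : ℕ) (θ : ℝ) => Acoef 1 8 m * (qe x θ) ^ m * Complex.exp (n * (x + θ * Complex.I)))
    (f := fun θ : ℝ => Fq z8 (qe x θ) * Complex.exp (n * (x + θ * Complex.I)))
    (fun m _ => ‖Acoef 1 8 m‖ * Real.exp (-x) ^ m * Real.exp (n * x))
    (fun m => by
      apply Continuous.aestronglyMeasurable
      unfold qe; fun_prop)
    (fun m => by
      refine Filter.Eventually.of_forall fun θ _ => ?_
      rw [norm_mul, norm_mul, norm_pow, qe_norm, Complex.norm_exp]
      apply le_of_eq; congr 2; simp)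
    (Filter.Eventually.of_forall fun θ _ => hs.mul_right _)
    intervalIntegrable_const
    (Filter.Eventually.of_forall fun θ _ => (Acoef_hasSum_qe hx θ).mul_right _)
  have hterm : ∀ m : ℕ, (∫ θ in (-Real.pi)..Real.pi, Acoef 1 8 m * (qe x θ) ^ m
      * Complex.exp (n * (x + θ * Complex.I))) = if m = n then 2 * Real.pi * Acoef 1 8 n else 0 := by
    intro m
    have e : ∀ θ : ℝ, Acoef 1 8 m * (qe x θ) ^ m * Complex.exp (n * (x + θ * Complex.I))
        = Acoef 1 8 m * Complex.exp ((n - m) * x) * Complex.exp (((n - m) * Complex.I) * θ) := by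
      intro θ
      rw [qe, ← Complex.exp_nat_mul, mul_assoc, mul_assoc, ← Complex.exp_add, ← Complex.exp_add]
      congr 2; ring
    simp_rw [e]
    rw [intervalIntegral.integral_const_mul]
    split_ifs with h
    · subst h
      simp
      ring
    · have hne : ((n : ℂ) - m) ≠ 0 := by
        rw [sub_ne_zero]; exact fun h1 => h (by exact_mod_cast h1.symm)
      rw [integral_exp_mul_complex (mul_ne_zero hne Complex.I_ne_zero)]
      have : Complex.exp (((n : ℂ) - m) * Complex.I * (Real.pi : ℝ)) =
          Complex.exp (((n : ℂ) - m) * Complex.I * ((-Real.pi : ℝ) : ℂ)) := by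
        rw [Complex.exp_eq_exp_iff_exists_int]
        refine ⟨(n : ℤ) - m, ?_⟩
        push_cast; ring
      rw [this]; simp
  simp_rw [hterm] at key
  exact key.unique (hasSum_ite_eq n _)

noncomputable def cc : ℝ := Real.pi ^ 2 / 32
theorem cc_pos : 0 < cc := by unfold cc; positivity
noncomputable def kap (x : ℝ) : ℝ := Real.sqrt (x / cc)
theorem kap_pos {x : ℝ} (hx : 0 < x) : 0 < kap x := Real.sqrt_pos.2 (div_pos hx cc_pos)
noncomputable def WW (x u : ℝ) : ℂ := 1 + (kap x * u : ℝ) * Complex.I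
theorem WW_re (x u : ℝ) : (WW x u).re = 1 := by simp [WW]
theorem WW_im (x u : ℝ) : (WW x u).im = kap x * u := by simp [WW]
theorem WW_ne (x u : ℝ) : WW x u ≠ 0 := by
  intro h; have := WW_re x u; rw [h] at this; simp at this

noncomputable def Mker (x u : ℝ) : ℂ :=
  (2 * Real.sin (Real.pi / 8) * Real.sqrt Real.pi : ℝ) * ((WW x u)⁻¹ * (WW x u) ^ (1 / 2 : ℂ))
    * Complex.exp (-(x * WW x u) / 8) * Complex.exp (-((u : ℂ) ^ 2 / WW x u))

theorem Mker_eq {x : ℝ} (hx : 0 < x) (u : ℝ) :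
    (kap x * Real.sqrt cc * Real.exp (-(2 * cc / x)) : ℝ) *
      (FL (x * WW x u) * Complex.exp ((cc / x ^ 2 : ℝ) * (x * WW x u))) = Mker x u := by
  have hp := Real.pi_pos
  have hc := cc_pos
  have hW := WW_ne x u
  have hre : 0 < ((x : ℂ) * WW x u).re := by rw [Complex.re_ofReal_mul, WW_re]; linarith
  have hk : kap x * Real.sqrt cc = Real.sqrt x := by
    rw [kap, ← Real.sqrt_mul (by positivity), div_mul_cancel₀ _ hc.ne']
  have hk2 : kap x ^ 2 = x / cc := Real.sq_sqrt (by positivity)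
  have hpow : (2 * ((x : ℂ) * WW x u) / Real.pi) ^ (1 / 2 : ℂ)
      = (Real.sqrt 2 * Real.sqrt x / Real.sqrt Real.pi : ℝ) * (WW x u) ^ (1 / 2 : ℂ) := by
    have e : (2 * ((x : ℂ) * WW x u) / Real.pi) = ((2 * x / Real.pi : ℝ) : ℂ) * WW x u := by
      push_cast; ring
    have h0 : 0 < 2 * x / Real.pi := by positivity
    rw [e, Complex.cpow_def_of_ne_zero (mul_ne_zero (by exact_mod_cast h0.ne') hW),
      Complex.log_ofReal_mul h0 hW, Complex.cpow_def_of_ne_zero hW, add_mul, Complex.exp_add]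
    congr 1
    rw [← Real.sqrt_mul (by norm_num), ← Real.sqrt_div (by positivity)]
    rw [Real.sqrt_eq_rpow, Real.rpow_def_of_pos h0]
    push_cast
    rfl
  have hxC : (x : ℂ) ≠ 0 := by exact_mod_cast hx.ne'
  have hcC : (cc : ℂ) ≠ 0 := by exact_mod_cast hc.ne'
  have hk2C : (kap x : ℂ) ^ 2 = x / cc := by exact_mod_cast hk2
  have hexp : Complex.exp (Real.pi ^ 2 / 32 / ((x : ℂ) * WW x u)) =
      Complex.exp (2 * cc / x) * Complex.exp (-((cc / x ^ 2 : ℝ) * (x * WW x u)))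
        * Complex.exp (-((u : ℂ) ^ 2 / WW x u)) := by
    rw [← Complex.exp_add, ← Complex.exp_add]
    congr 1
    have e1 : ((Real.pi : ℂ) ^ 2 / 32) = (cc : ℂ) := by rw [cc]; push_cast; ring
    have e2 : (u : ℂ) ^ 2 = -((cc : ℂ) / x) * (WW x u - 1) ^ 2 := by
      rw [WW]; push_cast
      have : (1 + (kap x : ℂ) * u * Complex.I - 1) ^ 2 = - ((kap x : ℂ) ^ 2 * u ^ 2) := by
        linear_combination ((kap x : ℂ) * u) ^ 2 * Complex.I_sq
      rw [this, hk2C]; field_simp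
    rw [e1, e2]; push_cast
    field_simp
    ring
  have hsx : (Real.sqrt x : ℂ) ≠ 0 := by exact_mod_cast (Real.sqrt_pos.2 hx).ne'
  have hsp : (Real.sqrt Real.pi : ℂ) ≠ 0 := by exact_mod_cast (Real.sqrt_pos.2 hp).ne'
  have hs2 : (Real.sqrt 2 : ℂ) ≠ 0 := by
    have : Real.sqrt 2 ≠ 0 := by positivity
    exact_mod_cast this
  have hsx2 : (Real.sqrt x : ℂ) ^ 2 = x := by exact_mod_cast Real.sq_sqrt hx.le
  have hsp2 : (Real.sqrt Real.pi : ℂ) ^ 2 = Real.pi := by exact_mod_cast Real.sq_sqrt hp.le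
  have hE1 : ((Real.exp (-(2 * cc / x)) : ℝ) : ℂ) = (Complex.exp (2 * cc / x))⁻¹ := by
    rw [← Complex.exp_neg]; push_cast; rfl
  have hE2 : Complex.exp (-((cc / x ^ 2 : ℝ) * (x * WW x u))) =
    (Complex.exp ((cc / x ^ 2 : ℝ) * (x * WW x u)))⁻¹ := Complex.exp_neg _
  have hn1 := Complex.exp_ne_zero (2 * cc / x)
  have hn2 := Complex.exp_ne_zero ((cc / x ^ 2 : ℝ) * (x * WW x u))
  rw [FL_eq hre, hk, hpow, hexp, hE2, Mker, Complex.ofReal_mul (Real.sqrt x), hE1]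
  generalize Complex.exp (2 * cc / x) = E1 at *
  generalize Complex.exp ((cc / x ^ 2 : ℝ) * (x * WW x u)) = E2 at *
  generalize (WW x u) ^ (1 / 2 : ℂ) = P at *
  generalize Complex.exp (-((u : ℂ) ^ 2 / WW x u)) = E3 at *
  have hE4 : Complex.exp (-((x : ℂ) * WW x u) / 8) = Complex.exp (-(x * WW x u) / 8) := rfl
  generalize Complex.exp (-((x : ℂ) * WW x u) / 8) = E4 at *
  push_cast
  generalize (Real.sqrt x : ℂ) = a at *
  generalize (Real.sqrt Real.pi : ℂ) = b at *
  rw [← hsx2, ← hsp2]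
  field_simp

theorem Mker_norm {x : ℝ} (hx : 0 < x) {u : ℝ} (hu : |kap x * u| ≤ 20) :
    ‖Mker x u‖ ≤ 2 * Real.sqrt Real.pi * Real.exp (-(1 / 401) * u ^ 2) := by
  have hW := WW_ne x u
  have h1 : 1 ≤ ‖WW x u‖ := by
    have := Complex.abs_re_le_norm (WW x u)
    rw [WW_re, abs_one] at this; exact this
  rw [Mker, norm_mul, norm_mul, norm_mul, norm_mul, Complex.norm_exp, Complex.norm_exp, norm_inv]
  have hP : ‖WW x u ^ (1 / 2 : ℂ)‖ ≤ ‖WW x u‖ := by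
    have := Complex.norm_cpow_real (WW x u) (1 / 2)
    push_cast at this
    rw [this]
    calc ‖WW x u‖ ^ (1 / 2 : ℝ) ≤ ‖WW x u‖ ^ (1 : ℝ) := Real.rpow_le_rpow_of_exponent_le h1 (by norm_num)
      _ = _ := Real.rpow_one _
  have hP2 : ‖WW x u‖⁻¹ * ‖WW x u ^ (1 / 2 : ℂ)‖ ≤ 1 := by
    rw [inv_mul_le_iff₀ (by linarith)]; linarith
  have hs : ‖((2 * Real.sin (Real.pi / 8) * Real.sqrt Real.pi : ℝ) : ℂ)‖ ≤ 2 * Real.sqrt Real.pi := by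
    rw [Complex.norm_real, norm_mul, norm_mul, Real.norm_eq_abs, Real.norm_eq_abs, Real.norm_eq_abs,
      abs_of_nonneg (Real.sqrt_nonneg _)]
    have := Real.abs_sin_le_one (Real.pi / 8)
    have h2 : |(2 : ℝ)| = 2 := by norm_num
    rw [h2]
    nlinarith [Real.sqrt_nonneg Real.pi]
  have hE1 : Real.exp (-(x * WW x u) / 8 : ℂ).re ≤ 1 := by
    rw [Real.exp_le_one_iff]
    have : (-(x * WW x u) / 8 : ℂ) = ((-x / 8 : ℝ) : ℂ) * WW x u := by push_cast; ring
    rw [this, Complex.re_ofReal_mul, WW_re]; linarith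
  have hE2 : Real.exp (-((u : ℂ) ^ 2 / WW x u)).re ≤ Real.exp (-(1 / 401) * u ^ 2) := by
    apply Real.exp_le_exp.2
    have e : (-((u : ℂ) ^ 2 / WW x u)) = ((-u ^ 2 : ℝ) : ℂ) * (WW x u)⁻¹ := by push_cast; ring
    rw [e, Complex.re_ofReal_mul, Sect.r_eq, WW_re, WW_im]
    have hv : (kap x * u) ^ 2 ≤ 400 := by
      have := sq_le_sq' (by linarith [abs_nonneg (kap x * u)]) hu
      rw [sq_abs] at this; linarith
    have : 1 / 401 ≤ 1 / (1 ^ 2 + (kap x * u) ^ 2) := by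
      apply one_div_le_one_div_of_le (by positivity); linarith
    nlinarith [sq_nonneg u]
  calc _ ≤ (2 * Real.sqrt Real.pi) * 1 * 1 * Real.exp (-(1 / 401) * u ^ 2) := by
        gcongr
    _ = _ := by ring

theorem kap_tendsto : Tendsto kap (𝓝[>] 0) (𝓝 0) := by
  have : Tendsto kap (𝓝 0) (𝓝 (kap 0)) := by
    apply Continuous.tendsto; unfold kap; fun_prop
  simp only [kap, zero_div, Real.sqrt_zero] at this
  exact this.mono_left nhdsWithin_le_nhds

theorem Mker_tendsto (u : ℝ) : Tendsto (fun x => Mker x u) (𝓝[>] 0)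
    (𝓝 ((2 * Real.sin (Real.pi / 8) * Real.sqrt Real.pi : ℝ) * Real.exp (-1 * u ^ 2) : ℂ)) := by
  have hW : Tendsto (fun x => WW x u) (𝓝[>] 0) (𝓝 1) := by
    have h : Tendsto (fun x => kap x * u) (𝓝[>] 0) (𝓝 (0 * u)) := kap_tendsto.mul_const u
    have h2 := ((Complex.continuous_ofReal.tendsto _).comp h).mul_const Complex.I
    have h3 := h2.const_add (1 : ℂ)
    simpa [WW, Function.comp_def] using h3
  have hx : Tendsto (fun x : ℝ => (x : ℂ)) (𝓝[>] 0) (𝓝 0) := by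
    have := (Complex.continuous_ofReal.tendsto 0).mono_left (nhdsWithin_le_nhds (s := Set.Ioi 0))
    simpa using this
  have hP : Tendsto (fun x => WW x u ^ (1 / 2 : ℂ)) (𝓝[>] 0) (𝓝 (1 ^ (1 / 2 : ℂ))) :=
    hW.cpow tendsto_const_nhds (by simp [Complex.slitPlane])
  have hI := hW.inv₀ one_ne_zero
  have hE1 := (((hx.mul hW).neg.div_const 8).cexp)
  have hE2 := (((tendsto_const_nhds (x := (u : ℂ) ^ 2)).div hW one_ne_zero).neg).cexp
  have := (((hI.mul hP).const_mul ((2 * Real.sin (Real.pi / 8) * Real.sqrt Real.pi : ℝ) : ℂ)).mul hE1).mul hE2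
  unfold Mker
  convert this using 2 <;> simp

noncomputable def FI (x θ : ℝ) : ℂ :=
  Fq z8 (qe x θ) * Complex.exp ((cc / x ^ 2 : ℝ) * (x + θ * Complex.I))

theorem FI_cont {x : ℝ} (hx : 0 < x) : Continuous (FI x) := by
  unfold FI
  exact (Fq_qe_cont hx).mul (by fun_prop)

noncomputable def GG (x : ℝ) : ℝ → ℂ :=
  (Set.Ioc (-(20 / kap x)) (20 / kap x)).indicator
    (fun u => (kap x * Real.sqrt cc * Real.exp (-(2 * cc / x)) : ℝ) * FI x (x * kap x * u))

theorem GG_integral {x : ℝ} (hx : 0 < x) :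
    ∫ u, GG x u = (Real.sqrt cc / x * Real.exp (-(2 * cc / x)) : ℝ) * ∫ θ in (-(20 * x))..(20 * x), FI x θ := by
  have hk := kap_pos hx
  have h20 : -(20 / kap x) ≤ 20 / kap x := by
    have : 0 < 20 / kap x := by positivity
    linarith
  unfold GG
  rw [MeasureTheory.integral_indicator measurableSet_Ioc, ← intervalIntegral.integral_of_le h20,
    intervalIntegral.integral_const_mul, intervalIntegral.integral_comp_mul_left _ (by positivity)]
  have e1 : x * kap x * -(20 / kap x) = -(20 * x) := by field_simp
  have e2 : x * kap x * (20 / kap x) = 20 * x := by field_simp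
  rw [e1, e2, Complex.real_smul, ← mul_assoc, ← Complex.ofReal_mul]
  congr 2
  field_simp

theorem GG_near {C x0 : ℝ} (h : ∀ t : ℂ, Sect t → t.re ≤ x0 →
    ‖Fq z8 (Complex.exp (-t)) - FL t‖ ≤ C * Real.sqrt t.re * ‖FL t‖)
    {x : ℝ} (hx : 0 < x) (hx0 : x ≤ x0) {u : ℝ} (hu : |kap x * u| ≤ 20) :
    ‖((kap x * Real.sqrt cc * Real.exp (-(2 * cc / x)) : ℝ) : ℂ) * FI x (x * kap x * u) - Mker x u‖
      ≤ C * Real.sqrt x * ‖Mker x u‖ := by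
  have e : (x : ℂ) + ((x * kap x * u : ℝ) : ℂ) * Complex.I = x * WW x u := by
    rw [WW]; push_cast; ring
  have hre : ((x : ℂ) * WW x u).re = x := by rw [Complex.re_ofReal_mul, WW_re, mul_one]
  have him : ((x : ℂ) * WW x u).im = x * (kap x * u) := by rw [Complex.im_ofReal_mul, WW_im]
  have hS : Sect (x * WW x u) := by
    refine ⟨by rw [hre]; exact hx, ?_⟩
    rw [hre, him, abs_mul, abs_of_pos hx]
    nlinarith
  have hF := h _ hS (by rw [hre]; exact hx0)
  rw [hre] at hF
  rw [← Mker_eq hx, FI, qe, e, ← mul_sub, ← sub_mul, norm_mul, norm_mul, norm_mul, norm_mul]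
  calc _ ≤ ‖((kap x * Real.sqrt cc * Real.exp (-(2 * cc / x)) : ℝ) : ℂ)‖ *
        ((C * Real.sqrt x * ‖FL (x * WW x u)‖) * ‖Complex.exp ((cc / x ^ 2 : ℝ) * (x * WW x u))‖) := by
        gcongr
    _ = _ := by ring

theorem GG_mem {x u : ℝ} (hx : 0 < x) (hu : u ∈ Set.Ioc (-(20 / kap x)) (20 / kap x)) : |kap x * u| ≤ 20 := by
  have hk := kap_pos hx
  have h1 := hu.1.le
  have h2 := hu.2
  rw [← neg_div, div_le_iff₀ hk] at h1
  rw [le_div_iff₀ hk] at h2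
  rw [abs_le]; constructor <;> linarith

theorem GG_tendsto : Tendsto (fun x => ∫ u, GG x u) (𝓝[>] 0)
    (𝓝 ((2 * Real.pi * Real.sin (Real.pi / 8) : ℝ) : ℂ)) := by
  obtain ⟨C, x0, hC, hx0, hx01, h⟩ := F_near_one
  have hlim : ((2 * Real.pi * Real.sin (Real.pi / 8) : ℝ) : ℂ) =
      ∫ u : ℝ, ((2 * Real.sin (Real.pi / 8) * Real.sqrt Real.pi : ℝ) * Real.exp (-1 * u ^ 2) : ℂ) := by
    rw [MeasureTheory.integral_const_mul, integral_complex_ofReal, integral_gaussian, div_one,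
      ← Complex.ofReal_mul]
    congr 1
    rw [mul_assoc (2 * Real.sin _), Real.mul_self_sqrt Real.pi_pos.le]; ring
  rw [hlim]
  have hIoc : ∀ᶠ x : ℝ in 𝓝[>] 0, 0 < x ∧ x ≤ x0 := by
    have := Ioc_mem_nhdsGT hx0
    filter_upwards [this] with x hx using ⟨hx.1, hx.2⟩
  apply MeasureTheory.tendsto_integral_filter_of_dominated_convergence
    (fun u => (C + 1) * (2 * Real.sqrt Real.pi * Real.exp (-(1 / 401) * u ^ 2)))
  · filter_upwards [hIoc] with x hx
    unfold GG
    apply MeasureTheory.AEStronglyMeasurable.indicator _ measurableSet_Ioc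
    apply Continuous.aestronglyMeasurable
    have := FI_cont hx.1
    fun_prop
  · filter_upwards [hIoc] with x hx
    refine Eventually.of_forall fun u => ?_
    unfold GG
    rw [Set.indicator_apply]
    split_ifs with hu
    · have hu2 := GG_mem hx.1 hu
      have h1 := GG_near h hx.1 hx.2 hu2
      have h2 := Mker_norm hx.1 hu2
      have h3 := norm_le_norm_sub_add
        (((kap x * Real.sqrt cc * Real.exp (-(2 * cc / x)) : ℝ) : ℂ) * FI x (x * kap x * u)) (Mker x u)
      have h4 : Real.sqrt x ≤ 1 := by
        exact Real.sqrt_le_one.2 (by linarith [hx.2])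
      have h5 : C * Real.sqrt x * ‖Mker x u‖ ≤ C * 1 * ‖Mker x u‖ := by gcongr
      calc _ ≤ C * ‖Mker x u‖ + ‖Mker x u‖ := by linarith
        _ = (C + 1) * ‖Mker x u‖ := by ring
        _ ≤ _ := by gcongr
    · rw [norm_zero]; positivity
  · exact ((integrable_exp_neg_mul_sq (by norm_num)).const_mul _).const_mul _
  · refine Eventually.of_forall fun u => ?_
    have hM := Mker_tendsto u
    have hz : Tendsto (fun x => C * Real.sqrt x * ‖Mker x u‖) (𝓝[>] 0) (𝓝 0) := by
      have hs : Tendsto (fun x : ℝ => C * Real.sqrt x) (𝓝[>] 0) (𝓝 0) := by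
        have : Tendsto (fun x : ℝ => C * Real.sqrt x) (𝓝 0) (𝓝 (C * Real.sqrt 0)) := by
          apply Continuous.tendsto (f := fun x : ℝ => C * Real.sqrt x); fun_prop
        simp only [Real.sqrt_zero, mul_zero] at this
        exact this.mono_left nhdsWithin_le_nhds
      simpa using hs.mul hM.norm
    have hsmall : ∀ᶠ x : ℝ in 𝓝[>] 0, |kap x * u| < 20 := by
      have h1 := (kap_tendsto.mul_const u).abs
      simp only [zero_mul, abs_zero] at h1
      exact h1.eventually_lt_const (by norm_num)
    have hd : Tendsto (fun x => GG x u - Mker x u) (𝓝[>] 0) (𝓝 0) := by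
      rw [tendsto_zero_iff_norm_tendsto_zero]
      refine squeeze_zero' (Eventually.of_forall fun _ => norm_nonneg _) ?_ hz
      filter_upwards [hIoc, hsmall] with x hx hu
      have hk := kap_pos hx.1
      have hmem : u ∈ Set.Ioc (-(20 / kap x)) (20 / kap x) := by
        rw [abs_lt] at hu
        constructor
        · rw [← neg_div, div_lt_iff₀ hk]; linarith [hu.1]
        · rw [le_div_iff₀ hk]; linarith [hu.2]
      unfold GG
      rw [Set.indicator_of_mem hmem]
      exact GG_near h hx.1 hx.2 hu.le
    have := hd.add hM
    simpa using this

theorem FI_rest {x θ : ℝ} (hx : 0 < x) (hx1 : x ≤ 1 / 1000) (h1 : 20 * x ≤ |θ|) (h2 : |θ| ≤ Real.pi) :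
    ‖FI x θ‖ ≤ (17 + 9600 * K1) / x ^ 2 * Real.exp (0.295 / x) * Real.exp (cc / x) := by
  have hK := K1_nonneg
  have hE : ‖Complex.exp ((cc / x ^ 2 : ℝ) * (x + θ * Complex.I))‖ = Real.exp (cc / x) := by
    rw [Complex.norm_exp, Complex.re_ofReal_mul]
    congr 1
    simp
    field_simp
  rw [FI, norm_mul, hE]
  apply mul_le_mul_of_nonneg_right _ (Real.exp_pos _).le
  by_cases h3 : 20 * x ≤ |(|θ| - Real.pi / 2)|
  · refine (norm_F_minor hx hx1 h1 h2 h3).trans ?_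
    gcongr
    linarith
  · refine (norm_F_near_i hx hx1 (not_le.1 h3).le).trans ?_
    have hs : Real.sqrt (1 / x) ≤ 1 / x ^ 2 := by
      rw [Real.sqrt_le_left (by positivity), div_pow, one_pow]
      apply one_div_le_one_div_of_le (by positivity)
      calc (x ^ 2) ^ 2 = x ^ 3 * x := by ring
        _ ≤ 1 * x := by
          gcongr
          apply pow_le_one₀ hx.le; linarith
        _ = x := one_mul x
    calc _ ≤ 9600 * K1 * (1 / x ^ 2) * Real.exp (0.295 / x) := by
          gcongr; norm_num
      _ = (9600 * K1) / x ^ 2 * Real.exp (0.295 / x) := by ring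
      _ ≤ _ := by gcongr; linarith

theorem rest_bound {x : ℝ} (hx : 0 < x) (hx1 : x ≤ 1 / 1000) :
    ‖(∫ θ in (-Real.pi)..Real.pi, FI x θ) - ∫ θ in (-(20 * x))..(20 * x), FI x θ‖ ≤
      8 * ((17 + 9600 * K1) / x ^ 2 * Real.exp (0.295 / x) * Real.exp (cc / x)) := by
  have hp := Real.pi_gt_three
  have hp4 := Real.pi_le_four
  have hK := K1_nonneg
  have hc := FI_cont hx
  have hi : ∀ a b, IntervalIntegrable (FI x) MeasureTheory.volume a b := fun a b => hc.intervalIntegrable a b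
  rw [← intervalIntegral.integral_add_adjacent_intervals (hi (-Real.pi) (-(20 * x))) (hi (-(20 * x)) Real.pi),
    ← intervalIntegral.integral_add_adjacent_intervals (hi (-(20 * x)) (20 * x)) (hi (20 * x) Real.pi)]
  set B := (17 + 9600 * K1) / x ^ 2 * Real.exp (0.295 / x) * Real.exp (cc / x) with hB
  have hB0 : 0 ≤ B := by positivity
  have b1 : ‖∫ θ in (-Real.pi)..(-(20 * x)), FI x θ‖ ≤ B * |(-(20 * x)) - (-Real.pi)| := by
    apply intervalIntegral.norm_integral_le_of_norm_le_const
    intro θ hθ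
    rw [Set.uIoc_of_le (by linarith)] at hθ
    have : |θ| = -θ := abs_of_nonpos (by linarith [hθ.2])
    apply FI_rest hx hx1 <;> rw [this] <;> linarith [hθ.1, hθ.2]
  have b2 : ‖∫ θ in (20 * x)..Real.pi, FI x θ‖ ≤ B * |Real.pi - 20 * x| := by
    apply intervalIntegral.norm_integral_le_of_norm_le_const
    intro θ hθ
    rw [Set.uIoc_of_le (by linarith)] at hθ
    have : |θ| = θ := abs_of_nonneg (by linarith [hθ.1])
    apply FI_rest hx hx1 <;> rw [this] <;> linarith [hθ.1, hθ.2]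
  rw [abs_of_nonneg (by linarith)] at b1 b2
  have e : ∀ a b c : ℂ, a + (b + c) - b = a + c := fun a b c => by ring
  rw [e]
  refine (norm_add_le _ _).trans ?_
  nlinarith

theorem full_tendsto : Tendsto (fun x : ℝ => ((Real.sqrt cc / x * Real.exp (-(2 * cc / x)) : ℝ) : ℂ) *
    ∫ θ in (-Real.pi)..Real.pi, FI x θ) (𝓝[>] 0) (𝓝 ((2 * Real.pi * Real.sin (Real.pi / 8) : ℝ) : ℂ)) := by
  have hcc : 0 < cc - 0.295 := by
    unfold cc; nlinarith [Real.pi_gt_d2]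
  have hpos : ∀ᶠ x : ℝ in 𝓝[>] 0, 0 < x ∧ x ≤ 1 / 1000 := by
    have := Ioc_mem_nhdsGT (show (0 : ℝ) < 1 / 1000 by norm_num)
    filter_upwards [this] with x hx using ⟨hx.1, hx.2⟩
  have hd : Tendsto (fun x : ℝ => ((Real.sqrt cc / x * Real.exp (-(2 * cc / x)) : ℝ) : ℂ) *
      (∫ θ in (-Real.pi)..Real.pi, FI x θ) - ∫ u, GG x u) (𝓝[>] 0) (𝓝 0) := by
    have hz : Tendsto (fun x : ℝ => (Real.sqrt cc * 8 * (17 + 9600 * K1)) *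
        ((x⁻¹) ^ (3 : ℝ) * Real.exp (-(cc - 0.295) * x⁻¹))) (𝓝[>] 0) (𝓝 0) := by
      have := ((tendsto_rpow_mul_exp_neg_mul_atTop_nhds_zero 3 _ hcc).comp
        tendsto_inv_nhdsGT_zero).const_mul (Real.sqrt cc * 8 * (17 + 9600 * K1))
      simpa [Function.comp_def] using this
    rw [tendsto_zero_iff_norm_tendsto_zero]
    refine squeeze_zero' (Eventually.of_forall fun _ => norm_nonneg _) ?_ hz
    filter_upwards [hpos] with x hx
    obtain ⟨hx, hx1⟩ := hx
    rw [GG_integral hx, ← mul_sub, norm_mul, Complex.norm_real, Real.norm_of_nonneg (by positivity)]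
    refine (mul_le_mul_of_nonneg_left (rest_bound hx hx1) (by positivity)).trans (le_of_eq ?_)
    have e3 : (x⁻¹) ^ (3 : ℝ) = (x⁻¹) ^ (3 : ℕ) := by exact_mod_cast Real.rpow_natCast (x⁻¹) 3
    have e : Real.exp (-(cc - 0.295) * x⁻¹) = Real.exp (-(2 * cc / x)) * Real.exp (0.295 / x) * Real.exp (cc / x) := by
      rw [← Real.exp_add, ← Real.exp_add]; congr 1; field_simp; ring
    rw [e, e3]
    field_simp
  have := hd.add GG_tendsto
  simpa using this

theorem A_tendsto : Tendsto (fun n : ℕ => Acoef 1 8 n *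
    ((Real.sqrt n * Real.exp (-(2 * Real.sqrt (cc * n))) : ℝ) : ℂ)) atTop (𝓝 ((Real.sin (Real.pi / 8) : ℝ) : ℂ)) := by
  have hc := cc_pos
  have hx : Tendsto (fun n : ℕ => Real.sqrt (cc / n)) atTop (𝓝[>] 0) := by
    rw [tendsto_nhdsWithin_iff]
    constructor
    · have h1 : Tendsto (fun n : ℕ => cc / (n : ℝ)) atTop (𝓝 0) := tendsto_const_div_atTop_nhds_zero_nat cc
      have h2 := (Real.continuous_sqrt.tendsto 0).comp h1
      simpa [Function.comp_def] using h2
    · filter_upwards [eventually_gt_atTop 0] with n hn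
      have : (0 : ℝ) < n := by exact_mod_cast hn
      exact Real.sqrt_pos.2 (by positivity)
  have h := (full_tendsto.comp hx).const_mul ((2 * Real.pi : ℝ) : ℂ)⁻¹
  have hp : (Real.pi : ℂ) ≠ 0 := by exact_mod_cast Real.pi_ne_zero
  have hl : ((2 * Real.pi : ℝ) : ℂ)⁻¹ * ((2 * Real.pi * Real.sin (Real.pi / 8) : ℝ) : ℂ)
      = ((Real.sin (Real.pi / 8) : ℝ) : ℂ) := by
    rw [Complex.ofReal_mul (2 * Real.pi), ← mul_assoc, inv_mul_cancel₀ (by push_cast; exact mul_ne_zero two_ne_zero hp),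
      one_mul]
  rw [hl] at h
  refine h.congr' ?_
  filter_upwards [eventually_gt_atTop 0] with n hn
  have hn0 : (0 : ℝ) < n := by exact_mod_cast hn
  simp only [Function.comp_def]
  set x := Real.sqrt (cc / n) with hxd
  have hx0 : 0 < x := Real.sqrt_pos.2 (by positivity)
  have hx2 : x ^ 2 = cc / n := Real.sq_sqrt (by positivity)
  have hnx : cc / x ^ 2 = n := by rw [hx2]; field_simp
  have hI : (∫ θ in (-Real.pi)..Real.pi, FI x θ) = 2 * Real.pi * Acoef 1 8 n := by
    rw [← cauchy_A hx0 n]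
    unfold FI
    rw [hnx, Complex.ofReal_natCast]
  have e1 : Real.sqrt cc / x = Real.sqrt n := by
    rw [hxd, Real.sqrt_div hc.le, div_div_cancel₀ (Real.sqrt_pos.2 hc).ne']
  have e2 : cc / x = Real.sqrt (cc * n) := by
    have : cc / x = x * n := by
      rw [div_eq_iff hx0.ne', ← hnx]; field_simp
    rw [this, eq_comm, Real.sqrt_eq_iff_mul_self_eq (by positivity) (by positivity)]
    have : x * n * (x * n) = x ^ 2 * n * n := by ring
    rw [this, hx2]; field_simp
  have e3 : 2 * cc / x = 2 * Real.sqrt (cc * n) := by rw [← e2]; ring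
  rw [hI, e1, e3]
  push_cast
  field_simp

theorem R_tendsto : Tendsto (fun n : ℕ => Real.sqrt (8 * (n : ℝ) - 1) / Real.sqrt n *
    (Real.exp (2 * Real.sqrt (cc * n)) / Real.cosh (Real.pi * Real.sqrt (8 * (n : ℝ) - 1) / 8)))
    atTop (𝓝 (Real.sqrt 8 * 2)) := by
  have hp := Real.pi_pos
  have hN : Tendsto (fun n : ℕ => (n : ℝ)) atTop atTop := tendsto_natCast_atTop_atTop
  have h8 : Tendsto (fun n : ℕ => 8 * (n : ℝ) - 1) atTop atTop :=
    tendsto_atTop_add_const_right _ _ (hN.const_mul_atTop (by norm_num : (0 : ℝ) < 8))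
  have hsq : Tendsto (fun n : ℕ => Real.sqrt (8 * (n : ℝ) - 1)) atTop atTop := Real.tendsto_sqrt_atTop.comp h8
  refine Tendsto.mul ?_ ?_
  · have h1 : Tendsto (fun n : ℕ => 8 - 1 / (n : ℝ)) atTop (𝓝 (8 - 0)) :=
      tendsto_const_nhds.sub tendsto_one_div_atTop_nhds_zero_nat
    have h2 := (Real.continuous_sqrt.tendsto _).comp h1
    rw [sub_zero] at h2
    refine h2.congr' ?_
    filter_upwards [eventually_gt_atTop 0] with n hn
    have hn0 : (0 : ℝ) < n := by exact_mod_cast hn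
    simp only [Function.comp_def]
    rw [← Real.sqrt_div' _ hn0.le]
    congr 1; field_simp
  · have hdiff : Tendsto (fun n : ℕ => Real.pi / 8 * (Real.sqrt (8 * (n : ℝ)) - Real.sqrt (8 * (n : ℝ) - 1)))
        atTop (𝓝 0) := by
      have h1 : Tendsto (fun n : ℕ => Real.sqrt (8 * (n : ℝ)) - Real.sqrt (8 * (n : ℝ) - 1)) atTop (𝓝 0) := by
        refine squeeze_zero' (Eventually.of_forall fun n => ?_) ?_ hsq.inv_tendsto_atTop
        · exact sub_nonneg.2 (Real.sqrt_le_sqrt (by linarith))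
        · filter_upwards [h8.eventually_gt_atTop 0] with n hn
          have hs := Real.sqrt_pos.2 hn
          have ha := Real.sq_sqrt hn.le
          have hb := Real.sq_sqrt (show (0 : ℝ) ≤ 8 * (n : ℝ) by linarith)
          have hb0 := Real.sqrt_nonneg (8 * (n : ℝ))
          have hle : Real.sqrt (8 * (n : ℝ) - 1) ≤ Real.sqrt (8 * (n : ℝ)) := Real.sqrt_le_sqrt (by linarith)
          simp only [Pi.inv_apply]
          rw [← one_div, le_div_iff₀ hs]
          nlinarith
      simpa using h1.const_mul (Real.pi / 8)
    have hE := (Real.continuous_exp.tendsto 0).comp hdiff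
    have hy : Tendsto (fun n : ℕ => Real.exp (-(Real.pi / 4 * Real.sqrt (8 * (n : ℝ) - 1)))) atTop (𝓝 0) :=
      Real.tendsto_exp_neg_atTop_nhds_zero.comp (hsq.const_mul_atTop (by positivity : 0 < Real.pi / 4))
    have hD := (hE.const_mul 2).div (hy.const_add 1) (by norm_num)
    simp only [Real.exp_zero, add_zero, mul_one, div_one] at hD
    refine hD.congr' (Eventually.of_forall fun n => ?_)
    have e1 : 2 * Real.sqrt (cc * n) = Real.pi / 8 * Real.sqrt (8 * (n : ℝ)) := by
      have : cc * n = (Real.pi / 16) ^ 2 * (8 * n) := by unfold cc; ring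
      rw [this, Real.sqrt_mul (by positivity), Real.sqrt_sq (by positivity)]; ring
    simp only [Function.comp_def, Pi.div_apply]
    rw [e1, Real.cosh_eq]
    set s := Real.sqrt (8 * (n : ℝ) - 1)
    set r := Real.sqrt (8 * (n : ℝ))
    have e2 : Real.exp (Real.pi / 8 * (r - s)) = Real.exp (Real.pi / 8 * r) * Real.exp (-(Real.pi * s / 8)) := by
      rw [← Real.exp_add]; congr 1; ring
    have e3 : Real.exp (-(Real.pi / 4 * s)) = Real.exp (-(Real.pi * s / 8)) * Real.exp (-(Real.pi * s / 8)) := by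
      rw [← Real.exp_add]; congr 1; ring
    rw [e2, e3, Real.exp_neg (Real.pi * s / 8)]
    have hpos := Real.exp_pos (Real.pi * s / 8)
    generalize Real.exp (Real.pi * s / 8) = E at *
    field_simp

theorem Acoef_one_eighth_asymptotic :
    Filter.Tendsto
      (fun n : ℕ =>
        Acoef 1 8 n * ((Real.sqrt (8 * (n : ℝ) - 1) : ℝ) : ℂ) /
          (((4 * Real.sqrt 2 * Real.sin (Real.pi / 8) : ℝ) : ℂ) *
            ((Real.cosh (Real.pi * Real.sqrt (8 * (n : ℝ) - 1) / 8) : ℝ) : ℂ)))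
      Filter.atTop (nhds 1) := by
  have hsin : 0 < Real.sin (Real.pi / 8) :=
    Real.sin_pos_of_pos_of_lt_pi (by linarith [Real.pi_pos]) (by linarith [Real.pi_pos])
  have hR := ((Complex.continuous_ofReal.tendsto _).comp R_tendsto).const_mul
    ((4 * Real.sqrt 2 * Real.sin (Real.pi / 8) : ℝ) : ℂ)⁻¹
  have h := A_tendsto.mul hR
  have h8 : Real.sqrt 8 = 2 * Real.sqrt 2 := by
    rw [show (8 : ℝ) = 2 ^ 2 * 2 by norm_num, Real.sqrt_mul (by norm_num), Real.sqrt_sq (by norm_num)]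
  have hs2 : 0 < Real.sqrt 2 := by positivity
  have hl : ((Real.sin (Real.pi / 8) : ℝ) : ℂ) * (((4 * Real.sqrt 2 * Real.sin (Real.pi / 8) : ℝ) : ℂ)⁻¹
      * ((Real.sqrt 8 * 2 : ℝ) : ℂ)) = 1 := by
    rw [← Complex.ofReal_inv, ← Complex.ofReal_mul, ← Complex.ofReal_mul, ← Complex.ofReal_one, h8]
    congr 1
    field_simp
    norm_num
  rw [hl] at h
  refine h.congr' ?_
  filter_upwards [eventually_gt_atTop 0] with n hn
  have hn0 : (0 : ℝ) < n := by exact_mod_cast hn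
  have hsn := Real.sqrt_pos.2 hn0
  simp only [Function.comp_def]
  rw [Real.exp_neg]
  have hE := Real.exp_pos (2 * Real.sqrt (cc * n))
  have hC := Real.cosh_pos (Real.pi * Real.sqrt (8 * (n : ℝ) - 1) / 8)
  generalize Real.exp (2 * Real.sqrt (cc * n)) = E at *
  generalize Real.cosh (Real.pi * Real.sqrt (8 * (n : ℝ) - 1) / 8) = D at *
  generalize Real.sqrt (8 * (n : ℝ) - 1) = s at *
  generalize Real.sqrt (n : ℝ) = a at *
  generalize Real.sin (Real.pi / 8) = b at *
  generalize Real.sqrt 2 = c at *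
  have hE' : (E : ℂ) ≠ 0 := by exact_mod_cast hE.ne'
  have hD' : (D : ℂ) ≠ 0 := by exact_mod_cast hC.ne'
  have ha' : (a : ℂ) ≠ 0 := by exact_mod_cast hsn.ne'
  have hb' : (b : ℂ) ≠ 0 := by exact_mod_cast hsin.ne'
  have hc' : (c : ℂ) ≠ 0 := by exact_mod_cast hs2.ne'
  push_cast
  field_simp
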